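/- arXiv:2602.01145 — 9 statements merged into one kernel-verified Lean document; each statement's English description precedes it below -/
import Mathlib

section
/- Let R > 0 and let ρ̄ : ℝ → ℝ be a function of bounded variation with compact support satisfying 0 ≤ ρ̄(x) ≤ R for a.e. x, with L = ∫_ℝ ρ̄ > 0. Fix a positive integer N, set ℓ = L/N, and let x̄_0 < ⋯ < x̄_N be the ℓ-quantile points of ρ̄ (x̄_0 = min(supp ρ̄), x̄_{i+1} = min{ x ≥ x̄_i : ∫_{x̄_i}^x ρ̄ ≥ ℓ }), with R_i^0 = ℓ/(x̄_{i+1} − x̄_i). Then the piecewise constant function ρ_N^0(x) = Σ_{i=0}^{N−1} R_i^0 1_{[x̄_i, x̄_{i+1})}(x) satisfies TV(ρ_N^0) ≤ TV(ρ̄), where TV(ρ_N^0) = R_0^0 + Σ_{i=0}^{N−2} |R_{i+1}^0 − R_i^0| + R_{N−1}^0 and TV(ρ̄) is the total variation of ρ̄ on ℝ (computed for a good, e.g. right-continuous, representative). -/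
open MeasureTheory

/-- the piecewise constant initial discrete density built from the
ℓ-quantile points of `ρb` has total variation bounded by the total variation of `ρb`:
`R_0^0 + Σ_{i=0}^{N-2} |R_{i+1}^0 - R_i^0| + R_{N-1}^0 ≤ TV(ρb)`,
where `R_i^0 = ℓ/(x̄_{i+1} - x̄_i)`. -/
theorem initial_discrete_TV_bound
    (R L : ℝ) (ρb : ℝ → ℝ) (N : ℕ) (ℓ : ℝ) (xb : ℕ → ℝ)
    (hR : 0 < R) (hN : 0 < N)
    (hBV : BoundedVariationOn ρb Set.univ)
    (hsupp : HasCompactSupport ρb)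
    (hbound : ∀ᵐ x ∂(volume : Measure ℝ), ρb x ∈ Set.Icc 0 R)
    (hL : (∫ x, ρb x) = L) (hLpos : 0 < L)
    (hℓ : ℓ = L / N)
    (hx0 : xb 0 = sInf (tsupport ρb))
    (hquant : ∀ i < N, IsLeast {x : ℝ | xb i ≤ x ∧ ℓ ≤ ∫ y in (xb i)..x, ρb y} (xb (i + 1))) :
    ℓ / (xb 1 - xb 0)
      + (∑ i ∈ Finset.range (N - 1),
          |ℓ / (xb (i + 2) - xb (i + 1)) - ℓ / (xb (i + 1) - xb i)|)
      + ℓ / (xb N - xb (N - 1))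
    ≤ (eVariationOn ρb Set.univ).toReal := by
  obtain ⟨n, rfl⟩ : ∃ n, N = n + 1 := ⟨N - 1, by omega⟩
  have hint : Integrable ρb := by
    by_contra h
    rw [integral_undef h] at hL
    linarith
  have hii : ∀ a b, IntervalIntegrable ρb volume a b := fun a b => hint.intervalIntegrable
  have hℓpos : 0 < ℓ := by rw [hℓ]; positivity
  have hlt : ∀ i < n + 1, xb i < xb (i + 1) := by
    intro i hi
    obtain ⟨⟨h1, h2⟩, -⟩ := hquant i hi
    rcases h1.lt_or_eq with h | h
    · exact h
    · rw [← h, intervalIntegral.integral_same] at h2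
      linarith
  have heq : ∀ i < n + 1, ∫ y in (xb i)..(xb (i + 1)), ρb y = ℓ := by
    intro i hi
    obtain ⟨⟨h1, h2⟩, h3⟩ := hquant i hi
    have hc : ContinuousOn (fun x => ∫ y in (xb i)..x, ρb y) (Set.Icc (xb i) (xb (i + 1))) :=
      (intervalIntegral.continuous_primitive hii (xb i)).continuousOn
    have := intermediate_value_Icc h1 hc
    obtain ⟨z, hz, hz2⟩ := this (show ℓ ∈ _ from ⟨by simpa using hℓpos.le, h2⟩)
    have hle := h3 (show z ∈ _ from ⟨hz.1, hz2.ge⟩)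
    have hze : z = xb (i + 1) := le_antisymm hz.2 hle
    rw [← hze]
    exact hz2
  obtain ⟨M, hM⟩ := hsupp.isCompact.bddAbove
  obtain ⟨m, hm⟩ := hsupp.isCompact.bddBelow
  obtain ⟨A, hA0, hA⟩ : ∃ A, ρb A = 0 ∧ A ≤ xb 0 := by
    refine ⟨min (m - 1) (xb 0), ?_, min_le_right _ _⟩
    apply image_eq_zero_of_notMem_tsupport
    intro h
    have h1 := hm h
    have := min_le_left (m - 1) (xb 0)
    linarith
  obtain ⟨B, hB0, hB⟩ : ∃ B, ρb B = 0 ∧ xb (n + 1) ≤ B := by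
    refine ⟨max (M + 1) (xb (n + 1)), ?_, le_max_right _ _⟩
    apply image_eq_zero_of_notMem_tsupport
    intro h
    have h1 := hM h
    have := le_max_left (M + 1) (xb (n + 1))
    linarith
  let u : ℕ → ℝ → ℝ := fun k t => match k with
    | 0 => A
    | i + 1 => if i < n + 1 then (xb (i + 1) - xb i) * t + xb i else B
  let a : ℕ → ℝ := fun k => match k with
    | 0 => 0
    | i + 1 => if i < n + 1 then ℓ / (xb (i + 1) - xb i) else 0
  have hu_int : ∀ k, IntervalIntegrable (fun t => ρb (u k t)) volume 0 1 := by
    intro k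
    rcases k with _ | i
    · simp [u]
    · by_cases h : i < n + 1
      · simp only [u, h, if_true]
        have hc : xb (i + 1) - xb i ≠ 0 := (sub_pos.2 (hlt i h)).ne'
        exact ((hint.comp_add_right (xb i)).comp_mul_left' hc).intervalIntegrable
      · simp only [u, h, if_false]
        simp
  have hu_eq : ∀ k, ∫ t in (0:ℝ)..1, ρb (u k t) = a k := by
    intro k
    rcases k with _ | i
    · simp [u, a, hA0]
    · by_cases h : i < n + 1
      · simp only [u, a, h, if_true]
        have hc : xb (i + 1) - xb i ≠ 0 := (sub_pos.2 (hlt i h)).ne'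
        rw [intervalIntegral.integral_comp_mul_add _ hc]
        simp only [mul_zero, zero_add, mul_one, sub_add_cancel, heq i h, smul_eq_mul]
        rw [div_eq_inv_mul]
      · simp only [u, a, h, if_false, hB0]
        simp
  have hu_mono : ∀ t ∈ Set.Icc (0:ℝ) 1, Monotone (fun k => u k t) := by
    intro t ht
    have hlo : ∀ i < n + 1, xb i ≤ (xb (i + 1) - xb i) * t + xb i := by
      intro i hi
      have := mul_nonneg (sub_pos.2 (hlt i hi)).le ht.1
      linarith
    have hup : ∀ i < n + 1, (xb (i + 1) - xb i) * t + xb i ≤ xb (i + 1) := by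
      intro i hi
      have := mul_le_mul_of_nonneg_left ht.2 (sub_pos.2 (hlt i hi)).le
      linarith
    apply monotone_nat_of_le_succ
    intro k
    rcases k with _ | i
    · have := hlo 0 (by omega)
      simp only [u, Nat.succ_pos, if_true]
      exact hA.trans this
    · by_cases h : i + 1 < n + 1
      · have h' : i < n + 1 := by omega
        simp only [u, h, h', if_true]
        exact (hup i h').trans (hlo (i + 1) h)
      · by_cases h' : i < n + 1
        · have : i = n := by omega
          subst this
          simp only [u, h, h', if_true, if_false]
          exact (hup i h').trans hB
        · simp only [u, h, h', if_false]
          exact le_rfl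
  have hpt : ∀ t ∈ Set.Icc (0:ℝ) 1,
      ∑ k ∈ Finset.range (n + 2), |ρb (u (k + 1) t) - ρb (u k t)|
        ≤ (eVariationOn ρb Set.univ).toReal := by
    intro t ht
    have h := eVariationOn.sum_le (f := ρb) (s := Set.univ) (n := n + 2) (hu_mono t ht)
      (fun _ => Set.mem_univ _)
    have h2 := ENNReal.toReal_mono hBV h
    rw [ENNReal.toReal_sum (fun _ _ => edist_ne_top _ _)] at h2
    simpa [edist_dist, Real.dist_eq] using h2
  have hD : ∀ k, IntervalIntegrable (fun t => |ρb (u (k + 1) t) - ρb (u k t)|) volume 0 1 :=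
    fun k => ((hu_int (k + 1)).sub (hu_int k)).abs
  have key : ∑ k ∈ Finset.range (n + 2), |a (k + 1) - a k|
      ≤ (eVariationOn ρb Set.univ).toReal := by
    calc ∑ k ∈ Finset.range (n + 2), |a (k + 1) - a k|
        ≤ ∑ k ∈ Finset.range (n + 2), ∫ t in (0:ℝ)..1, |ρb (u (k + 1) t) - ρb (u k t)| := by
          apply Finset.sum_le_sum
          intro k _
          rw [← hu_eq k, ← hu_eq (k + 1), ← intervalIntegral.integral_sub (hu_int (k + 1)) (hu_int k)]
          exact intervalIntegral.abs_integral_le_integral_abs zero_le_one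
      _ = ∫ t in (0:ℝ)..1, ∑ k ∈ Finset.range (n + 2), |ρb (u (k + 1) t) - ρb (u k t)| := by
          rw [intervalIntegral.integral_finsetSum]
          exact fun k _ => hD k
      _ ≤ ∫ t in (0:ℝ)..1, (eVariationOn ρb Set.univ).toReal := by
          apply intervalIntegral.integral_mono_on zero_le_one _ _ hpt
          · rw [intervalIntegrable_iff]
            exact integrable_finsetSum _ (fun k _ => intervalIntegrable_iff.1 (hD k))
          · simp
      _ = _ := by simp
  refine le_trans (le_of_eq ?_) key
  rw [Finset.sum_range_succ, Finset.sum_range_succ']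
  have e0 : |a (0 + 1) - a 0| = ℓ / (xb 1 - xb 0) := by
    have := hlt 0 (by omega)
    simp only [a, Nat.succ_pos, if_true, sub_zero, zero_add]
    exact abs_of_pos (div_pos hℓpos (sub_pos.2 this))
  have e1 : |a (n + 1 + 1) - a (n + 1)| = ℓ / (xb (n + 1) - xb (n + 1 - 1)) := by
    have := hlt n (by omega)
    simp only [a, lt_irrefl, if_false, zero_sub, abs_neg, Nat.lt_succ_self, if_true,
      Nat.add_sub_cancel]
    exact abs_of_pos (div_pos hℓpos (sub_pos.2 this))
  rw [e0, e1, add_comm (ℓ / (xb 1 - xb 0))]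
  congr 2
  apply Finset.sum_congr (by simp)
  intro i hi
  have hi' : i < n := by simpa using hi
  have h1 : i + 1 < n + 1 := by omega
  have h2 : i < n + 1 := by omega
  simp only [a, h1, h2, if_true]
end

section
/- Consider the θ-scheme as defined in the context. Assume a particle configuration (x_i^m) is given and that R_{N−1}^0 ≤ R. Then for every m = 0,…,M−1 one has x_N^{m+1} − x_{N−1}^{m+1} ≥ x_N^m − x_{N−1}^m; equivalently 0 < R_{N−1}^{m+1} ≤ R_{N−1}^m ≤ R for all m. -/
/-- Discrete density `R_i^m = ℓ/(x_{i+1}^m - x_i^m)` for `i < N`, with the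
convention `R_N^m = 0`. -/
noncomputable def Rd (N : ℕ) (l : ℝ) (x : ℕ → ℕ → ℝ) (i m : ℕ) : ℝ :=
  if i < N then l / (x (i + 1) m - x i m) else 0

/-- A particle configuration for the θ-scheme with parameters `N, M, ℓ, τ`. -/
def IsScheme (N M : ℕ) (l τ θ : ℝ) (v : ℝ → ℝ) (x : ℕ → ℕ → ℝ) : Prop :=
  (∀ m ≤ M, ∀ i < N, x i m < x (i + 1) m) ∧
  (∀ m < M, x N (m + 1) = x N m + τ * v 0) ∧
  (∀ m < M, ∀ i < N,
    x i (m + 1) = x i m + τ * (θ * v (Rd N l x i m) + (1 - θ) * v (Rd N l x i (m + 1))))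

/-- the gap between the two rightmost particles is nondecreasing in time;
equivalently `0 < R_{N-1}^{m+1} ≤ R_{N-1}^m ≤ R` for all `m`, provided `R_{N-1}^0 ≤ R`. -/
theorem rightmost_gap_monotone
    (R T L θ Lv : ℝ) (N M : ℕ) (v : ℝ → ℝ) (ℓ τ : ℝ) (x : ℕ → ℕ → ℝ)
    (hR : 0 < R) (hT : 0 < T) (hLpos : 0 < L) (hN : 0 < N) (hM : 0 < M)
    (hθ : θ ∈ Set.Icc (0 : ℝ) 1)
    (hv : ContDiffOn ℝ 1 v (Set.Icc 0 R))
    (hv' : ∀ ρ ∈ Set.Icc (0 : ℝ) R, derivWithin v (Set.Icc 0 R) ρ < 0)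
    (hvleft : ∀ ρ < (0 : ℝ), v ρ = v 0)
    (hvright : ∀ ρ, R < ρ → v ρ = v R)
    (hLv : ∀ a ∈ Set.Icc (0 : ℝ) R, ∀ b ∈ Set.Icc (0 : ℝ) R, |v a - v b| ≤ Lv * |a - b|)
    (hℓ : ℓ = L / N) (hτ : τ = T / M)
    (hscheme : IsScheme N M ℓ τ θ v x)
    (hinit : Rd N ℓ x (N - 1) 0 ≤ R) :
    (∀ m < M, x N m - x (N - 1) m ≤ x N (m + 1) - x (N - 1) (m + 1)) ∧
    (∀ m ≤ M, 0 < Rd N ℓ x (N - 1) m ∧ Rd N ℓ x (N - 1) m ≤ R) ∧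
    (∀ m < M, Rd N ℓ x (N - 1) (m + 1) ≤ Rd N ℓ x (N - 1) m) := by
  obtain ⟨n, rfl⟩ : ∃ n, N = n + 1 := ⟨N - 1, by omega⟩
  obtain ⟨hord, hlead, hfol⟩ := hscheme
  have hn : n + 1 - 1 = n := by omega
  rw [hn] at *
  have hτ0 : 0 < τ := by
    rw [hτ]
    have : (0 : ℝ) < M := by exact_mod_cast hM
    positivity
  have hℓ0 : 0 < ℓ := by
    rw [hℓ]
    positivity
  have hanti : AntitoneOn v (Set.Icc 0 R) := by
    apply antitoneOn_of_deriv_nonpos (convex_Icc 0 R) hv.continuousOn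
    · exact (hv.differentiableOn (by norm_num)).mono interior_subset
    · intro y hy
      have h1 := hv' y (interior_subset hy)
      rw [derivWithin_of_mem_nhds (mem_interior_iff_mem_nhds.mp hy)] at h1
      exact h1.le
  have h0R : (0 : ℝ) ∈ Set.Icc (0 : ℝ) R := ⟨le_rfl, hR.le⟩
  have hRR : R ∈ Set.Icc (0 : ℝ) R := ⟨hR.le, le_rfl⟩
  have hvle : ∀ ρ, v ρ ≤ v 0 := by
    intro ρ
    rcases lt_or_ge ρ 0 with h | h
    · exact (hvleft ρ h).le
    · rcases lt_or_ge R ρ with h2 | h2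
      · rw [hvright ρ h2]
        exact hanti h0R hRR hR.le
      · exact hanti h0R ⟨h, h2⟩ h
  have hRd : ∀ m, Rd (n + 1) ℓ x n m = ℓ / (x (n + 1) m - x n m) := by
    intro m
    simp [Rd]
  have hgap : ∀ m ≤ M, 0 < x (n + 1) m - x n m := fun m hm =>
    sub_pos.mpr (hord m hm n (by omega))
  have h1 : ∀ m < M, x (n + 1) m - x n m ≤ x (n + 1) (m + 1) - x n (m + 1) := by
    intro m hm
    rw [hlead m hm, hfol m hm n (by omega)]
    have ha := mul_le_mul_of_nonneg_left (hvle (Rd (n + 1) ℓ x n m)) hθ.1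
    have hb := mul_le_mul_of_nonneg_left (hvle (Rd (n + 1) ℓ x n (m + 1))) (sub_nonneg.mpr hθ.2)
    have hc := mul_le_mul_of_nonneg_left (add_le_add ha hb) hτ0.le
    linarith
  have h3 : ∀ m < M, Rd (n + 1) ℓ x n (m + 1) ≤ Rd (n + 1) ℓ x n m := by
    intro m hm
    rw [hRd, hRd]
    exact div_le_div_of_nonneg_left hℓ0.le (hgap m hm.le) (h1 m hm)
  refine ⟨h1, ?_, h3⟩
  intro m hm
  refine ⟨by rw [hRd]; exact div_pos hℓ0 (hgap m hm), ?_⟩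
  induction m with
  | zero => exact hinit
  | succ k ih => exact (h3 k (by omega)).trans (ih (by omega))
end

section
/- Consider the θ-scheme as defined in the context and assume the CFL-type condition θ N T [v]_Lip R² < L M (equivalently θ τ [v]_Lip R² < ℓ). Assume a particle configuration (x_i^m) is given with R_i^0 ≤ R for all i = 0,…,N−1 (equivalently x_{i+1}^0 − x_i^0 ≥ ℓ/R). Then 0 < R_i^m ≤ R for all i = 0,…,N−1 and all m = 0,…,M; equivalently x_{i+1}^m − x_i^m ≥ ℓ/R for all i and m (discrete maximum principle). -/
/-- discrete maximum principle. Under the CFL-type condition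
`θ N T [v]_Lip R² < L M`, if `R_i^0 ≤ R` for all `i < N` then `0 < R_i^m ≤ R`
(equivalently `x_{i+1}^m - x_i^m ≥ ℓ/R`) for all `i < N` and `m ≤ M`. -/
theorem discrete_maximum_principle
    (R T L θ Lv : ℝ) (N M : ℕ) (v : ℝ → ℝ) (ℓ τ : ℝ) (x : ℕ → ℕ → ℝ)
    (hR : 0 < R) (hT : 0 < T) (hLpos : 0 < L) (hN : 0 < N) (hM : 0 < M)
    (hθ : θ ∈ Set.Icc (0 : ℝ) 1)
    (hv : ContDiffOn ℝ 1 v (Set.Icc 0 R))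
    (hv' : ∀ ρ ∈ Set.Icc (0 : ℝ) R, derivWithin v (Set.Icc 0 R) ρ < 0)
    (hvleft : ∀ ρ < (0 : ℝ), v ρ = v 0)
    (hvright : ∀ ρ, R < ρ → v ρ = v R)
    (hLv : ∀ a ∈ Set.Icc (0 : ℝ) R, ∀ b ∈ Set.Icc (0 : ℝ) R, |v a - v b| ≤ Lv * |a - b|)
    (hℓ : ℓ = L / N) (hτ : τ = T / M)
    (hCFL : θ * N * T * Lv * R ^ 2 < L * M)
    (hscheme : IsScheme N M ℓ τ θ v x)
    (hinit : ∀ i < N, Rd N ℓ x i 0 ≤ R) :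
    ∀ m ≤ M, ∀ i < N,
      (0 < Rd N ℓ x i m ∧ Rd N ℓ x i m ≤ R) ∧ ℓ / R ≤ x (i + 1) m - x i m := by
  obtain ⟨hθ0, hθ1⟩ := hθ
  obtain ⟨hord, hlast, hstep⟩ := hscheme
  have hN' : (0 : ℝ) < N := by exact_mod_cast hN
  have hM' : (0 : ℝ) < M := by exact_mod_cast hM
  have hℓ0 : 0 < ℓ := by rw [hℓ]; positivity
  have hτ0 : 0 < τ := by rw [hτ]; positivity
  have hanti : StrictAntiOn v (Set.Icc 0 R) := by
    apply strictAntiOn_of_deriv_neg (convex_Icc 0 R) hv.continuousOn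
    intro y hy
    rw [interior_Icc] at hy
    rw [← derivWithin_of_mem_nhds (Icc_mem_nhds hy.1 hy.2)]
    exact hv' y (Set.Ioo_subset_Icc_self hy)
  have hRmem : R ∈ Set.Icc (0 : ℝ) R := ⟨hR.le, le_refl R⟩
  have hvR : ∀ s, 0 ≤ s → v R ≤ v s := by
    intro s hs
    rcases le_or_gt s R with h | h
    · exact hanti.antitoneOn ⟨hs, h⟩ hRmem h
    · exact (hvright s h).ge
  have hLv0 : 0 ≤ Lv := by
    have h := (abs_nonneg _).trans (hLv R hRmem 0 ⟨le_refl 0, hR.le⟩)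
    rw [sub_zero, abs_of_pos hR] at h
    exact nonneg_of_mul_nonneg_left h hR
  have hcfl : θ * τ * Lv * R ^ 2 ≤ ℓ := by
    have h : θ * τ * Lv * R ^ 2 = θ * N * T * Lv * R ^ 2 / (N * M) := by
      rw [hτ]; field_simp
    rw [h, hℓ, div_le_div_iff₀ (by positivity) hN']
    nlinarith
  have hRd : ∀ m i, i < N → Rd N ℓ x i m = ℓ / (x (i + 1) m - x i m) := by
    intro m i hi
    simp [Rd, hi]
  have hRdpos : ∀ m ≤ M, ∀ i < N, 0 < Rd N ℓ x i m := by
    intro m hm i hi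
    rw [hRd m i hi]
    exact div_pos hℓ0 (sub_pos.2 (hord m hm i hi))
  have hRdnn : ∀ m ≤ M, ∀ i, 0 ≤ Rd N ℓ x i m := by
    intro m hm i
    by_cases hi : i < N
    · exact (hRdpos m hm i hi).le
    · simp [Rd, hi]
  have hstep' : ∀ m < M, ∀ i ≤ N, x i (m + 1) =
      x i m + τ * (θ * v (Rd N ℓ x i m) + (1 - θ) * v (Rd N ℓ x i (m + 1))) := by
    intro m hm i hi
    rcases hi.lt_or_eq with h | h
    · exact hstep m hm i h
    · subst h
      rw [hlast m hm]
      simp only [Rd, lt_irrefl, if_false]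
      ring
  have main : ∀ m ≤ M, ∀ i < N, Rd N ℓ x i m ≤ R := by
    intro m
    induction m with
    | zero => intro _ i hi; exact hinit i hi
    | succ m ih =>
      intro hm i hi
      by_contra! hlt
      have hmM : m ≤ M := by omega
      have hρ := ih hmM i hi
      have hρ0 := hRdpos m hmM i hi
      have e1 := hstep' m (by omega) i hi.le
      have e2 := hstep' m (by omega) (i + 1) hi
      rw [hvright _ hlt] at e1
      have a1 := hvR _ (hRdnn m hmM (i + 1))
      have a2 := hvR _ (hRdnn (m + 1) hm (i + 1))
      have a3 := hLv _ ⟨hρ0.le, hρ⟩ R hRmem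
      have hd : 0 < x (i + 1) m - x i m := sub_pos.2 (hord m hmM i hi)
      have hd1 : 0 < x (i + 1) (m + 1) - x i (m + 1) := sub_pos.2 (hord (m + 1) hm i hi)
      have hdef := hRd m i hi
      rw [hRd (m + 1) i hi, lt_div_iff₀ hd1] at hlt
      rw [eq_div_iff hd.ne'] at hdef
      rw [abs_of_nonpos (sub_nonpos.2 hρ)] at a3
      have a4 := (le_abs_self _).trans a3
      generalize Rd N ℓ x i m = ρ at *
      generalize hdd : x (i + 1) m - x i m = d at *
      -- lower bound on the new distance
      have b1 : 0 ≤ τ * θ * (v (Rd N ℓ x (i + 1) m) - v R) :=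
        mul_nonneg (by positivity) (by linarith)
      have b2 : 0 ≤ τ * (1 - θ) * (v (Rd N ℓ x (i + 1) (m + 1)) - v R) :=
        mul_nonneg (mul_nonneg hτ0.le (by linarith)) (by linarith)
      have b3 : τ * θ * (v ρ - v R) ≤ τ * θ * (Lv * -(ρ - R)) :=
        mul_le_mul_of_nonneg_left a4 (by positivity)
      have b4 : d - τ * θ * (Lv * -(ρ - R)) ≤ x (i + 1) (m + 1) - x i (m + 1) := by
        rw [e1, e2]; linarith
      -- `R (d - k (R - ρ)) ≥ ℓ`, with `k = θ τ Lv`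
      have b5 : R * (d - τ * θ * (Lv * -(ρ - R))) < ℓ :=
        (mul_le_mul_of_nonneg_left b4 hR.le).trans_lt hlt
      set k := θ * τ * Lv with hk
      have hk0 : 0 ≤ k := by positivity
      have b6 : k * R ≤ d := by
        have : ρ * d ≤ R * d := mul_le_mul_of_nonneg_right hρ hd.le
        have : R * (k * R) ≤ R * d := by linarith
        exact le_of_mul_le_mul_left this hR
      have b7 : 0 ≤ (R - ρ) * (d - k * R) := mul_nonneg (by linarith) (by linarith)
      have b8 : R * (d - τ * θ * (Lv * -(ρ - R))) = R * d - k * R * (R - ρ) := by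
        rw [hk]; ring
      linarith
  intro m hm i hi
  refine ⟨⟨hRdpos m hm i hi, main m hm i hi⟩, ?_⟩
  have h := main m hm i hi
  have hd : 0 < x (i + 1) m - x i m := sub_pos.2 (hord m hm i hi)
  rw [hRd m i hi, div_le_iff₀ hd] at h
  rw [div_le_iff₀ hR]
  linarith
end

section
/- Consider the θ-scheme as defined in the context and assume the CFL-type condition θ N T [v]_Lip R² < L M. Let ρ̄ : ℝ → ℝ be of bounded variation with compact support, 0 ≤ ρ̄ ≤ R a.e., L = ∫_ℝ ρ̄ > 0, and let x̄_0 < ⋯ < x̄_N be the ℓ-quantile points of ρ̄ (x̄_0 = min(supp ρ̄), x̄_{i+1} = min{ x ≥ x̄_i : ∫_{x̄_i}^x ρ̄ ≥ ℓ }). Then there exists a particle configuration (x_i^m) with x_i^0 = x̄_i for all i = 0,…,N and x_{i+1}^m − x_i^m ≥ ℓ/R for all i = 0,…,N−1 and m = 0,…,M. Consequently the discrete density ρ_N^M(x,t) = Σ_{m=0}^{M−1} Σ_{i=0}^{N−1} R_i^m 1_{[x_i^m, x_{i+1}^m)}(x) 1_{[t^m, t^{m+1})}(t) is well defined on ℝ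 × [0,T) and satisfies 0 ≤ ρ_N^M(x,t) ≤ R for all (x,t). -/
open MeasureTheory

/-- The fully discrete density
`ρ_N^M(y,t) = Σ_m Σ_i R_i^m 1_{[x_i^m, x_{i+1}^m)}(y) 1_{[t^m, t^{m+1})}(t)`. -/
noncomputable def discDens (N M : ℕ) (l τ : ℝ) (x : ℕ → ℕ → ℝ) (y t : ℝ) : ℝ :=
  ∑ m ∈ Finset.range M, ∑ i ∈ Finset.range N,
    Rd N l x i m * Set.indicator (Set.Ico (x i m) (x (i + 1) m)) (fun _ => (1 : ℝ)) y *
      Set.indicator (Set.Ico ((m : ℝ) * τ) (((m : ℝ) + 1) * τ)) (fun _ => (1 : ℝ)) t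

theorem solve_one (R l c a X : ℝ) (v : ℝ → ℝ) (hR : 0 < R) (hl : 0 < l) (hc : 0 ≤ c)
    (hcont : ContinuousOn v (Set.Icc 0 R)) (hanti : AntitoneOn v (Set.Icc 0 R))
    (h : a + c * v R ≤ X - l / R) :
    ∃ z, l / R ≤ X - z ∧ z = a + c * v (l / (X - z)) := by
  have hlR : 0 < l / R := div_pos hl hR
  set b := X - l / R with hb
  have hmem : ∀ z ≤ b, l / (X - z) ∈ Set.Icc 0 R := by
    intro z hz
    have h1 : l / R ≤ X - z := by linarith
    have h2 : 0 < X - z := by linarith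
    refine ⟨by positivity, ?_⟩
    rw [div_le_iff₀ h2]
    rw [div_le_iff₀ hR] at h1
    linarith
  set w := min b (a + c * v R) with hw
  have hwb : w ≤ b := min_le_left _ _
  have hf : ContinuousOn (fun z => z - (a + c * v (l / (X - z)))) (Set.Icc w b) := by
    apply continuousOn_id.sub
    apply continuousOn_const.add
    apply continuousOn_const.mul
    apply hcont.comp (t := Set.Icc 0 R)
    · apply continuousOn_const.div (by fun_prop)
      intro z hz
      have := hz.2
      intro h0
      linarith
    · intro z hz
      exact hmem z hz.2
  have h1 : w - (a + c * v (l / (X - w))) ≤ 0 := by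
    have hm := hmem w hwb
    have h3 : w ≤ a + c * v R := min_le_right _ _
    have h4 : v R ≤ v (l / (X - w)) := hanti hm ⟨hR.le, le_rfl⟩ hm.2
    have h5 := mul_le_mul_of_nonneg_left h4 hc
    linarith
  have h2 : 0 ≤ b - (a + c * v (l / (X - b))) := by
    have : l / (X - b) = R := by
      rw [hb]; field_simp; ring_nf
      try field_simp
    rw [this]; linarith
  obtain ⟨z, hz, hz0⟩ := intermediate_value_Icc hwb hf ⟨h1, h2⟩
  refine ⟨z, by linarith [hz.2], ?_⟩
  simp only at hz0
  linarith


/-- all gaps are at least `g` -/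
def GoodGaps (N : ℕ) (g : ℝ) (y : ℕ → ℝ) : Prop := ∀ i < N, g ≤ y (i + 1) - y i

/-- density of one time slice -/
noncomputable def rowDens (N : ℕ) (l : ℝ) (y : ℕ → ℝ) (i : ℕ) : ℝ :=
  if i < N then l / (y (i + 1) - y i) else 0

theorem rowDens_mem (N : ℕ) (R l : ℝ) (y : ℕ → ℝ) (hR : 0 < R) (hl : 0 < l)
    (i : ℕ) (hy : i < N → l / R ≤ y (i + 1) - y i) : rowDens N l y i ∈ Set.Icc 0 R := by
  unfold rowDens
  split_ifs with hi
  · have h1 := hy hi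
    have h2 : 0 < y (i + 1) - y i := lt_of_lt_of_le (div_pos hl hR) h1
    refine ⟨by positivity, ?_⟩
    rw [div_le_iff₀ h2]
    rw [div_le_iff₀ hR] at h1
    linarith
  · exact ⟨le_rfl, hR.le⟩

theorem gap_cfl (R l K g : ℝ) (hR : 0 < R) (hl : 0 < l) (hg : l / R ≤ g)
    (hcfl : K * R ^ 2 ≤ l) : K * (R - l / g) ≤ g - l / R := by
  have h2 : 0 < g := lt_of_lt_of_le (div_pos hl hR) hg
  have h3 : 0 ≤ R * g - l := by
    rw [div_le_iff₀ hR] at hg; linarith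
  have h4 : l ≤ R * g := by linarith
  have e1 : R - l / g = (R * g - l) / g := by field_simp
  have e2 : g - l / R = (R * g - l) / R := by field_simp
  rw [e1, e2, ← mul_div_assoc, div_le_div_iff₀ h2 hR]
  have h5 : K * R ≤ g := by
    by_contra! hcon
    nlinarith
  nlinarith [mul_le_mul_of_nonneg_left h5 h3]

theorem step_exists (R l θ Lv τ : ℝ) (N : ℕ) (v : ℝ → ℝ) (hR : 0 < R) (hl : 0 < l)
    (hτ : 0 < τ) (hθ : θ ∈ Set.Icc (0 : ℝ) 1)
    (hcont : ContinuousOn v (Set.Icc 0 R)) (hanti : AntitoneOn v (Set.Icc 0 R))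
    (hLv : ∀ a ∈ Set.Icc (0 : ℝ) R, ∀ b ∈ Set.Icc (0 : ℝ) R, |v a - v b| ≤ Lv * |a - b|)
    (hcfl : (τ * θ * Lv) * R ^ 2 ≤ l) (y : ℕ → ℝ) (hy : GoodGaps N (l / R) y) :
    ∃ z : ℕ → ℝ, GoodGaps N (l / R) z ∧ z N = y N + τ * v 0 ∧
      ∀ i < N, z i = y i + τ * (θ * v (rowDens N l y i) + (1 - θ) * v (rowDens N l z i)) := by
  obtain ⟨hθ0, hθ1⟩ := hθ
  have key : ∀ k ≤ N, ∃ z : ℕ → ℝ, z N = y N + τ * v 0 ∧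
      ∀ i < N, N - k ≤ i → l / R ≤ z (i + 1) - z i ∧
        z i = y i + τ * (θ * v (rowDens N l y i) + (1 - θ) * v (rowDens N l z i)) := by
    intro k
    induction k with
    | zero =>
      intro _
      exact ⟨fun _ => y N + τ * v 0, rfl, fun i hi hi' => by omega⟩
    | succ k ih =>
      intro hk
      obtain ⟨z, hzN, hz⟩ := ih (by omega)
      obtain ⟨j, hj⟩ : ∃ j, j + 1 = N - k := ⟨N - k - 1, by omega⟩
      have hjN : j < N := by omega
      have hzj : z (j + 1) = y (j + 1) + τ * (θ * v (rowDens N l y (j + 1)) +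
          (1 - θ) * v (rowDens N l z (j + 1))) := by
        by_cases h : j + 1 < N
        · exact (hz (j + 1) h (by omega)).2
        · have h' : j + 1 = N := by omega
          rw [h', hzN]; simp only [rowDens, lt_irrefl, if_false]; ring
      have m1 := rowDens_mem N R l y hR hl (j + 1) (fun h => hy _ h)
      have m2 := rowDens_mem N R l z hR hl (j + 1) (fun h => (hz _ h (by omega)).1)
      have m0 := rowDens_mem N R l y hR hl j (fun h => hy _ h)
      have mR : R ∈ Set.Icc 0 R := ⟨hR.le, le_rfl⟩
      have v1 := hanti m1 mR m1.2
      have v2 := hanti m2 mR m2.2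
      have v0 : v (rowDens N l y j) - v R ≤ Lv * (R - rowDens N l y j) := by
        have h1 := hLv _ m0 _ mR
        rw [abs_sub_comm (rowDens N l y j) R, abs_of_nonneg (sub_nonneg.2 m0.2)] at h1
        exact (le_abs_self _).trans h1
      have hgap := gap_cfl R l _ _ hR hl (hy j hjN) hcfl
      have hrj : rowDens N l y j = l / (y (j + 1) - y j) := by simp [rowDens, hjN]
      rw [← hrj] at hgap
      have hc : 0 ≤ τ * (1 - θ) := mul_nonneg hτ.le (by linarith)
      have hτθ : 0 ≤ τ * θ := mul_nonneg hτ.le hθ0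
      have q1 := mul_le_mul_of_nonneg_left v1 hτθ
      have q2 := mul_le_mul_of_nonneg_left v2 hc
      have q0 := mul_le_mul_of_nonneg_left v0 hτθ
      obtain ⟨w, hw1, hw2⟩ := solve_one R l (τ * (1 - θ))
        (y j + τ * θ * v (rowDens N l y j)) (z (j + 1)) v hR hl hc hcont hanti (by
          rw [hzj]; nlinarith)
      refine ⟨Function.update z j w, ?_, ?_⟩
      · rw [Function.update_of_ne (by omega), hzN]
      · intro i hi hji
        have u1 : Function.update z j w (i + 1) = z (i + 1) :=
          Function.update_of_ne (by omega) _ _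
        by_cases hij : i = j
        · subst hij
          simp only [rowDens, hi, if_true, u1, Function.update_self]
          refine ⟨hw1, ?_⟩
          simp only [rowDens, hi, if_true] at hw2
          linarith
        · have u0 : Function.update z j w i = z i := Function.update_of_ne hij _ _
          have hh := hz i hi (by omega)
          simp only [rowDens, hi, if_true, u1, u0] at hh ⊢
          exact hh
  obtain ⟨z, hzN, hz⟩ := key N le_rfl
  exact ⟨z, fun i hi => (hz i hi (by omega)).1, hzN, fun i hi => (hz i hi (by omega)).2⟩

theorem sum_le_of_single {s : Finset ℕ} {g : ℕ → ℝ} {R : ℝ} (hR : 0 ≤ R)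
    (hg : ∀ i ∈ s, g i ≤ R) (hu : ∀ i ∈ s, ∀ j ∈ s, i < j → g i ≠ 0 → g j = 0) :
    ∑ i ∈ s, g i ≤ R := by
  by_cases h : ∃ i ∈ s, g i ≠ 0
  · obtain ⟨i, hi, hi0⟩ := h
    rw [Finset.sum_eq_single_of_mem i hi]
    · exact hg i hi
    · intro j hj hji
      rcases lt_or_gt_of_ne hji with h | h
      · by_contra hj0
        exact hi0 (hu j hj i hi h hj0)
      · exact hu i hi j hj h hi0
  · push Not at h
    rw [Finset.sum_eq_zero h]; exact hR

theorem discDens_bounds (N M : ℕ) (R l τ : ℝ) (x : ℕ → ℕ → ℝ) (hR : 0 < R) (hl : 0 < l)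
    (hτ : 0 < τ) (hgap : ∀ m ≤ M, ∀ i < N, l / R ≤ x (i + 1) m - x i m) (y t : ℝ) :
    0 ≤ discDens N M l τ x y t ∧ discDens N M l τ x y t ≤ R := by
  have hmem : ∀ m ≤ M, ∀ i, Rd N l x i m ∈ Set.Icc 0 R := fun m hm i =>
    rowDens_mem N R l (fun i => x i m) hR hl i (fun h => hgap m hm i h)
  have hlR : 0 < l / R := div_pos hl hR
  have hmono : ∀ m ≤ M, ∀ j ≤ N, ∀ i ≤ j, x i m ≤ x j m := by
    intro m hm j
    induction j with
    | zero => intro _ i hi; rw [Nat.le_zero.1 hi]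
    | succ j ih =>
      intro hj i hi
      rcases Nat.lt_or_ge j i with h | h
      · have : i = j + 1 := by omega
        rw [this]
      · have h1 := ih (by omega) i h
        have h2 := hgap m hm j (by omega)
        linarith
  have hind : ∀ (S : Set ℝ) (u : ℝ), 0 ≤ S.indicator (fun _ => (1 : ℝ)) u ∧
      S.indicator (fun _ => (1 : ℝ)) u ≤ 1 := by
    intro S u
    by_cases h : u ∈ S <;> simp [h]
  unfold discDens
  refine ⟨?_, ?_⟩
  · refine Finset.sum_nonneg fun m hm => Finset.sum_nonneg fun i hi => ?_
    exact mul_nonneg (mul_nonneg (hmem m (Finset.mem_range.1 hm).le i).1 (hind _ _).1)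
      (hind _ _).1
  · apply sum_le_of_single hR.le
    · intro m hm
      have hm' := (Finset.mem_range.1 hm).le
      apply sum_le_of_single hR.le
      · intro i hi
        have h1 := hmem m hm' i
        calc _ ≤ R * 1 * 1 := by
              gcongr
              · exact (hind _ _).1
              · exact (hind _ _).1
              · exact h1.2
              · exact (hind _ _).2
              · exact (hind _ _).2
          _ = R := by ring
      · intro i hi j hj hij h0
        have hy : y ∈ Set.Ico (x i m) (x (i + 1) m) := by
          by_contra hn
          exact h0 (by simp [Set.indicator_of_notMem hn])
        have hn : y ∉ Set.Ico (x j m) (x (j + 1) m) := by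
          intro h
          have := hmono m hm' j (Finset.mem_range.1 hj).le (i + 1) hij
          linarith [hy.2, h.1]
        simp [Set.indicator_of_notMem hn]
    · intro m hm m' hm' hlt h0
      have ht : t ∈ Set.Ico ((m : ℝ) * τ) (((m : ℝ) + 1) * τ) := by
        by_contra hn
        exact h0 (by simp [Set.indicator_of_notMem hn])
      have hn : t ∉ Set.Ico ((m' : ℝ) * τ) (((m' : ℝ) + 1) * τ) := by
        intro h
        have h1 : (m : ℝ) + 1 ≤ m' := by exact_mod_cast hlt
        have := mul_le_mul_of_nonneg_right h1 hτ.le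
        linarith [ht.2, h.1]
      simp [Set.indicator_of_notMem hn]

/-- under the CFL-type condition there exists a particle configuration for
the θ-scheme starting from the ℓ-quantile points of `ρb`, with all gaps at least `ℓ/R`;
consequently the discrete density is well defined and satisfies `0 ≤ ρ_N^M ≤ R`. -/
theorem scheme_global_existence
    (R T L θ Lv : ℝ) (N M : ℕ) (v : ℝ → ℝ) (ℓ τ : ℝ) (ρb : ℝ → ℝ) (xb : ℕ → ℝ)
    (hR : 0 < R) (hT : 0 < T) (hLpos : 0 < L) (hN : 0 < N) (hM : 0 < M)
    (hθ : θ ∈ Set.Icc (0 : ℝ) 1)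
    (hv : ContDiffOn ℝ 1 v (Set.Icc 0 R))
    (hv' : ∀ ρ ∈ Set.Icc (0 : ℝ) R, derivWithin v (Set.Icc 0 R) ρ < 0)
    (hvleft : ∀ ρ < (0 : ℝ), v ρ = v 0)
    (hvright : ∀ ρ, R < ρ → v ρ = v R)
    (hLv : ∀ a ∈ Set.Icc (0 : ℝ) R, ∀ b ∈ Set.Icc (0 : ℝ) R, |v a - v b| ≤ Lv * |a - b|)
    (hBV : BoundedVariationOn ρb Set.univ)
    (hsupp : HasCompactSupport ρb)
    (hbound : ∀ᵐ z ∂(volume : Measure ℝ), ρb z ∈ Set.Icc 0 R)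
    (hLdef : (∫ z, ρb z) = L)
    (hℓ : ℓ = L / N) (hτ : τ = T / M)
    (hCFL : θ * N * T * Lv * R ^ 2 < L * M)
    (hx0 : xb 0 = sInf (tsupport ρb))
    (hquant : ∀ i < N, IsLeast {z : ℝ | xb i ≤ z ∧ ℓ ≤ ∫ s in (xb i)..z, ρb s} (xb (i + 1))) :
    ∃ x : ℕ → ℕ → ℝ,
      IsScheme N M ℓ τ θ v x ∧
      (∀ i ≤ N, x i 0 = xb i) ∧
      (∀ m ≤ M, ∀ i < N, ℓ / R ≤ x (i + 1) m - x i m) ∧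
      (∀ y t : ℝ, 0 ≤ discDens N M ℓ τ x y t ∧ discDens N M ℓ τ x y t ≤ R) := by
  have hN' : (0 : ℝ) < N := by exact_mod_cast hN
  have hM' : (0 : ℝ) < M := by exact_mod_cast hM
  have hl : 0 < ℓ := by rw [hℓ]; positivity
  have hτ0 : 0 < τ := by rw [hτ]; positivity
  have hcont := hv.continuousOn
  have hanti : AntitoneOn v (Set.Icc 0 R) := by
    apply (strictAntiOn_of_deriv_neg (convex_Icc 0 R) hcont _).antitoneOn
    intro ρ hρ
    have h1 := hv' ρ (interior_subset hρ)
    rwa [derivWithin_of_mem_nhds (mem_interior_iff_mem_nhds.1 hρ)] at h1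
  have hcfl : (τ * θ * Lv) * R ^ 2 ≤ ℓ := by
    rw [hℓ, hτ, le_div_iff₀ hN']
    have : T / M * θ * Lv * R ^ 2 * N = (θ * N * T * Lv * R ^ 2) / M := by ring
    rw [this, div_le_iff₀ hM']
    exact hCFL.le
  have hinit : GoodGaps N (ℓ / R) xb := by
    intro i hi
    obtain ⟨h1, h2⟩ := (hquant i hi).1
    have h3 := intervalIntegral.norm_integral_le_of_norm_le_const_ae (a := xb i)
      (b := xb (i + 1)) (f := ρb) (C := R) (by
        filter_upwards [hbound] with z hz _
        rw [Real.norm_eq_abs, abs_of_nonneg hz.1]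
        exact hz.2)
    rw [abs_of_nonneg (by linarith)] at h3
    rw [div_le_iff₀ hR]
    have := (Real.le_norm_self _).trans h3
    linarith
  have hstep := step_exists R ℓ θ Lv τ N v hR hl hτ0 hθ hcont hanti hLv hcfl
  choose F hF1 hF2 hF3 using hstep
  let Y : ℕ → {y : ℕ → ℝ // GoodGaps N (ℓ / R) y} := fun m =>
    Nat.rec ⟨xb, hinit⟩ (fun _ p => ⟨F p.1 p.2, hF1 p.1 p.2⟩) m
  have hgap : ∀ m ≤ M, ∀ i < N, ℓ / R ≤ (Y m).1 (i + 1) - (Y m).1 i :=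
    fun m _ i hi => (Y m).2 i hi
  refine ⟨fun i m => (Y m).1 i, ⟨?_, ?_, ?_⟩, fun i _ => rfl, hgap,
    discDens_bounds N M R ℓ τ _ hR hl hτ0 hgap⟩
  · intro m hm i hi
    have h1 := hgap m hm i hi
    have h2 : 0 < ℓ / R := div_pos hl hR
    show (Y m).1 i < (Y m).1 (i + 1)
    linarith
  · intro m _
    exact hF2 (Y m).1 (Y m).2
  · intro m _ i hi
    exact hF3 (Y m).1 (Y m).2 i hi
end

section
/- Consider the θ-scheme as defined in the context, assume the CFL-type condition θ N T [v]_Lip R² < L M, and let (x_i^m) be a particle configuration with 0 < R_i^m ≤ R for all i = 0,…,N−1 and m = 0,…,M. Define TV(ρ_N^m) = R_0^m + Σ_{i=0}^{N−2} |R_{i+1}^m − R_i^m| + R_{N−1}^m, the total variation of the piecewise constant discrete density ρ_N^m(x) = Σ_{i=0}^{N−1} R_i^m 1_{[x_i^m, x_{i+1}^m)}(x). Then for every m = 0,…,M−1 one has TV(ρ_N^{m+1}) ≤ TV(ρ_N^m) (discrete total variation diminishing property). -/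
/-- The total variation `TV(ρ_N^m) = R_0^m + Σ_{i=0}^{N-2} |R_{i+1}^m - R_i^m| + R_{N-1}^m`
of the piecewise constant discrete density at time step `m`. -/
noncomputable def TVd (N : ℕ) (l : ℝ) (x : ℕ → ℕ → ℝ) (m : ℕ) : ℝ :=
  Rd N l x 0 m + (∑ i ∈ Finset.range (N - 1), |Rd N l x (i + 1) m - Rd N l x i m|) +
    Rd N l x (N - 1) m

/-- Summation of a local Harten-type inequality. -/
lemma tv_sum_aux (p q : ℕ → ℝ) (n : ℕ)
    (h : ∀ i < n, |q (i + 1) - q i| + |q i - p i| ≤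
      |p (i + 1) - p i| + |q (i + 1) - p (i + 1)|) :
    q 0 + ∑ i ∈ Finset.range n, |q (i + 1) - q i| ≤
      p 0 + ∑ i ∈ Finset.range n, |p (i + 1) - p i| + |q n - p n| := by
  induction n with
  | zero =>
    have := le_abs_self (q 0 - p 0)
    simp only [Finset.range_zero, Finset.sum_empty]
    linarith
  | succ n ih =>
    rw [Finset.sum_range_succ, Finset.sum_range_succ]
    have h1 := ih (fun i hi => h i (by omega))
    have h2 := h n (by omega)
    linarith

/-- Explicit half step: the intermediate value lies between its neighbours. -/
lemma explicit_aux (R l k Lv : ℝ) (v : ℝ → ℝ) (hR : 0 < R) (hl : 0 < l) (hk : 0 ≤ k)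
    (hLv0 : 0 ≤ Lv) (hanti : AntitoneOn v (Set.Icc 0 R))
    (hLv : ∀ a ∈ Set.Icc (0 : ℝ) R, ∀ b ∈ Set.Icc (0 : ℝ) R, |v a - v b| ≤ Lv * |a - b|)
    (hC : k * Lv * R ^ 2 < l) (a a' H : ℝ) (ha : 0 < a) (haR : a ≤ R)
    (ha' : 0 ≤ a') (haR' : a' ≤ R) (hH : H = l / a + k * (v a' - v a)) :
    0 < H ∧ ((a ≤ l / H ∧ l / H ≤ a') ∨ (a' ≤ l / H ∧ l / H ≤ a)) := by
  have hkL : 0 ≤ k * Lv := mul_nonneg hk hLv0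
  have hprod : k * Lv * (a * a') ≤ l := by
    have : a * a' ≤ R ^ 2 := by nlinarith
    have := mul_le_mul_of_nonneg_left this hkL
    linarith
  have hHa : H * a = l + k * (v a' - v a) * a := by
    rw [hH]; field_simp
  rcases le_total a a' with h | h
  · have hv := hanti ⟨ha.le, haR⟩ ⟨ha', haR'⟩ h
    have hb := hLv a ⟨ha.le, haR⟩ a' ⟨ha', haR'⟩
    rw [abs_of_nonneg (by linarith), abs_of_nonpos (by linarith)] at hb
    have hb2 : k * (v a - v a') ≤ k * Lv * (a' - a) := by
      have := mul_le_mul_of_nonneg_left hb hk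
      linarith
    have ha'0 : 0 < a' := lt_of_lt_of_le ha h
    have key : l ≤ H * a' := by
      have h1 : H * a * a' = l * a' + k * (v a' - v a) * (a * a') := by rw [hHa]; ring
      have h2 : k * (v a - v a') * (a * a') ≤ k * Lv * (a' - a) * (a * a') :=
        mul_le_mul_of_nonneg_right hb2 (by positivity)
      have h3 : k * Lv * (a * a') * (a' - a) ≤ l * (a' - a) :=
        mul_le_mul_of_nonneg_right hprod (by linarith)
      have h4 : a * l ≤ a * (H * a') := by linarith
      exact le_of_mul_le_mul_left h4 ha
    have hHpos : 0 < H := by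
      by_contra hc
      nlinarith
    refine ⟨hHpos, Or.inl ⟨?_, ?_⟩⟩
    · rw [le_div_iff₀ hHpos]
      have : 0 ≤ k * (v a - v a') * a := by
        have : 0 ≤ v a - v a' := by linarith
        positivity
      linarith
    · rw [div_le_iff₀ hHpos]; linarith
  · have hv := hanti ⟨ha', haR'⟩ ⟨ha.le, haR⟩ h
    have hb := hLv a' ⟨ha', haR'⟩ a ⟨ha.le, haR⟩
    rw [abs_of_nonneg (by linarith), abs_of_nonpos (by linarith)] at hb
    have hb2 : k * (v a' - v a) ≤ k * Lv * (a - a') := by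
      have := mul_le_mul_of_nonneg_left hb hk
      linarith
    have hd : 0 ≤ k * (v a' - v a) := mul_nonneg hk (by linarith)
    have hHpos : 0 < H := by rw [hH]; positivity
    refine ⟨hHpos, Or.inr ⟨?_, ?_⟩⟩
    · rw [le_div_iff₀ hHpos]
      have h1 : H * a * a' = l * a' + k * (v a' - v a) * (a * a') := by rw [hHa]; ring
      have h2 : k * (v a' - v a) * (a * a') ≤ k * Lv * (a - a') * (a * a') :=
        mul_le_mul_of_nonneg_right hb2 (by positivity)
      have h3 : k * Lv * (a * a') * (a - a') ≤ l * (a - a') :=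
        mul_le_mul_of_nonneg_right hprod (by linarith)
      have h4 : a * (a' * H) ≤ a * l := by linarith
      exact le_of_mul_le_mul_left h4 ha
    · rw [div_le_iff₀ hHpos]
      have : 0 ≤ k * (v a' - v a) * a := by positivity
      linarith

/-- Implicit half step: `b` lies between the intermediate value and the next one. -/
lemma implicit_aux (R l k : ℝ) (v : ℝ → ℝ) (hl : 0 < l) (hk : 0 ≤ k)
    (hanti : AntitoneOn v (Set.Icc 0 R)) (b b' H : ℝ) (hb : 0 < b) (hbR : b ≤ R)
    (hb' : 0 ≤ b') (hbR' : b' ≤ R) (hHpos : 0 < H) (hH : H + k * (v b' - v b) = l / b) :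
    (l / H ≤ b ∧ b ≤ b') ∨ (b' ≤ b ∧ b ≤ l / H) := by
  have hHb : H * b + k * (v b' - v b) * b = l := by
    rw [← add_mul, hH]; field_simp
  rcases le_total b b' with h | h
  · have hv := hanti ⟨hb.le, hbR⟩ ⟨hb', hbR'⟩ h
    have : 0 ≤ k * (v b - v b') * b := mul_nonneg (mul_nonneg hk (by linarith)) hb.le
    refine Or.inl ⟨?_, h⟩
    rw [div_le_iff₀ hHpos]; linarith
  · have hv := hanti ⟨hb', hbR'⟩ ⟨hb.le, hbR⟩ h
    have : 0 ≤ k * (v b' - v b) * b := mul_nonneg (mul_nonneg hk (by linarith)) hb.le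
    refine Or.inr ⟨h, ?_⟩
    rw [le_div_iff₀ hHpos]; linarith

lemma between_abs (a c d : ℝ) (h : (a ≤ c ∧ c ≤ d) ∨ (d ≤ c ∧ c ≤ a)) :
    |d - a| = |d - c| + |c - a| := by
  rcases h with ⟨h1, h2⟩ | ⟨h1, h2⟩
  · rw [abs_of_nonneg, abs_of_nonneg, abs_of_nonneg] <;> linarith
  · rw [abs_of_nonpos, abs_of_nonpos, abs_of_nonpos] <;> linarith

lemma TVd_eq (N : ℕ) (l : ℝ) (x : ℕ → ℕ → ℝ) (m : ℕ) (hN : 0 < N)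
    (h : 0 < Rd N l x (N - 1) m) :
    TVd N l x m = Rd N l x 0 m +
      ∑ i ∈ Finset.range N, |Rd N l x (i + 1) m - Rd N l x i m| := by
  obtain ⟨n, rfl⟩ : ∃ n, N = n + 1 := ⟨N - 1, by omega⟩
  simp only [Nat.add_sub_cancel] at h
  have h0 : Rd (n + 1) l x (n + 1) m = 0 := by simp [Rd]
  rw [TVd, Finset.sum_range_succ, h0, zero_sub, abs_neg]
  simp only [Nat.add_sub_cancel]
  rw [abs_of_pos h]
  ring

/-- discrete total variation diminishing property: under the CFL-type
condition, `TV(ρ_N^{m+1}) ≤ TV(ρ_N^m)` for every `m = 0,…,M-1`. -/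
theorem discrete_TVD
    (R T L θ Lv : ℝ) (N M : ℕ) (v : ℝ → ℝ) (ℓ τ : ℝ) (x : ℕ → ℕ → ℝ)
    (hR : 0 < R) (hT : 0 < T) (hLpos : 0 < L) (hN : 0 < N) (hM : 0 < M)
    (hθ : θ ∈ Set.Icc (0 : ℝ) 1)
    (hv : ContDiffOn ℝ 1 v (Set.Icc 0 R))
    (hv' : ∀ ρ ∈ Set.Icc (0 : ℝ) R, derivWithin v (Set.Icc 0 R) ρ < 0)
    (hvleft : ∀ ρ < (0 : ℝ), v ρ = v 0)
    (hvright : ∀ ρ, R < ρ → v ρ = v R)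
    (hLv : ∀ a ∈ Set.Icc (0 : ℝ) R, ∀ b ∈ Set.Icc (0 : ℝ) R, |v a - v b| ≤ Lv * |a - b|)
    (hℓ : ℓ = L / N) (hτ : τ = T / M)
    (hCFL : θ * N * T * Lv * R ^ 2 < L * M)
    (hscheme : IsScheme N M ℓ τ θ v x)
    (hbnd : ∀ m ≤ M, ∀ i < N, 0 < Rd N ℓ x i m ∧ Rd N ℓ x i m ≤ R) :
    ∀ m < M, TVd N ℓ x (m + 1) ≤ TVd N ℓ x m := by
  obtain ⟨hord, hlast, hstep⟩ := hscheme
  intro m hm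
  have hNr : (0 : ℝ) < N := by exact_mod_cast hN
  have hMr : (0 : ℝ) < M := by exact_mod_cast hM
  have hl : 0 < ℓ := by rw [hℓ]; positivity
  have hτ0 : 0 < τ := by rw [hτ]; positivity
  have hanti : AntitoneOn v (Set.Icc 0 R) := by
    apply antitoneOn_of_deriv_nonpos (convex_Icc 0 R) hv.continuousOn
    · exact (hv.differentiableOn (by norm_num)).mono interior_subset
    · intro y hy
      have h1 := hv' y (interior_subset hy)
      rw [derivWithin_of_mem_nhds (mem_interior_iff_mem_nhds.mp hy)] at h1
      exact h1.le
  have hLv0 : 0 ≤ Lv := by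
    have h1 := (abs_nonneg _).trans (hLv R ⟨hR.le, le_rfl⟩ 0 ⟨le_rfl, hR.le⟩)
    rw [sub_zero, abs_of_pos hR] at h1
    exact nonneg_of_mul_nonneg_left h1 hR
  have hC : τ * θ * Lv * R ^ 2 < ℓ := by
    rw [hτ, hℓ, lt_div_iff₀ hNr]
    have : T / M * θ * Lv * R ^ 2 * N = (θ * N * T * Lv * R ^ 2) / M := by ring
    rw [this, div_lt_iff₀ hMr]
    exact hCFL
  have hkθ : 0 ≤ τ * θ := mul_nonneg hτ0.le hθ.1
  have hkθ' : 0 ≤ τ * (1 - θ) := mul_nonneg hτ0.le (by linarith [hθ.2])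
  have hRN : ∀ j, Rd N ℓ x N j = 0 := fun j => by simp [Rd]
  have hstep' : ∀ i ≤ N, x i (m + 1) =
      x i m + τ * (θ * v (Rd N ℓ x i m) + (1 - θ) * v (Rd N ℓ x i (m + 1))) := by
    intro i hi
    rcases hi.lt_or_eq with h | h
    · exact hstep m hm i h
    · rw [h, hRN, hRN, hlast m hm]; ring
  have hrange : ∀ j ≤ M, ∀ i ≤ N, 0 ≤ Rd N ℓ x i j ∧ Rd N ℓ x i j ≤ R := by
    intro j hj i hi
    rcases hi.lt_or_eq with h | h
    · exact ⟨(hbnd j hj i h).1.le, (hbnd j hj i h).2⟩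
    · rw [h, hRN]; exact ⟨le_rfl, hR.le⟩
  have hgap : ∀ j ≤ M, ∀ i < N, ℓ / Rd N ℓ x i j = x (i + 1) j - x i j := by
    intro j hj i hi
    have := hord j hj i hi
    rw [Rd, if_pos hi, div_div_cancel₀ hl.ne']
  rw [TVd_eq N ℓ x m hN (hbnd m hm.le _ (by omega)).1,
    TVd_eq N ℓ x (m + 1) hN (hbnd (m + 1) hm _ (by omega)).1]
  set a : ℕ → ℝ := fun i => Rd N ℓ x i m with ha
  set b : ℕ → ℝ := fun i => Rd N ℓ x i (m + 1) with hb
  set H : ℕ → ℝ := fun i => ℓ / a i + τ * θ * (v (a (i + 1)) - v (a i)) with hHdef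
  set c : ℕ → ℝ := fun i => if i < N then ℓ / H i else 0 with hc
  have hcN : c N = 0 := by simp [hc]
  have haN : a N = 0 := hRN m
  have hbN : b N = 0 := hRN (m + 1)
  have hex : ∀ i < N, 0 < H i ∧ ((a i ≤ c i ∧ c i ≤ a (i + 1)) ∨
      (a (i + 1) ≤ c i ∧ c i ≤ a i)) := by
    intro i hi
    have hci : c i = ℓ / H i := by simp [hc, hi]
    rw [hci]
    exact explicit_aux R ℓ (τ * θ) Lv v hR hl hkθ hLv0 hanti hLv hC (a i) (a (i + 1)) (H i)
      (hbnd m hm.le i hi).1 (hbnd m hm.le i hi).2 (hrange m hm.le (i + 1) hi).1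
      (hrange m hm.le (i + 1) hi).2 rfl
  have him : ∀ i < N, (c i ≤ b i ∧ b i ≤ b (i + 1)) ∨ (b (i + 1) ≤ b i ∧ b i ≤ c i) := by
    intro i hi
    have hci : c i = ℓ / H i := by simp [hc, hi]
    rw [hci]
    refine implicit_aux R ℓ (τ * (1 - θ)) v hl hkθ' hanti (b i) (b (i + 1)) (H i)
      (hbnd (m + 1) hm i hi).1 (hbnd (m + 1) hm i hi).2 (hrange (m + 1) hm (i + 1) hi).1
      (hrange (m + 1) hm (i + 1) hi).2 (hex i hi).1 ?_
    have e1 : ℓ / b i = _ := hgap (m + 1) hm i hi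
    have e2 : ℓ / a i = _ := hgap m hm.le i hi
    have e3 := hstep' i hi.le
    have e4 := hstep' (i + 1) hi
    simp only [hHdef]
    rw [e1, e2, e3, e4]
    ring
  have s1 := tv_sum_aux a c N (fun i hi => by
    have h1 := between_abs _ _ _ (hex i hi).2
    have h2 := abs_sub_le (c (i + 1)) (a (i + 1)) (c i)
    linarith)
  have s2 := tv_sum_aux c b N (fun i hi => by
    have h1 := between_abs _ _ _ (him i hi)
    have h2 := abs_sub_le (b (i + 1)) (c (i + 1)) (c i)
    linarith)
  rw [hcN, haN, sub_zero, abs_zero] at s1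
  rw [hcN, hbN, sub_zero, abs_zero] at s2
  linarith
end

section
/- Consider the θ-scheme as defined in the context and let (x_i^m) be a particle configuration with 0 < R_i^m ≤ R for all i = 0,…,N−1 and m = 0,…,M. For each m let ρ_N^m(x) = Σ_{i=0}^{N−1} R_i^m 1_{[x_i^m, x_{i+1}^m)}(x), F_N^m(x) = ∫_{−∞}^x ρ_N^m(y) dy, and X_N^m(z) = inf{ x : F_N^m(x) ≥ z } for z ∈ (0, L). Let 0 ≤ t₁ ≤ t₂ ≤ T and let m₁ ≤ m₂ be such that t₁ ∈ [t^{m₁}, t^{m₁+1}) and t₂ ∈ [t^{m₂}, t^{m₂+1}). Then ∫_0^L |X_N^{m₂}(z) − X_N^{m₁}(z)| dz ≤ 4 L V (t₂ − t₁ + τ), where V = max(|v(0)|, |v(R)|). (The left-hand side is the scaled 1-Wasserstein distance d₁(ρ_N^{m₂}, ρ_N^{m₁}).) -/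
open MeasureTheory

/-- The cumulative distribution function `F(x) = ∫_{-∞}^x Σ_{i<N} R_i 1_{[xs_i, xs_{i+1})}`. -/
noncomputable def cdf (N : ℕ) (l : ℝ) (xs : ℕ → ℝ) (y : ℝ) : ℝ :=
  ∫ s in Set.Iic y,
    (∑ i ∈ Finset.range N,
      (l / (xs (i + 1) - xs i)) *
        Set.indicator (Set.Ico (xs i) (xs (i + 1))) (fun _ => (1 : ℝ)) s)

/-- The pseudo-inverse `X(z) = inf { x : F(x) ≥ z }` of the CDF. -/
noncomputable def pinv (N : ℕ) (l : ℝ) (xs : ℕ → ℝ) (z : ℝ) : ℝ :=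
  sInf {y : ℝ | z ≤ cdf N l xs y}

lemma aux_ind (a b y : ℝ) (hab : a < b) :
    ∫ s in Set.Iic y, Set.indicator (Set.Ico a b) (fun _ => (1 : ℝ)) s
      = max 0 (min b y - a) := by
  rw [integral_indicator measurableSet_Ico, Measure.restrict_restrict measurableSet_Ico]
  simp only [integral_const, smul_eq_mul, mul_one, measureReal_restrict_apply_univ]
  rcases le_or_gt b y with h | h
  · have : Set.Ico a b ∩ Set.Iic y = Set.Ico a b := by
      ext s; simp only [Set.mem_inter_iff, Set.mem_Ico, Set.mem_Iic]
      constructor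
      · exact fun h => h.1
      · intro h'; exact ⟨h', by linarith [h'.2]⟩
    rw [this, min_eq_left h, Real.volume_real_Ico, max_comm]
  · have : Set.Ico a b ∩ Set.Iic y = Set.Icc a y := by
      ext s; simp only [Set.mem_inter_iff, Set.mem_Ico, Set.mem_Iic, Set.mem_Icc]
      constructor
      · exact fun h => ⟨h.1.1, h.2⟩
      · intro h'; exact ⟨⟨h'.1, by linarith [h'.2]⟩, h'.2⟩
    rw [this, min_eq_right h.le, Real.volume_real_Icc, max_comm]

lemma aux_cdf (N : ℕ) (l : ℝ) (xs : ℕ → ℝ) (hx : ∀ i < N, xs i < xs (i + 1)) (y : ℝ) :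
    cdf N l xs y = ∑ i ∈ Finset.range N,
      (l / (xs (i + 1) - xs i)) * max 0 (min (xs (i + 1)) y - xs i) := by
  unfold cdf
  rw [integral_finset_sum]
  · refine Finset.sum_congr rfl fun i hi => ?_
    rw [integral_const_mul, aux_ind _ _ _ (hx i (Finset.mem_range.1 hi))]
  · intro i hi
    refine Integrable.const_mul ?_ _
    refine Integrable.integrableOn ?_
    rw [integrable_indicator_iff measurableSet_Ico]
    exact integrableOn_const (by simp)

lemma aux_mono (N : ℕ) (xs : ℕ → ℝ) (hx : ∀ i < N, xs i < xs (i + 1)) (j k : ℕ)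
    (hjk : j ≤ k) (hk : k ≤ N) : xs j ≤ xs k := by
  induction k, hjk using Nat.le_induction with
  | base => exact le_rfl
  | succ n hn ih => exact (ih (by omega)).trans (hx n (by omega)).le

lemma aux_val (N : ℕ) (l : ℝ) (xs : ℕ → ℝ) (hx : ∀ i < N, xs i < xs (i + 1)) (i : ℕ)
    (hi : i < N) (s : ℝ) (h0 : 0 ≤ s) (h1 : s ≤ 1) :
    cdf N l xs (xs i + s * (xs (i + 1) - xs i)) = (i + s) * l := by
  rw [aux_cdf N l xs hx]
  have hd := hx i hi
  set y := xs i + s * (xs (i + 1) - xs i) with hy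
  have hy0 : xs i ≤ y := by nlinarith
  have hy1 : y ≤ xs (i + 1) := by nlinarith
  rw [← Finset.sum_subset (s₁ := Finset.range (i + 1)) (by
      intro j hj; simp only [Finset.mem_range] at *; omega)]
  · rw [Finset.sum_range_succ]
    have e : ∀ j ∈ Finset.range i,
        (l / (xs (j + 1) - xs j)) * max 0 (min (xs (j + 1)) y - xs j) = l := by
      intro j hj
      have hj := Finset.mem_range.1 hj
      have := hx j (by omega)
      have h2 := aux_mono N xs hx (j + 1) i (by omega) (by omega)
      rw [min_eq_left (by linarith), max_eq_right (by linarith)]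
      have : xs (j + 1) - xs j ≠ 0 := by linarith
      field_simp
    rw [Finset.sum_congr rfl e, min_eq_right hy1, max_eq_right (by linarith)]
    have : xs (i + 1) - xs i ≠ 0 := by linarith
    simp only [Finset.sum_const, Finset.card_range, nsmul_eq_mul]
    rw [hy]
    field_simp
    ring
  · intro j hj hj'
    simp only [Finset.mem_range] at *
    have h2 := aux_mono N xs hx (i + 1) j (by omega) (by omega)
    rw [max_eq_left, mul_zero]
    have := min_le_right (xs (j + 1)) y
    linarith

lemma aux_cdf_mono (N : ℕ) (l : ℝ) (hl : 0 < l) (xs : ℕ → ℝ)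
    (hx : ∀ i < N, xs i < xs (i + 1)) : Monotone (cdf N l xs) := by
  intro y y' h
  rw [aux_cdf N l xs hx, aux_cdf N l xs hx]
  refine Finset.sum_le_sum fun i hi => ?_
  have := hx i (Finset.mem_range.1 hi)
  refine mul_le_mul_of_nonneg_left ?_ (div_nonneg hl.le (by linarith))
  exact max_le_max le_rfl (sub_le_sub_right (min_le_min le_rfl h) _)

lemma aux_pinv (N : ℕ) (l : ℝ) (hl : 0 < l) (xs : ℕ → ℝ)
    (hx : ∀ i < N, xs i < xs (i + 1)) (i : ℕ)
    (hi : i < N) (s : ℝ) (h0 : 0 < s) (h1 : s ≤ 1) :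
    pinv N l xs ((i + s) * l) = xs i + s * (xs (i + 1) - xs i) := by
  refine IsLeast.csInf_eq ⟨?_, ?_⟩
  · exact (aux_val N l xs hx i hi s h0.le h1).ge
  · intro y hy
    by_contra! hlt
    have hd := hx i hi
    have hd' : 0 < xs (i + 1) - xs i := by linarith
    have hy : (i + s) * l ≤ cdf N l xs y := hy
    set s' := max 0 ((y - xs i) / (xs (i + 1) - xs i)) with hs'
    have hs's : s' < s := max_lt h0 (by rw [div_lt_iff₀ hd']; linarith)
    have hs0 : 0 ≤ s' := le_max_left _ _
    have hle : y ≤ xs i + s' * (xs (i + 1) - xs i) := by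
      have := le_max_right 0 ((y - xs i) / (xs (i + 1) - xs i))
      rw [← hs', div_le_iff₀ hd'] at this
      linarith
    have := aux_cdf_mono N l hl xs hx hle
    rw [aux_val N l xs hx i hi s' hs0 (by linarith)] at this
    nlinarith

lemma aux_vel (R : ℝ) (hR : 0 < R) (v : ℝ → ℝ) (hv : ContDiffOn ℝ 1 v (Set.Icc 0 R))
    (hv' : ∀ ρ ∈ Set.Icc (0 : ℝ) R, derivWithin v (Set.Icc 0 R) ρ < 0)
    (r : ℝ) (h0 : 0 ≤ r) (h1 : r ≤ R) : |v r| ≤ max |v 0| |v R| := by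
  have ha : AntitoneOn v (Set.Icc 0 R) := by
    refine antitoneOn_of_deriv_nonpos (convex_Icc 0 R) hv.continuousOn
      ((hv.differentiableOn (by simp)).mono interior_subset) ?_
    intro y hy
    have := hv' y (interior_subset hy)
    rw [derivWithin_of_mem_nhds (mem_interior_iff_mem_nhds.1 hy)] at this
    exact this.le
  have a := ha (a := 0) (b := r) ⟨le_rfl, hR.le⟩ ⟨h0, h1⟩ h0
  have b := ha (a := r) (b := R) ⟨h0, h1⟩ ⟨hR.le, le_rfl⟩ h1
  exact (abs_le_max_abs_abs b a).trans (max_comm _ _).le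

/-- time oscillation estimate in the scaled 1-Wasserstein distance:
`∫_0^L |X_N^{m₂}(z) - X_N^{m₁}(z)| dz ≤ 4 L V (t₂ - t₁ + τ)`, `V = max(|v 0|, |v R|)`. -/
theorem wasserstein_time_estimate
    (R T L θ Lv : ℝ) (N M : ℕ) (v : ℝ → ℝ) (ℓ τ : ℝ) (x : ℕ → ℕ → ℝ)
    (t₁ t₂ : ℝ) (m₁ m₂ : ℕ)
    (hR : 0 < R) (hT : 0 < T) (hLpos : 0 < L) (hN : 0 < N) (hM : 0 < M)
    (hθ : θ ∈ Set.Icc (0 : ℝ) 1)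
    (hv : ContDiffOn ℝ 1 v (Set.Icc 0 R))
    (hv' : ∀ ρ ∈ Set.Icc (0 : ℝ) R, derivWithin v (Set.Icc 0 R) ρ < 0)
    (hvleft : ∀ ρ < (0 : ℝ), v ρ = v 0)
    (hvright : ∀ ρ, R < ρ → v ρ = v R)
    (hLv : ∀ a ∈ Set.Icc (0 : ℝ) R, ∀ b ∈ Set.Icc (0 : ℝ) R, |v a - v b| ≤ Lv * |a - b|)
    (hℓ : ℓ = L / N) (hτ : τ = T / M)
    (hscheme : IsScheme N M ℓ τ θ v x)
    (hbnd : ∀ m ≤ M, ∀ i < N, 0 < Rd N ℓ x i m ∧ Rd N ℓ x i m ≤ R)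
    (ht₁ : 0 ≤ t₁) (ht₁₂ : t₁ ≤ t₂) (ht₂ : t₂ ≤ T) (hm₁₂ : m₁ ≤ m₂)
    (hm₁ : t₁ ∈ Set.Ico ((m₁ : ℝ) * τ) (((m₁ : ℝ) + 1) * τ))
    (hm₂ : t₂ ∈ Set.Ico ((m₂ : ℝ) * τ) (((m₂ : ℝ) + 1) * τ)) :
    (∫ z in (0 : ℝ)..L,
        |pinv N ℓ (fun i => x i m₂) z - pinv N ℓ (fun i => x i m₁) z|) ≤
      4 * L * max |v 0| |v R| * (t₂ - t₁ + τ) := by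
  have hNr : (0 : ℝ) < N := by exact_mod_cast hN
  have hMr : (0 : ℝ) < M := by exact_mod_cast hM
  have hl : 0 < ℓ := by rw [hℓ]; positivity
  have hτp : 0 < τ := by rw [hτ]; positivity
  have hT' : T = M * τ := by rw [hτ]; field_simp
  have hL' : L = N * ℓ := by rw [hℓ]; field_simp
  have hm₂M : m₂ ≤ M := by
    have : (m₂ : ℝ) * τ ≤ M * τ := by linarith [hm₂.1]
    exact_mod_cast le_of_mul_le_mul_right this hτp
  obtain ⟨hs1, hs2, hs3⟩ := hscheme
  set V := max |v 0| |v R| with hV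
  have hV0 : 0 ≤ V := (abs_nonneg _).trans (le_max_left _ _)
  have hstep : ∀ m < M, ∀ i ≤ N, |x i (m + 1) - x i m| ≤ τ * V := by
    intro m hm i hi
    rcases hi.lt_or_eq with hi | rfl
    · rw [hs3 m hm i hi, add_sub_cancel_left, abs_mul, abs_of_pos hτp]
      refine mul_le_mul_of_nonneg_left ?_ hτp.le
      have b1 := hbnd m hm.le i hi
      have b2 := hbnd (m + 1) hm i hi
      have a1 := abs_le.1 (aux_vel R hR v hv hv' _ b1.1.le b1.2)
      have a2 := abs_le.1 (aux_vel R hR v hv hv' _ b2.1.le b2.2)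
      rw [← hV] at a1 a2
      have t0 := hθ.1
      have t1 : 0 ≤ 1 - θ := by linarith [hθ.2]
      rw [abs_le]
      constructor
      · nlinarith [mul_le_mul_of_nonneg_left a1.1 t0, mul_le_mul_of_nonneg_left a2.1 t1]
      · nlinarith [mul_le_mul_of_nonneg_left a1.2 t0, mul_le_mul_of_nonneg_left a2.2 t1]
    · rw [hs2 m hm, add_sub_cancel_left, abs_mul, abs_of_pos hτp]
      exact mul_le_mul_of_nonneg_left (le_max_left _ _) hτp.le
  have hmany : ∀ m, m₁ ≤ m → m ≤ M → ∀ i ≤ N,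
      |x i m - x i m₁| ≤ ((m : ℝ) - m₁) * (τ * V) := by
    intro m hm
    induction m, hm using Nat.le_induction with
    | base => intro _ i _; simp
    | succ n hn ih =>
      intro h i hi
      have h1 := ih (by omega) i hi
      have h2 := hstep n (by omega) i hi
      have h3 := abs_sub_le (x i (n + 1)) (x i n) (x i m₁)
      push_cast
      linarith
  have hD := hmany m₂ hm₁₂ hm₂M
  have hpt : ∀ z ∈ Set.uIoc 0 L,
      ‖|pinv N ℓ (fun i => x i m₂) z - pinv N ℓ (fun i => x i m₁) z|‖
        ≤ ((m₂ : ℝ) - m₁) * (τ * V) := by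
    intro z hz
    rw [Set.uIoc_of_le hLpos.le] at hz
    obtain ⟨hz0, hzL⟩ := hz
    have hq : 0 < z / ℓ := div_pos hz0 hl
    have hc : 0 < ⌈z / ℓ⌉₊ := Nat.ceil_pos.2 hq
    have hcN : ⌈z / ℓ⌉₊ ≤ N := Nat.ceil_le.2 (by rw [div_le_iff₀ hl]; linarith)
    obtain ⟨i, hi⟩ : ∃ i, ⌈z / ℓ⌉₊ = i + 1 := ⟨⌈z / ℓ⌉₊ - 1, by omega⟩
    have hiN : i < N := by omega
    have c1 := Nat.le_ceil (z / ℓ)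
    have c2 := Nat.ceil_lt_add_one hq.le
    rw [hi] at c1 c2
    push_cast at c1 c2
    obtain ⟨s, hs⟩ : ∃ s, s = z / ℓ - i := ⟨_, rfl⟩
    have hs0 : 0 < s := by linarith
    have hs1' : s ≤ 1 := by linarith
    have hze : z = (i + s) * ℓ := by rw [hs]; field_simp; ring
    rw [hze, aux_pinv N ℓ hl _ (hs1 m₂ hm₂M) i hiN s hs0 hs1',
      aux_pinv N ℓ hl _ (hs1 m₁ (hm₁₂.trans hm₂M)) i hiN s hs0 hs1', Real.norm_eq_abs, abs_abs]
    have d1 := abs_le.1 (hD i hiN.le)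
    have d2 := abs_le.1 (hD (i + 1) hiN)
    have t1 : 0 ≤ 1 - s := by linarith
    rw [abs_le]
    constructor
    · nlinarith [mul_le_mul_of_nonneg_left d1.1 t1, mul_le_mul_of_nonneg_left d2.1 hs0.le]
    · nlinarith [mul_le_mul_of_nonneg_left d1.2 t1, mul_le_mul_of_nonneg_left d2.2 hs0.le]
  have hint := intervalIntegral.norm_integral_le_of_norm_le_const hpt
  rw [sub_zero, abs_of_pos hLpos] at hint
  refine (Real.le_norm_self _).trans (hint.trans ?_)
  have hdt : ((m₂ : ℝ) - m₁) * τ ≤ t₂ - t₁ + τ := by linarith [hm₂.1, hm₁.2]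
  have hLV : 0 ≤ L * V := by positivity
  have hpos : 0 ≤ L * V * (t₂ - t₁ + τ) := mul_nonneg hLV (by linarith)
  have := mul_le_mul_of_nonneg_left hdt hLV
  nlinarith
end

section
/- Consider the θ-scheme as defined in the context and let (x_i^m) be a particle configuration with 0 < R_i^m ≤ R for all i = 0,…,N−1 and m = 0,…,M, and such that the discrete total variations satisfy TV(ρ_N^m) = R_0^m + Σ_{i=0}^{N−2} |R_{i+1}^m − R_i^m| + R_{N−1}^m ≤ TV(ρ̄) for all m, where ρ̄ is a compactly supported BV function with ∫_ℝ ρ̄ = L and 0 ≤ ρ̄ ≤ R. Let ρ_N^m(x) = Σ_{i=0}^{N−1} R_i^m 1_{[x_i^m, x_{i+1}^m)}(x). Let 0 ≤ t₁ ≤ t₂ ≤ T with t₁ ∈ [t^{m₁}, t^{m₁+1}) and t₂ ∈ [t^{m₂}, t^{m₂+1}). Then ∫_ℝ |ρ_N^{m₂}(x) − ρ_N^{m₁}(x)| dx ≤ 4 (2 TV(ρ̄) L V)^{1/2} (t₂ − t₁ + τ)^{1/2}, where V = max(|v(0)|, |v(R)|). -/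
open MeasureTheory

/-- The piecewise constant density `ρ_N^m = Σ_{i<N} R_i^m 1_{[x_i^m, x_{i+1}^m)}`. -/
noncomputable def pcDens (N : ℕ) (l : ℝ) (x : ℕ → ℕ → ℝ) (m : ℕ) (y : ℝ) : ℝ :=
  ∑ i ∈ Finset.range N,
    Rd N l x i m * Set.indicator (Set.Ico (x i m) (x (i + 1) m)) (fun _ => (1 : ℝ)) y

/-- Heaviside difference bound. -/
lemma aux_heav (a h y s : ℝ) (h1 : y ≤ s) (h2 : s ≤ y + h) :
    |(Set.Ici a).indicator (fun _ => (1 : ℝ)) s - (Set.Ici a).indicator (fun _ => (1 : ℝ)) y| ≤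
      (Set.Ico (a - h) a).indicator (fun _ => (1 : ℝ)) y := by
  by_cases hs : a ≤ s
  · by_cases hy : a ≤ y
    · rw [Set.indicator_of_mem (Set.mem_Ici.2 hs), Set.indicator_of_mem (Set.mem_Ici.2 hy),
        Set.indicator_of_notMem (by simp [hy])]
      simp
    · rw [Set.indicator_of_mem (Set.mem_Ici.2 hs), Set.indicator_of_notMem (by simpa using hy),
        Set.indicator_of_mem (by constructor <;> linarith)]
      simp
  · have hy : ¬ a ≤ y := by intro h; exact hs (h.trans h1)
    rw [Set.indicator_of_notMem (by simpa using hs), Set.indicator_of_notMem (by simpa using hy)]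
    simp only [sub_self, abs_zero]
    exact Set.indicator_nonneg (fun _ _ => zero_le_one) _

lemma aux_Ico (a b y : ℝ) (hab : a ≤ b) :
    (Set.Ico a b).indicator (fun _ => (1 : ℝ)) y =
      (Set.Ici a).indicator (fun _ => (1 : ℝ)) y - (Set.Ici b).indicator (fun _ => (1 : ℝ)) y := by
  simp only [Set.indicator, Set.mem_Ico, Set.mem_Ici]
  by_cases h1 : a ≤ y <;> by_cases h2 : b ≤ y
  · simp [h1, h2]
  · simp [h1, h2, not_le.1 h2]
  · exact absurd (hab.trans h2) h1
  · simp [h1, h2]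

lemma aux_abel (r H : ℕ → ℝ) (n : ℕ) :
    ∑ i ∈ Finset.range (n + 1), r i * (H i - H (i + 1)) =
      r 0 * H 0 + (∑ i ∈ Finset.range n, (r (i + 1) - r i) * H (i + 1)) - r n * H (n + 1) := by
  induction n with
  | zero => simp; ring
  | succ n ih =>
    rw [Finset.sum_range_succ, ih, Finset.sum_range_succ]
    ring

/-- the majorant -/
noncomputable def auxG (r X : ℕ → ℝ) (n : ℕ) (h y : ℝ) : ℝ :=
  |r 0| * (Set.Ico (X 0 - h) (X 0)).indicator (fun _ => (1 : ℝ)) y +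
  (∑ i ∈ Finset.range n, |r (i + 1) - r i| *
    (Set.Ico (X (i + 1) - h) (X (i + 1))).indicator (fun _ => (1 : ℝ)) y) +
  |r n| * (Set.Ico (X (n + 1) - h) (X (n + 1))).indicator (fun _ => (1 : ℝ)) y

lemma aux_ptw (r X : ℕ → ℝ) (n : ℕ) (hX : ∀ i < n + 1, X i < X (i + 1)) (h y s : ℝ)
    (h1 : y ≤ s) (h2 : s ≤ y + h) :
    |(∑ i ∈ Finset.range (n + 1), r i * (Set.Ico (X i) (X (i + 1))).indicator (fun _ => (1 : ℝ)) s) -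
      (∑ i ∈ Finset.range (n + 1), r i * (Set.Ico (X i) (X (i + 1))).indicator (fun _ => (1 : ℝ)) y)|
      ≤ auxG r X n h y := by
  have key : ∀ z, (∑ i ∈ Finset.range (n + 1),
      r i * (Set.Ico (X i) (X (i + 1))).indicator (fun _ => (1 : ℝ)) z) =
      r 0 * (Set.Ici (X 0)).indicator (fun _ => (1 : ℝ)) z +
      (∑ i ∈ Finset.range n, (r (i + 1) - r i) *
        (Set.Ici (X (i + 1))).indicator (fun _ => (1 : ℝ)) z) -
      r n * (Set.Ici (X (n + 1))).indicator (fun _ => (1 : ℝ)) z := by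
    intro z
    rw [← aux_abel r (fun i => (Set.Ici (X i)).indicator (fun _ => (1 : ℝ)) z)]
    refine Finset.sum_congr rfl fun i hi => ?_
    rw [aux_Ico _ _ _ (hX i (Finset.mem_range.1 hi)).le]
  rw [key, key]
  have e : ∀ a b c a' b' c' : ℝ, a + b - c - (a' + b' - c') = (a - a') + (b - b') + -(c - c') := by
    intros; ring
  rw [e, ← mul_sub, ← mul_sub, ← Finset.sum_sub_distrib]
  unfold auxG
  refine (abs_add_three _ _ _).trans ?_
  rw [abs_neg, abs_mul, abs_mul]
  refine add_le_add_three ?_ ?_ ?_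
  · exact mul_le_mul_of_nonneg_left (aux_heav _ _ _ _ h1 h2) (abs_nonneg _)
  · refine (Finset.abs_sum_le_sum_abs _ _).trans (Finset.sum_le_sum fun i _ => ?_)
    rw [← mul_sub, abs_mul]
    exact mul_le_mul_of_nonneg_left (aux_heav _ _ _ _ h1 h2) (abs_nonneg _)
  · exact mul_le_mul_of_nonneg_left (aux_heav _ _ _ _ h1 h2) (abs_nonneg _)

lemma aux_indInt (a b : ℝ) : Integrable ((Set.Ico a b).indicator (fun _ => (1 : ℝ))) := by
  rw [integrable_indicator_iff measurableSet_Ico]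
  simp

lemma aux_indval (a h : ℝ) (hh : 0 ≤ h) :
    ∫ y, (Set.Ico (a - h) a).indicator (fun _ => (1 : ℝ)) y = h := by
  rw [integral_indicator measurableSet_Ico]
  simp [hh]

lemma auxG_int (r X : ℕ → ℝ) (n : ℕ) (h : ℝ) : Integrable (auxG r X n h) := by
  unfold auxG
  refine Integrable.add (Integrable.add ((aux_indInt _ _).const_mul _) ?_)
    ((aux_indInt _ _).const_mul _)
  exact integrable_finsetSum _ fun i _ => (aux_indInt _ _).const_mul _

lemma auxG_val (r X : ℕ → ℝ) (n : ℕ) (h : ℝ) (hh : 0 ≤ h) :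
    ∫ y, auxG r X n h y =
      (|r 0| + (∑ i ∈ Finset.range n, |r (i + 1) - r i|) + |r n|) * h := by
  unfold auxG
  have i1 : ∀ c a : ℝ, Integrable
      (fun y => c * (Set.Ico (a - h) a).indicator (fun _ => (1 : ℝ)) y) :=
    fun c a => (aux_indInt _ _).const_mul _
  have i2 : Integrable (fun y => ∑ i ∈ Finset.range n, |r (i + 1) - r i| *
      (Set.Ico (X (i + 1) - h) (X (i + 1))).indicator (fun _ => (1 : ℝ)) y) :=
    integrable_finsetSum _ fun i _ => i1 _ _
  have i3 : Integrable (fun y => |r 0| * (Set.Ico (X 0 - h) (X 0)).indicator (fun _ => (1 : ℝ)) y +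
      ∑ i ∈ Finset.range n, |r (i + 1) - r i| *
      (Set.Ico (X (i + 1) - h) (X (i + 1))).indicator (fun _ => (1 : ℝ)) y) := (i1 _ _).add i2
  rw [integral_add i3 (i1 _ _), integral_add (i1 _ _) i2,
    integral_finsetSum _ fun i _ => i1 _ _]
  simp only [integral_const_mul, aux_indval _ _ hh]
  rw [← Finset.sum_mul]
  ring

/-- normalized cumulative mass of a cell -/
noncomputable def auxC (a b y : ℝ) : ℝ := max 0 (min 1 ((y - a) / (b - a)))

lemma auxC_zero (a b y : ℝ) (hab : a < b) (hy : y ≤ a) : auxC a b y = 0 := by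
  unfold auxC
  refine max_eq_left ((min_le_right _ _).trans ?_)
  exact div_nonpos_of_nonpos_of_nonneg (by linarith) (by linarith)

lemma auxC_one (a b y : ℝ) (hab : a < b) (hy : b ≤ y) : auxC a b y = 1 := by
  unfold auxC
  rw [min_eq_left]
  · simp
  · rw [le_div_iff₀ (by linarith)]; linarith

lemma auxC_mid (a b y : ℝ) (hab : a < b) (h1 : a ≤ y) (h2 : y ≤ b) :
    auxC a b y = (y - a) / (b - a) := by
  unfold auxC
  rw [min_eq_right, max_eq_right]
  · exact div_nonneg (by linarith) (by linarith)
  · rw [div_le_one (by linarith)]; linarith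

lemma auxC_nonneg (a b y : ℝ) : 0 ≤ auxC a b y := le_max_left _ _

lemma auxC_le_one (a b y : ℝ) : auxC a b y ≤ 1 := max_le zero_le_one (min_le_left _ _)

lemma auxC_cont (a b : ℝ) : Continuous (auxC a b) := by
  unfold auxC
  fun_prop

lemma auxC_anti (a b a' b' y : ℝ) (hab : a < b) (hab' : a' < b') (ha : a ≤ a') (hb : b ≤ b') :
    auxC a' b' y ≤ auxC a b y := by
  rcases le_total y a' with h1 | h1
  · rw [auxC_zero _ _ _ hab' h1]; exact auxC_nonneg _ _ _
  rcases le_total b y with h2 | h2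
  · rw [auxC_one _ _ _ hab h2]; exact auxC_le_one _ _ _
  rw [auxC_mid _ _ _ hab' h1 (by linarith), auxC_mid _ _ _ hab (by linarith) h2,
    div_le_div_iff₀ (by linarith) (by linarith)]
  have : (y - a') * (b - y) ≤ (y - a) * (b' - y) :=
    mul_le_mul (by linarith) (by linarith) (by linarith) (by linarith)
  linarith

lemma auxC_shift (a b D y : ℝ) : auxC (a - D) (b - D) y = auxC a b (y + D) := by
  unfold auxC
  congr 3 <;> ring

lemma auxC_diff (a b a' b' D y : ℝ) (hab : a < b) (hab' : a' < b') (hD : 0 ≤ D)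
    (ha : |a' - a| ≤ D) (hb : |b' - b| ≤ D) :
    |auxC a' b' y - auxC a b y| ≤ auxC a b (y + D) - auxC a b (y - D) := by
  rw [abs_le] at *
  have e1 := auxC_shift a b D y
  have e2 := auxC_shift a b (-D) y
  rw [← sub_eq_add_neg] at e2
  have h1 := auxC_anti (a - D) (b - D) a' b' y (by linarith) hab' (by linarith) (by linarith)
  have h2 := auxC_anti a' b' (a - -D) (b - -D) y hab' (by linarith) (by linarith) (by linarith)
  have h3 := auxC_anti (a - D) (b - D) a b y (by linarith) hab (by linarith) (by linarith)
  have h4 := auxC_anti a b (a - -D) (b - -D) y hab (by linarith) (by linarith) (by linarith)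
  constructor <;> linarith

lemma auxC_supp (a b D : ℝ) (hab : a < b) (hD : 0 ≤ D) (y : ℝ)
    (hy : y ∉ Set.Ioc (a - D) (b + D)) : auxC a b (y + D) - auxC a b (y - D) = 0 := by
  by_cases h : y ≤ a - D
  · rw [auxC_zero _ _ _ hab (by linarith), auxC_zero _ _ _ hab (by linarith), sub_self]
  · have : b + D < y := by
      by_contra h'
      exact hy ⟨not_le.1 h, not_lt.1 h'⟩
    rw [auxC_one _ _ _ hab (by linarith), auxC_one _ _ _ hab (by linarith), sub_self]

lemma auxC_int (a b D : ℝ) (hab : a < b) (hD : 0 ≤ D) :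
    Integrable (fun y => auxC a b (y + D) - auxC a b (y - D)) := by
  have hc : Continuous (fun y => auxC a b (y + D) - auxC a b (y - D)) :=
    ((auxC_cont a b).comp (by fun_prop)).sub ((auxC_cont a b).comp (by fun_prop))
  refine hc.integrable_of_hasCompactSupport ?_
  refine HasCompactSupport.intro (K := Set.Icc (a - D) (b + D)) isCompact_Icc fun y hy => ?_
  exact auxC_supp a b D hab hD y fun h => hy (Set.Ioc_subset_Icc_self h)

lemma auxC_val (a b D : ℝ) (hab : a < b) (hD : 0 ≤ D) :
    ∫ y, (auxC a b (y + D) - auxC a b (y - D)) = 2 * D := by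
  rw [← setIntegral_eq_integral_of_forall_compl_eq_zero (auxC_supp a b D hab hD),
    ← intervalIntegral.integral_of_le (by linarith)]
  have ii : ∀ u w, IntervalIntegrable (auxC a b) volume u w :=
    fun u w => (auxC_cont a b).intervalIntegrable _ _
  have j1 : Continuous fun y => auxC a b (y + D) :=
    (auxC_cont a b).comp (by fun_prop : Continuous fun y : ℝ => y + D)
  have j2 : Continuous fun y => auxC a b (y - D) :=
    (auxC_cont a b).comp (by fun_prop : Continuous fun y : ℝ => y - D)
  rw [intervalIntegral.integral_sub (j1.intervalIntegrable _ _) (j2.intervalIntegrable _ _),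
    intervalIntegral.integral_comp_add_right (auxC a b), 
    intervalIntegral.integral_comp_sub_right (auxC a b)]
  rw [← intervalIntegral.integral_add_adjacent_intervals (ii _ b) (ii b _),
    ← intervalIntegral.integral_add_adjacent_intervals (ii (a - D - D) a) (ii a (b + D - D))]
  have z1 : ∫ y in (a - D - D)..a, auxC a b y = ∫ y in (a - D - D)..a, (0 : ℝ) := by
    refine intervalIntegral.integral_congr fun y hy => ?_
    rw [Set.uIcc_of_le (by linarith)] at hy
    exact auxC_zero _ _ _ hab hy.2
  have z2 : ∫ y in b..(b + D + D), auxC a b y = ∫ y in b..(b + D + D), (1 : ℝ) := by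
    refine intervalIntegral.integral_congr fun y hy => ?_
    rw [Set.uIcc_of_le (by linarith)] at hy
    exact auxC_one _ _ _ hab hy.1
  rw [z1, z2]
  simp
  ring

lemma aux_cell (a b y h : ℝ) (hab : a < b) (hh : 0 ≤ h) :
    ∫ s in y..(y + h), (Set.Ico a b).indicator (fun _ => (1 : ℝ)) s =
      (b - a) * (auxC a b (y + h) - auxC a b y) := by
  rw [intervalIntegral.integral_of_le (by linarith), ← integral_Ico_eq_integral_Ioc,
    setIntegral_indicator measurableSet_Ico, Set.Ico_inter_Ico]
  have hba : b - a ≠ 0 := by linarith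
  simp only [integral_const, smul_eq_mul, mul_one, measureReal_restrict_apply_univ,
    Real.volume_real_Ico]
  rcases le_total y a with h1 | h1 <;> rcases le_total (y + h) b with h2 | h2
  · rw [auxC_zero a b y hab h1]
    rcases le_total (y + h) a with h3 | h3
    · rw [auxC_zero a b _ hab h3, max_eq_right]
      · ring
      · simp [h1, h2, h3]
    · rw [auxC_mid a b _ hab h3 h2, max_eq_left] <;> simp [h1, h2, h3]
      field_simp
  · rw [auxC_zero a b y hab h1, auxC_one a b _ hab h2, max_eq_left] <;> simp [h1, h2, hab.le]
  · rw [auxC_mid a b y hab h1 (by linarith), auxC_mid a b _ hab (by linarith) h2,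
      max_eq_left] <;> simp [h1, h2, hh]
    field_simp
    ring
  · rw [auxC_one a b _ hab h2]
    rcases le_total y b with h3 | h3
    · rw [auxC_mid a b _ hab h1 h3, max_eq_left] <;> simp [h1, h2, h3]
      field_simp
      ring
    · rw [auxC_one a b _ hab h3, max_eq_right] <;> simp [h1, h2, h3]

/-- mollification error -/
lemma aux_moll (r X : ℕ → ℝ) (n : ℕ) (l : ℝ) (hX : ∀ i < n + 1, X i < X (i + 1))
    (hr : ∀ i < n + 1, r i = l / (X (i + 1) - X i)) (h y : ℝ) (hh : 0 < h) :
    |h * (∑ i ∈ Finset.range (n + 1),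
        r i * (Set.Ico (X i) (X (i + 1))).indicator (fun _ => (1 : ℝ)) y) -
      ∑ i ∈ Finset.range (n + 1),
        l * (auxC (X i) (X (i + 1)) (y + h) - auxC (X i) (X (i + 1)) y)|
      ≤ h * auxG r X n h y := by
  set ρ : ℝ → ℝ := fun z => ∑ i ∈ Finset.range (n + 1),
        r i * (Set.Ico (X i) (X (i + 1))).indicator (fun _ => (1 : ℝ)) z with hρ
  have ii : ∀ i, IntervalIntegrable
      (fun z => r i * (Set.Ico (X i) (X (i + 1))).indicator (fun _ => (1 : ℝ)) z)
      volume y (y + h) := fun i => ((aux_indInt _ _).const_mul _).intervalIntegrable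
  have hint : IntervalIntegrable ρ volume y (y + h) := by
    have : Integrable ρ := integrable_finsetSum _ fun i _ => (aux_indInt _ _).const_mul _
    exact this.intervalIntegrable
  have e1 : ∑ i ∈ Finset.range (n + 1),
        l * (auxC (X i) (X (i + 1)) (y + h) - auxC (X i) (X (i + 1)) y) =
      ∫ s in y..(y + h), ρ s := by
    rw [hρ, intervalIntegral.integral_finsetSum (fun i _ => ii i)]
    refine Finset.sum_congr rfl fun i hi => ?_
    have hi' := Finset.mem_range.1 hi
    have := hX i hi'
    rw [intervalIntegral.integral_const_mul, aux_cell _ _ _ _ this hh.le, hr i hi']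
    have : X (i + 1) - X i ≠ 0 := by linarith
    field_simp
  have e2 : h * ρ y = ∫ s in y..(y + h), ρ y := by simp
  change |h * ρ y - _| ≤ _
  rw [e1, e2, ← intervalIntegral.integral_sub (by simp) hint]
  have := intervalIntegral.norm_integral_le_of_norm_le_const (a := y) (b := y + h)
    (f := fun s => ρ y - ρ s) (C := auxG r X n h y) ?_
  · simpa [abs_of_pos hh, mul_comm] using this
  · intro s hs
    rw [Set.uIoc_of_le (by linarith)] at hs
    rw [Real.norm_eq_abs, abs_sub_comm]
    exact aux_ptw r X n hX h y s hs.1.le hs.2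

/-- interpolation estimate -/
lemma aux_main (r X r' X' : ℕ → ℝ) (n : ℕ) (l h D : ℝ) (hl : 0 ≤ l)
    (hX : ∀ i < n + 1, X i < X (i + 1)) (hr : ∀ i < n + 1, r i = l / (X (i + 1) - X i))
    (hX' : ∀ i < n + 1, X' i < X' (i + 1)) (hr' : ∀ i < n + 1, r' i = l / (X' (i + 1) - X' i))
    (hh : 0 < h) (hD : 0 ≤ D) (hdisp : ∀ i ≤ n + 1, |X' i - X i| ≤ D) :
    ∫ y, |(∑ i ∈ Finset.range (n + 1),
        r' i * (Set.Ico (X' i) (X' (i + 1))).indicator (fun _ => (1 : ℝ)) y) -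
        (∑ i ∈ Finset.range (n + 1),
        r i * (Set.Ico (X i) (X (i + 1))).indicator (fun _ => (1 : ℝ)) y)| ≤
      (|r' 0| + (∑ i ∈ Finset.range n, |r' (i + 1) - r' i|) + |r' n|) * h +
      (|r 0| + (∑ i ∈ Finset.range n, |r (i + 1) - r i|) + |r n|) * h +
      4 * ((n + 1 : ℕ) * l) * D / h := by
  set G : ℕ → ℝ → ℝ := fun i y => auxC (X i) (X (i + 1)) (y + D) - auxC (X i) (X (i + 1)) (y - D)
    with hG
  have hGi : ∀ i ∈ Finset.range (n + 1), Integrable (G i) := fun i hi =>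
    auxC_int _ _ _ (hX i (Finset.mem_range.1 hi)) hD
  have hGi' : ∀ i ∈ Finset.range (n + 1), Integrable (fun y => l * (G i (y + h) + G i y)) :=
    fun i hi => (((hGi i hi).comp_add_right h).add (hGi i hi)).const_mul l
  have hS : Integrable (fun y => h⁻¹ * ∑ i ∈ Finset.range (n + 1), l * (G i (y + h) + G i y)) :=
    (integrable_finsetSum _ hGi').const_mul _
  have hB : Integrable (fun y => auxG r' X' n h y + auxG r X n h y +
      h⁻¹ * ∑ i ∈ Finset.range (n + 1), l * (G i (y + h) + G i y)) :=
    ((auxG_int _ _ _ _).add (auxG_int _ _ _ _)).add hS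
  have hval : ∫ y, (auxG r' X' n h y + auxG r X n h y +
      h⁻¹ * ∑ i ∈ Finset.range (n + 1), l * (G i (y + h) + G i y)) =
      (|r' 0| + (∑ i ∈ Finset.range n, |r' (i + 1) - r' i|) + |r' n|) * h +
      (|r 0| + (∑ i ∈ Finset.range n, |r (i + 1) - r i|) + |r n|) * h +
      4 * ((n + 1 : ℕ) * l) * D / h := by
    have i3 : Integrable (fun y => auxG r' X' n h y + auxG r X n h y) :=
      (auxG_int _ _ _ _).add (auxG_int _ _ _ _)
    rw [integral_add i3 hS,
      integral_add (auxG_int _ _ _ _) (auxG_int _ _ _ _), auxG_val _ _ _ _ hh.le,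
      auxG_val _ _ _ _ hh.le, integral_const_mul, integral_finsetSum _ hGi']
    have : ∀ i ∈ Finset.range (n + 1), ∫ y, l * (G i (y + h) + G i y) = l * (4 * D) := by
      intro i hi
      rw [integral_const_mul, integral_add ((hGi i hi).comp_add_right h) (hGi i hi),
        integral_add_right_eq_self (G i) h, hG]
      simp only
      rw [auxC_val _ _ _ (hX i (Finset.mem_range.1 hi)) hD]
      ring
    rw [Finset.sum_congr rfl this, Finset.sum_const, Finset.card_range, nsmul_eq_mul]
    field_simp
  rw [← hval]
  refine integral_mono_of_nonneg (Filter.Eventually.of_forall fun y => abs_nonneg _) hB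
    (Filter.Eventually.of_forall fun y => ?_)
  simp only
  have m1 := aux_moll r X n l hX hr h y hh
  have m2 := aux_moll r' X' n l hX' hr' h y hh
  have m3 : |(∑ i ∈ Finset.range (n + 1),
        l * (auxC (X' i) (X' (i + 1)) (y + h) - auxC (X' i) (X' (i + 1)) y)) -
      ∑ i ∈ Finset.range (n + 1),
        l * (auxC (X i) (X (i + 1)) (y + h) - auxC (X i) (X (i + 1)) y)| ≤
      ∑ i ∈ Finset.range (n + 1), l * (G i (y + h) + G i y) := by
    rw [← Finset.sum_sub_distrib]
    refine (Finset.abs_sum_le_sum_abs _ _).trans (Finset.sum_le_sum fun i hi => ?_)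
    have hi' := Finset.mem_range.1 hi
    rw [← mul_sub, abs_mul, abs_of_nonneg hl]
    refine mul_le_mul_of_nonneg_left ?_ hl
    have d : ∀ z, |auxC (X' i) (X' (i + 1)) z - auxC (X i) (X (i + 1)) z| ≤ G i z := fun z =>
      auxC_diff _ _ _ _ D z (hX i hi') (hX' i hi') hD (hdisp i (by omega)) (hdisp (i + 1) (by omega))
    have d1 := abs_le.1 (d (y + h))
    have d2 := abs_le.1 (d y)
    rw [abs_le]
    constructor <;> linarith [d1.1, d1.2, d2.1, d2.2]
  generalize (∑ i ∈ Finset.range (n + 1),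
        r' i * (Set.Ico (X' i) (X' (i + 1))).indicator (fun _ => (1 : ℝ)) y) = A' at *
  generalize (∑ i ∈ Finset.range (n + 1),
        r i * (Set.Ico (X i) (X (i + 1))).indicator (fun _ => (1 : ℝ)) y) = A at *
  generalize (∑ i ∈ Finset.range (n + 1),
        l * (auxC (X' i) (X' (i + 1)) (y + h) - auxC (X' i) (X' (i + 1)) y)) = B' at *
  generalize (∑ i ∈ Finset.range (n + 1),
        l * (auxC (X i) (X (i + 1)) (y + h) - auxC (X i) (X (i + 1)) y)) = B at *
  generalize (∑ i ∈ Finset.range (n + 1), l * (G i (y + h) + G i y)) = S at *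
  have hfin : h * |A' - A| ≤ h * (auxG r' X' n h y + auxG r X n h y + h⁻¹ * S) := by
    have : h * (h⁻¹ * S) = S := by field_simp
    rw [mul_add, this]
    have : h * |A' - A| = |h * A' - h * A| := by rw [← mul_sub, abs_mul, abs_of_pos hh]
    rw [this]
    rw [abs_le] at *
    constructor <;> linarith [m1.1, m1.2, m2.1, m2.2, m3.1, m3.2]
  exact le_of_mul_le_mul_left hfin hh

lemma aux_V (R : ℝ) (v : ℝ → ℝ) (_hR : 0 < R)
    (hv : ContDiffOn ℝ 1 v (Set.Icc 0 R))
    (hv' : ∀ ρ ∈ Set.Icc (0 : ℝ) R, derivWithin v (Set.Icc 0 R) ρ < 0) :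
    StrictAntiOn v (Set.Icc 0 R) := by
  refine strictAntiOn_of_deriv_neg (convex_Icc _ _) hv.continuousOn fun z hz => ?_
  have hzmem := interior_subset hz
  rw [← derivWithin_of_mem_nhds (mem_interior_iff_mem_nhds.1 hz)]
  exact hv' z hzmem

/-- `L¹` time continuity of the discrete densities:
`‖ρ_N^{m₂} - ρ_N^{m₁}‖_{L¹} ≤ 4 (2 TV(ρb) L V)^{1/2} (t₂ - t₁ + τ)^{1/2}`. -/
theorem L1_time_estimate
    (R T L θ Lv : ℝ) (N M : ℕ) (v : ℝ → ℝ) (ℓ τ : ℝ) (x : ℕ → ℕ → ℝ) (ρb : ℝ → ℝ)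
    (t₁ t₂ : ℝ) (m₁ m₂ : ℕ)
    (hR : 0 < R) (hT : 0 < T) (hLpos : 0 < L) (hN : 0 < N) (hM : 0 < M)
    (hθ : θ ∈ Set.Icc (0 : ℝ) 1)
    (hv : ContDiffOn ℝ 1 v (Set.Icc 0 R))
    (hv' : ∀ ρ ∈ Set.Icc (0 : ℝ) R, derivWithin v (Set.Icc 0 R) ρ < 0)
    (hvleft : ∀ ρ < (0 : ℝ), v ρ = v 0)
    (hvright : ∀ ρ, R < ρ → v ρ = v R)
    (hLv : ∀ a ∈ Set.Icc (0 : ℝ) R, ∀ b ∈ Set.Icc (0 : ℝ) R, |v a - v b| ≤ Lv * |a - b|)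
    (hBV : BoundedVariationOn ρb Set.univ)
    (hsupp : HasCompactSupport ρb)
    (hbound : ∀ᵐ z ∂(volume : Measure ℝ), ρb z ∈ Set.Icc 0 R)
    (hLdef : (∫ z, ρb z) = L)
    (hℓ : ℓ = L / N) (hτ : τ = T / M)
    (hscheme : IsScheme N M ℓ τ θ v x)
    (hbnd : ∀ m ≤ M, ∀ i < N, 0 < Rd N ℓ x i m ∧ Rd N ℓ x i m ≤ R)
    (hTV : ∀ m ≤ M, TVd N ℓ x m ≤ (eVariationOn ρb Set.univ).toReal)
    (ht₁ : 0 ≤ t₁) (ht₁₂ : t₁ ≤ t₂) (ht₂ : t₂ ≤ T) (hm₁₂ : m₁ ≤ m₂)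
    (hm₁ : t₁ ∈ Set.Ico ((m₁ : ℝ) * τ) (((m₁ : ℝ) + 1) * τ))
    (hm₂ : t₂ ∈ Set.Ico ((m₂ : ℝ) * τ) (((m₂ : ℝ) + 1) * τ)) :
    (∫ y : ℝ, |pcDens N ℓ x m₂ y - pcDens N ℓ x m₁ y|) ≤
      4 * Real.sqrt (2 * (eVariationOn ρb Set.univ).toReal * L * max |v 0| |v R|) *
        Real.sqrt (t₂ - t₁ + τ) := by
  obtain ⟨hs1, hs2, hs3⟩ := hscheme
  obtain ⟨n, rfl⟩ : ∃ n, N = n + 1 := ⟨N - 1, by omega⟩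
  have hanti := aux_V R v hR hv hv'
  have h0 : (0 : ℝ) ∈ Set.Icc 0 R := ⟨le_rfl, hR.le⟩
  have hRR : R ∈ Set.Icc 0 R := ⟨hR.le, le_rfl⟩
  set V := max |v 0| |v R| with hVdef
  set TV := (eVariationOn ρb Set.univ).toReal with hTVdef
  have hvR : v R < v 0 := hanti h0 hRR hR
  have hVpos : 0 < V := by
    by_contra hneg
    have a1 : |v 0| ≤ 0 := (le_max_left _ _).trans (not_lt.1 hneg)
    have a2 : |v R| ≤ 0 := (le_max_right _ _).trans (not_lt.1 hneg)
    rw [abs_nonpos_iff] at a1 a2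
    linarith
  have hvV : ∀ z ∈ Set.Icc 0 R, |v z| ≤ V := by
    intro z hz
    have b1 : v z ≤ v 0 := hanti.antitoneOn h0 hz hz.1
    have b2 : v R ≤ v z := hanti.antitoneOn hz hRR hz.2
    have b3 : |v 0| ≤ V := le_max_left _ _
    have b4 : |v R| ≤ V := le_max_right _ _
    rw [abs_le] at *
    constructor <;> linarith [b3.2, b4.1]
  have hMpos : (0 : ℝ) < M := by exact_mod_cast hM
  have hτpos : 0 < τ := by rw [hτ]; positivity
  have hm₂M : m₂ ≤ M := by
    have : (m₂ : ℝ) * τ ≤ M * τ := by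
      have : (M : ℝ) * τ = T := by rw [hτ]; field_simp
      rw [this]; exact hm₂.1.trans ht₂
    exact_mod_cast le_of_mul_le_mul_right this hτpos
  have hstep : ∀ m < M, ∀ i ≤ n + 1, |x i (m + 1) - x i m| ≤ τ * V := by
    intro m hm i hi
    rcases Nat.lt_or_ge i (n + 1) with hlt | hge
    · rw [hs3 m hm i hlt, add_sub_cancel_left, abs_mul, abs_of_pos hτpos]
      refine mul_le_mul_of_nonneg_left ?_ hτpos.le
      have c1 := hbnd m hm.le i hlt
      have c2 := hbnd (m + 1) hm i hlt
      have d1 := abs_le.1 (hvV _ ⟨c1.1.le, c1.2⟩)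
      have d2 := abs_le.1 (hvV _ ⟨c2.1.le, c2.2⟩)
      have t1 := hθ.1
      have t2 : 0 ≤ 1 - θ := by linarith [hθ.2]
      rw [abs_le]
      constructor
      · nlinarith [mul_le_mul_of_nonneg_left d1.1 t1, mul_le_mul_of_nonneg_left d2.1 t2]
      · nlinarith [mul_le_mul_of_nonneg_left d1.2 t1, mul_le_mul_of_nonneg_left d2.2 t2]
    · obtain rfl : i = n + 1 := by omega
      rw [hs2 m hm, add_sub_cancel_left, abs_mul, abs_of_pos hτpos]
      exact mul_le_mul_of_nonneg_left (hvV 0 h0) hτpos.le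
  have hdisp0 : ∀ k, m₁ + k ≤ M → ∀ i ≤ n + 1, |x i (m₁ + k) - x i m₁| ≤ k * (τ * V) := by
    intro k
    induction k with
    | zero => intro _ i _; simp
    | succ k ih =>
      intro hk i hi
      have e1 := abs_le.1 (ih (by omega) i hi)
      have e2 := abs_le.1 (hstep (m₁ + k) (by omega) i hi)
      rw [← add_assoc, abs_le]
      push_cast
      constructor <;> linarith [e1.1, e1.2, e2.1, e2.2]
  set Δ := t₂ - t₁ + τ with hΔ
  have hΔpos : 0 < Δ := by linarith
  have hdisp : ∀ i ≤ n + 1, |x i m₂ - x i m₁| ≤ V * Δ := by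
    intro i hi
    obtain ⟨k, rfl⟩ := Nat.exists_eq_add_of_le hm₁₂
    refine (hdisp0 k hm₂M i hi).trans ?_
    have f1 := hm₁.2
    have f2 := hm₂.1
    push_cast at f2
    have : (k : ℝ) * τ ≤ Δ := by rw [hΔ]; linarith
    nlinarith
  have hRd : ∀ m, ∀ i < n + 1, Rd (n + 1) ℓ x i m = ℓ / (x (i + 1) m - x i m) := by
    intro m i hi
    simp [Rd, hi]
  have hℓpos : 0 < ℓ := by rw [hℓ]; positivity
  have hℓN : ((n + 1 : ℕ) : ℝ) * ℓ = L := by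
    rw [hℓ]; field_simp
  have hTVb : ∀ m ≤ M, |Rd (n + 1) ℓ x 0 m| +
      (∑ i ∈ Finset.range n, |Rd (n + 1) ℓ x (i + 1) m - Rd (n + 1) ℓ x i m|) +
      |Rd (n + 1) ℓ x n m| ≤ TV := by
    intro m hm
    have := hTV m hm
    unfold TVd at this
    rw [Nat.add_sub_cancel] at this
    rwa [abs_of_pos (hbnd m hm 0 (by omega)).1, abs_of_pos (hbnd m hm n (by omega)).1]
  have hTVpos : 0 < TV := by
    refine lt_of_lt_of_le ?_ (hTVb m₂ hm₂M)
    have g1 := (hbnd m₂ hm₂M 0 (by omega)).1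
    positivity
  have hD : 0 < V * Δ := mul_pos hVpos hΔpos
  set h := Real.sqrt (2 * L * (V * Δ) / TV) with hh
  have hq : 0 < 2 * L * (V * Δ) / TV := by positivity
  have hhpos : 0 < h := Real.sqrt_pos.2 hq
  have hsq : h ^ 2 = 2 * L * (V * Δ) / TV := Real.sq_sqrt hq.le
  have main := aux_main (fun i => Rd (n + 1) ℓ x i m₁) (fun i => x i m₁)
    (fun i => Rd (n + 1) ℓ x i m₂) (fun i => x i m₂) n ℓ h (V * Δ) hℓpos.le
    (hs1 m₁ (hm₁₂.trans hm₂M)) (hRd m₁) (hs1 m₂ hm₂M) (hRd m₂) hhpos hD.le hdisp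
  rw [hℓN] at main
  refine (main.trans ?_ : (∫ y : ℝ, |pcDens (n + 1) ℓ x m₂ y - pcDens (n + 1) ℓ x m₁ y|) ≤ _)
  have k1 := mul_le_mul_of_nonneg_right (hTVb m₁ (hm₁₂.trans hm₂M)) hhpos.le
  have k2 := mul_le_mul_of_nonneg_right (hTVb m₂ hm₂M) hhpos.le
  have hsq' : h ^ 2 * TV = 2 * L * (V * Δ) := by rw [hsq]; field_simp
  have k3 : 4 * L * (V * Δ) / h = 2 * TV * h := by
    rw [div_eq_iff hhpos.ne']; linarith
  have k4 : Real.sqrt (2 * TV * L * V) * Real.sqrt Δ = TV * h := by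
    rw [← Real.sqrt_mul (by positivity)]
    rw [Real.sqrt_eq_iff_mul_self_eq_of_pos (by positivity)]
    linear_combination TV * hsq'
  rw [k3, mul_assoc 4 (Real.sqrt _) (Real.sqrt _), k4]
  linarith
end

section
/- Consider the θ-scheme as defined in the context, let (x_i^m) be a particle configuration with 0 < R_j^m ≤ R for all j and m, and for i = 0,…,N define the time-interpolated trajectories x_i(t) = x_i^m + ((t − t^m)/τ)(x_i^{m+1} − x_i^m) for t ∈ [t^m, t^{m+1}], and set R_i(t) = ℓ/(x_{i+1}(t) − x_i(t)) for i = 0,…,N−1. Then for every m = 0,…,M−1, every i = 0,…,N−1 and every t ∈ (t^m, t^{m+1}): (a) 0 < min(R_i^m, R_i^{m+1}) ≤ R_i(t) ≤ max(R_i^m, R_i^{m+1}) ≤ R; (b) |R_i(t) − R_i^m| ≤ (τ/ℓ) [v]_Lip R_i(t) R_i^m ( θ |R_{i+1}^m − R_i^m| + (1−θ) |R_{i+1}^{m+1} − R_i^{m+1}| ), with the convention R_N^m = R_N^{m+1} = 0. -/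
/-- The linearly interpolated trajectory `x_i(t) = x_i^m + ((t - t^m)/τ)(x_i^{m+1} - x_i^m)`
for `t ∈ [t^m, t^{m+1}]`. -/
noncomputable def interp (τ : ℝ) (x : ℕ → ℕ → ℝ) (m i : ℕ) (t : ℝ) : ℝ :=
  x i m + ((t - (m : ℝ) * τ) / τ) * (x i (m + 1) - x i m)

/-- The interpolated discrete density `R_i(t) = ℓ/(x_{i+1}(t) - x_i(t))`. -/
noncomputable def Rint (N : ℕ) (l τ : ℝ) (x : ℕ → ℕ → ℝ) (m i : ℕ) (t : ℝ) : ℝ :=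
  if i < N then l / (interp τ x m (i + 1) t - interp τ x m i t) else 0

/-- estimates for the time-interpolated discrete densities: for
`t ∈ (t^m, t^{m+1})`, (a) `0 < min(R_i^m, R_i^{m+1}) ≤ R_i(t) ≤ max(R_i^m, R_i^{m+1}) ≤ R`;
(b) `|R_i(t) - R_i^m| ≤ (τ/ℓ)[v]_Lip R_i(t) R_i^m (θ|R_{i+1}^m - R_i^m| + (1-θ)|R_{i+1}^{m+1} - R_i^{m+1}|)`. -/
theorem interpolated_density_estimates
    (R T L θ Lv : ℝ) (N M : ℕ) (v : ℝ → ℝ) (ℓ τ : ℝ) (x : ℕ → ℕ → ℝ)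
    (hR : 0 < R) (hT : 0 < T) (hLpos : 0 < L) (hN : 0 < N) (hM : 0 < M)
    (hθ : θ ∈ Set.Icc (0 : ℝ) 1)
    (hv : ContDiffOn ℝ 1 v (Set.Icc 0 R))
    (hv' : ∀ ρ ∈ Set.Icc (0 : ℝ) R, derivWithin v (Set.Icc 0 R) ρ < 0)
    (hvleft : ∀ ρ < (0 : ℝ), v ρ = v 0)
    (hvright : ∀ ρ, R < ρ → v ρ = v R)
    (hLv : ∀ a ∈ Set.Icc (0 : ℝ) R, ∀ b ∈ Set.Icc (0 : ℝ) R, |v a - v b| ≤ Lv * |a - b|)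
    (hℓ : ℓ = L / N) (hτ : τ = T / M)
    (hscheme : IsScheme N M ℓ τ θ v x)
    (hbnd : ∀ m ≤ M, ∀ j < N, 0 < Rd N ℓ x j m ∧ Rd N ℓ x j m ≤ R) :
    ∀ m < M, ∀ i < N, ∀ t ∈ Set.Ioo ((m : ℝ) * τ) (((m : ℝ) + 1) * τ),
      (0 < min (Rd N ℓ x i m) (Rd N ℓ x i (m + 1)) ∧
        min (Rd N ℓ x i m) (Rd N ℓ x i (m + 1)) ≤ Rint N ℓ τ x m i t ∧
        Rint N ℓ τ x m i t ≤ max (Rd N ℓ x i m) (Rd N ℓ x i (m + 1)) ∧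
        max (Rd N ℓ x i m) (Rd N ℓ x i (m + 1)) ≤ R) ∧
      |Rint N ℓ τ x m i t - Rd N ℓ x i m| ≤
        (τ / ℓ) * Lv * Rint N ℓ τ x m i t * Rd N ℓ x i m *
          (θ * |Rd N ℓ x (i + 1) m - Rd N ℓ x i m| +
            (1 - θ) * |Rd N ℓ x (i + 1) (m + 1) - Rd N ℓ x i (m + 1)|) := by
  intro m hm i hi t ht
  obtain ⟨hord, hlast, hstep⟩ := hscheme
  obtain ⟨hθ0, hθ1⟩ := hθ
  have hNr : (0 : ℝ) < N := by exact_mod_cast hN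
  have hMr : (0 : ℝ) < M := by exact_mod_cast hM
  have hℓ0 : 0 < ℓ := by rw [hℓ]; positivity
  have hτ0 : 0 < τ := by rw [hτ]; positivity
  clear hℓ hτ
  -- scheme for all indices up to N
  have hstep' : ∀ j ≤ N, x j (m + 1) =
      x j m + τ * (θ * v (Rd N ℓ x j m) + (1 - θ) * v (Rd N ℓ x j (m + 1))) := by
    intro j hj
    rcases hj.lt_or_eq with h | h
    · exact hstep m hm j h
    · subst h
      have h0 : ∀ k, Rd j ℓ x j k = 0 := fun k => by simp [Rd]
      rw [h0, h0, hlast m hm]; ring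
  have hmem : ∀ k ≤ M, ∀ j ≤ N, Rd N ℓ x j k ∈ Set.Icc (0 : ℝ) R := by
    intro k hk j hj
    rcases hj.lt_or_eq with h | h
    · exact ⟨(hbnd k hk j h).1.le, (hbnd k hk j h).2⟩
    · have h0 : Rd N ℓ x j k = 0 := by simp [Rd, h]
      rw [h0]; exact ⟨le_rfl, hR.le⟩
  have e1 := hstep' i hi.le
  have e2 := hstep' (i + 1) hi
  have l1 := hLv _ (hmem m hm.le (i + 1) hi) _ (hmem m hm.le i hi.le)
  have l2 := hLv _ (hmem (m + 1) hm (i + 1) hi) _ (hmem (m + 1) hm i hi.le)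
  have b0 := hbnd m hm.le i hi
  have b1 := hbnd (m + 1) hm i hi
  have g0 : 0 < x (i + 1) m - x i m := sub_pos.2 (hord m hm.le i hi)
  have g1 : 0 < x (i + 1) (m + 1) - x i (m + 1) := sub_pos.2 (hord (m + 1) hm i hi)
  have r0 : Rd N ℓ x i m = ℓ / (x (i + 1) m - x i m) := by simp [Rd, hi]
  have r1 : Rd N ℓ x i (m + 1) = ℓ / (x (i + 1) (m + 1) - x i (m + 1)) := by simp [Rd, hi]
  obtain ⟨s, hs⟩ : ∃ s, s = (t - (m : ℝ) * τ) / τ := ⟨_, rfl⟩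
  have hs0 : 0 < s := by rw [hs]; exact div_pos (by linarith [ht.1]) hτ0
  have hs1 : s < 1 := by rw [hs, div_lt_one hτ0]; linarith [ht.2]
  have rt : Rint N ℓ τ x m i t = ℓ / ((x (i + 1) m - x i m) +
      s * ((x (i + 1) (m + 1) - x i (m + 1)) - (x (i + 1) m - x i m))) := by
    simp only [Rint, hi, if_true, interp, ← hs]
    congr 1; ring
  have hdiff : |(x (i + 1) (m + 1) - x i (m + 1)) - (x (i + 1) m - x i m)| ≤
      τ * (Lv * (θ * |Rd N ℓ x (i + 1) m - Rd N ℓ x i m| +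
            (1 - θ) * |Rd N ℓ x (i + 1) (m + 1) - Rd N ℓ x i (m + 1)|)) := by
    have : (x (i + 1) (m + 1) - x i (m + 1)) - (x (i + 1) m - x i m) =
        τ * (θ * (v (Rd N ℓ x (i + 1) m) - v (Rd N ℓ x i m)) +
          (1 - θ) * (v (Rd N ℓ x (i + 1) (m + 1)) - v (Rd N ℓ x i (m + 1)))) := by
      rw [e1, e2]; ring
    rw [this, abs_mul, abs_of_pos hτ0]
    refine mul_le_mul_of_nonneg_left ((abs_add_le _ _).trans ?_) hτ0.le
    rw [abs_mul, abs_mul, abs_of_nonneg hθ0, abs_of_nonneg (sub_nonneg.2 hθ1)]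
    have k1 := mul_le_mul_of_nonneg_left l1 hθ0
    have k2 := mul_le_mul_of_nonneg_left l2 (sub_nonneg.2 hθ1)
    linarith
  generalize θ * |Rd N ℓ x (i + 1) m - Rd N ℓ x i m| +
            (1 - θ) * |Rd N ℓ x (i + 1) (m + 1) - Rd N ℓ x i (m + 1)| = Q at hdiff ⊢
  refine ⟨⟨lt_min b0.1 b1.1, ?_, ?_, max_le b0.2 b1.2⟩, ?_⟩
  all_goals
    rw [rt]
    try rw [r1]
    rw [r0]
    clear rt r0 r1 e1 e2
    generalize x (i + 1) m - x i m = d0 at *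
    generalize x (i + 1) (m + 1) - x i (m + 1) = d1 at *
    have hd : 0 < d0 + s * (d1 - d0) := by nlinarith
  · rcases le_total d0 d1 with h | h
    · exact (min_le_right _ _).trans (div_le_div_of_nonneg_left hℓ0.le hd (by nlinarith))
    · exact (min_le_left _ _).trans (div_le_div_of_nonneg_left hℓ0.le hd (by nlinarith))
  · rcases le_total d0 d1 with h | h
    · exact (div_le_div_of_nonneg_left hℓ0.le g0 (by nlinarith)).trans (le_max_left _ _)
    · exact (div_le_div_of_nonneg_left hℓ0.le g1 (by nlinarith)).trans (le_max_right _ _)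
  · generalize hD : d0 + s * (d1 - d0) = D at *
    have h1 : ℓ / D - ℓ / d0 = (ℓ / (D * d0)) * (-(s * (d1 - d0))) := by
      field_simp
      linarith
    have h2 : τ / ℓ * Lv * (ℓ / D) * (ℓ / d0) * Q = (ℓ / (D * d0)) * (τ * (Lv * Q)) := by
      field_simp
    have hc : 0 < ℓ / (D * d0) := by positivity
    rw [h1, h2, abs_mul, abs_of_pos hc, abs_neg, abs_mul, abs_of_pos hs0]
    refine mul_le_mul_of_nonneg_left (le_trans ?_ hdiff) hc.le
    exact mul_le_of_le_one_left (abs_nonneg _) hs1.le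
end

section
/- Let R > 0, let v : ℝ → ℝ be continuously differentiable on [0,R] with v'(ρ) < 0 on [0,R] and extended constantly outside [0,R], and let ρ̄ be a compactly supported BV function with 0 ≤ ρ̄ ≤ R a.e. and L = ∫_ℝ ρ̄ > 0. Fix T > 0, θ ∈ [0,1], and monotone sequences of positive integers (N_n), (M_n) with N_n → ∞ and θ N_n T [v]_Lip R² < L M_n for every n. For each n, let (x_i^{(n),m}) be a particle configuration for the θ-scheme with parameters N_n, M_n, ℓ_n = L/N_n, τ_n = T/M_n, initial positions given by the ℓ_n-quantile points of ρ̄, and with 0 < R_i^{(n),m} ≤ R for all i, m; let ρ_n(x,t) = Σ_{m=0}^{M_n−1} Σ_{i=0}^{N_n−1} R_i^{(n),m} 1_{[x_i^{(n),m}, x_{i+1}^{(n),m})}(x) 1_{[m τ_n, (m+1) τ_n)}(t) be the associated discrete density, and assume TV(ρ_n(·, m τ_n)) ≤ TV(ρ̄) for all m. Then there exist a subsequence (ρ_{n_k}) and a measurable function ρ : ℝ × [0,T] → [0,R] with compact support such that ρ_{n_k} → ρ strongly in L¹(ℝ × [0,T]), and for every t ∈ [0,T] one has ‖ρ(·,t)‖_{L∞(ℝ)}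 ≤ R and TV(ρ(·,t)) ≤ TV(ρ̄). -/
open MeasureTheory Filter

/-! ### Averages -/

/-- Average of `f` over `[y, y+h]`. -/
noncomputable def avG (f : ℝ → ℝ) (h y : ℝ) : ℝ := ∫ s in (0:ℝ)..1, f (y + h * s)

lemma ii_of_bdd {g : ℝ → ℝ} {K : ℝ} (hg : Measurable g) (hb : ∀ z, |g z| ≤ K) (a b : ℝ) :
    IntervalIntegrable g volume a b := by
  rw [intervalIntegrable_iff]
  refine Measure.integrableOn_of_bounded (M := K) ?_ hg.aestronglyMeasurable ?_
  · rw [Set.uIoc]; simp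
  · exact Eventually.of_forall fun z => by simpa using hb z

lemma ii_av {g : ℝ → ℝ} {K : ℝ} (hg : Measurable g) (hb : ∀ z, |g z| ≤ K) (h y a b : ℝ) :
    IntervalIntegrable (fun s => g (y + h * s)) volume a b :=
  ii_of_bdd (hg.comp (by fun_prop)) (fun _ => hb _) a b

lemma avG_eq {g : ℝ → ℝ} {K : ℝ} (hg : Measurable g) (hb : ∀ z, |g z| ≤ K) {h : ℝ}
    (hh : h ≠ 0) (A y : ℝ) :
    avG g h y = h⁻¹ * ((∫ z in A..(y + h), g z) - ∫ z in A..y, g z) := by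
  unfold avG
  rw [intervalIntegral.integral_comp_add_mul g hh, 
    intervalIntegral.integral_interval_sub_left (ii_of_bdd hg hb _ _) (ii_of_bdd hg hb _ _)]
  simp

lemma avG_mono {f g : ℝ → ℝ} {K K' : ℝ} (hf : Measurable f) (hb : ∀ z, |f z| ≤ K)
    (hg : Measurable g) (hb' : ∀ z, |g z| ≤ K') {h h' y y' : ℝ}
    (H : ∀ s ∈ Set.Icc (0:ℝ) 1, f (y + h * s) ≤ g (y' + h' * s)) :
    avG f h y ≤ avG g h' y' :=
  intervalIntegral.integral_mono_on zero_le_one (ii_av hf hb _ _ _ _) (ii_av hg hb' _ _ _ _) H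

lemma avG_const (c h y : ℝ) : avG (fun _ => c) h y = c := by simp [avG]

lemma avG_mem {f : ℝ → ℝ} {K a b : ℝ} (hf : Measurable f) (hb : ∀ z, |f z| ≤ K)
    (H : ∀ z, f z ∈ Set.Icc a b) (h y : ℝ) : avG f h y ∈ Set.Icc a b := by
  constructor
  · calc a = avG (fun _ => a) h y := (avG_const _ _ _).symm
      _ ≤ _ := avG_mono measurable_const (fun _ => le_refl |a|) hf hb fun s _ => (H _).1
  · calc avG f h y ≤ avG (fun _ => b) h y :=
        avG_mono hf hb measurable_const (fun _ => le_refl |b|) fun s _ => (H _).2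
      _ = b := (avG_const _ _ _)

lemma avG_sub {f g : ℝ → ℝ} {K K' : ℝ} (hf : Measurable f) (hb : ∀ z, |f z| ≤ K)
    (hg : Measurable g) (hb' : ∀ z, |g z| ≤ K') (h h' y y' : ℝ) :
    avG f h y - avG g h' y' = ∫ s in (0:ℝ)..1, (f (y + h * s) - g (y' + h' * s)) :=
  (intervalIntegral.integral_sub (ii_av hf hb _ _ _ _) (ii_av hg hb' _ _ _ _)).symm

/-- `W` dominates the variation of `f`. -/
structure Dom (R V : ℝ) (f W : ℝ → ℝ) : Prop where
  meas : Measurable f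
  mem : ∀ z, f z ∈ Set.Icc 0 R
  Wmono : Monotone W
  Wmem : ∀ z, W z ∈ Set.Icc 0 V
  dom : ∀ a b, a ≤ b → |f b - f a| ≤ W b - W a

namespace Dom
variable {R V : ℝ} {f W : ℝ → ℝ}

lemma fb (D : Dom R V f W) (z : ℝ) : |f z| ≤ R := by
  have := D.mem z; rw [abs_of_nonneg this.1]; exact this.2

lemma Wb (D : Dom R V f W) (z : ℝ) : |W z| ≤ V := by
  have := D.Wmem z; rw [abs_of_nonneg this.1]; exact this.2

lemma Wmeas (D : Dom R V f W) : Measurable W := D.Wmono.measurable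

lemma av_dom (D : Dom R V f W) (h : ℝ) {a b : ℝ} (hab : a ≤ b) :
    |avG f h b - avG f h a| ≤ avG W h b - avG W h a := by
  rw [avG_sub D.meas D.fb D.meas D.fb, avG_sub D.Wmeas D.Wb D.Wmeas D.Wb]
  refine (intervalIntegral.abs_integral_le_integral_abs zero_le_one).trans ?_
  refine intervalIntegral.integral_mono_on zero_le_one ?_ ?_ ?_
  · exact ((ii_av D.meas D.fb _ _ _ _).sub (ii_av D.meas D.fb _ _ _ _)).abs
  · exact ((ii_av D.Wmeas D.Wb _ _ _ _).sub (ii_av D.Wmeas D.Wb _ _ _ _))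
  · intro s _
    exact D.dom _ _ (by linarith)

lemma av_near (D : Dom R V f W) {h : ℝ} (hh : 0 ≤ h) (y : ℝ) :
    |f y - avG f h y| ≤ W (y + h) - W y := by
  have : f y - avG f h y = ∫ s in (0:ℝ)..1, (f y - f (y + h * s)) := by
    rw [intervalIntegral.integral_sub (by simp) (ii_av D.meas D.fb _ _ _ _)]; simp [avG]
  rw [this]
  have h2 : W (y + h) - W y = ∫ s in (0:ℝ)..1, (W (y + h) - W y) := by simp
  rw [h2]
  refine (intervalIntegral.abs_integral_le_integral_abs zero_le_one).trans ?_
  refine intervalIntegral.integral_mono_on zero_le_one ?_ (by simp) ?_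
  · exact ((by simp : IntervalIntegrable (fun _ => f y) volume 0 1).sub
      (ii_av D.meas D.fb _ _ _ _)).abs
  · intro s hs
    have h3 : y ≤ y + h * s := by nlinarith [hs.1]
    rw [abs_sub_comm]
    refine (D.dom _ _ h3).trans ?_
    have : W (y + h * s) ≤ W (y + h) := D.Wmono (by nlinarith [hs.2])
    linarith

lemma int_near (D : Dom R V f W) {h : ℝ} (hh : 0 ≤ h) {a b : ℝ} (hab : a ≤ b) :
    ∫ y in a..b, |f y - avG f h y| ≤ h * V := by
  have hW : ∀ a b, IntervalIntegrable W volume a b := ii_of_bdd D.Wmeas D.Wb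
  have hav : Measurable (fun y => avG f h y) := by
    rcases hh.eq_or_lt with rfl | hpos
    · simpa [avG] using D.meas
    · have : (fun y => avG f h y) = 
        fun y => h⁻¹ * ((∫ z in (0:ℝ)..(y + h), f z) - ∫ z in (0:ℝ)..y, f z) := 
        funext fun y => avG_eq D.meas D.fb hpos.ne' 0 y
      rw [this]
      have hc := intervalIntegral.continuous_primitive (μ := volume) (ii_of_bdd D.meas D.fb) 0
      have hc2 : Continuous fun y => ∫ z in (0:ℝ)..(y + h), f z := hc.comp (by fun_prop)
      exact (continuous_const.mul (hc2.sub hc)).measurable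
  have hW' : IntervalIntegrable (fun y => W (y + h)) volume a b := 
    ii_of_bdd (D.Wmeas.comp (by fun_prop)) (fun _ => D.Wb _) _ _
  calc ∫ y in a..b, |f y - avG f h y| ≤ ∫ y in a..b, (W (y + h) - W y) := by
        refine intervalIntegral.integral_mono_on hab ?_ (hW'.sub (hW _ _)) 
          fun y _ => D.av_near hh y
        refine ((ii_of_bdd D.meas D.fb _ _).sub (ii_of_bdd (K := R) hav (fun y => ?_) _ _)).abs
        have := avG_mem D.meas D.fb D.mem h y
        rw [abs_of_nonneg this.1]; exact this.2
    _ = (∫ y in b..(b + h), W y) - ∫ y in a..(a + h), W y := by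
        rw [intervalIntegral.integral_sub hW' (hW _ _), intervalIntegral.integral_comp_add_right,
          intervalIntegral.integral_interval_sub_interval_comm' (hW _ _) (hW _ _) (hW _ _)]
    _ ≤ (∫ y in b..(b + h), V) - ∫ y in a..(a + h), 0 := by
        gcongr
        · exact intervalIntegral.integral_mono_on (by linarith) (hW _ _) (by simp)
            fun y _ => (D.Wmem y).2
        · exact intervalIntegral.integral_mono_on (by linarith) (by simp) (hW _ _)
            fun y _ => (D.Wmem y).1
    _ = h * V := by simp

end Dom

lemma eVar_le_of_dom {ρ w : ℝ → ℝ} {V : ℝ} (hV : ∀ z, w z ∈ Set.Icc 0 V)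
    (hd : ∀ a b, a ≤ b → |ρ b - ρ a| ≤ w b - w a) :
    eVariationOn ρ Set.univ ≤ ENNReal.ofReal V := by
  unfold eVariationOn
  refine iSup_le ?_
  rintro ⟨n, u, hu, -⟩
  simp only
  calc ∑ i ∈ Finset.range n, edist (ρ (u (i + 1))) (ρ (u i))
      ≤ ∑ i ∈ Finset.range n, ENNReal.ofReal (w (u (i + 1)) - w (u i)) := by
        refine Finset.sum_le_sum fun i _ => ?_
        rw [edist_dist, Real.dist_eq]
        exact ENNReal.ofReal_le_ofReal (hd _ _ (hu (Nat.le_succ i)))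
    _ = ENNReal.ofReal (∑ i ∈ Finset.range n, (w (u (i + 1)) - w (u i))) := by
        rw [ENNReal.ofReal_sum_of_nonneg]
        intro i _
        exact (abs_nonneg _).trans (hd _ _ (hu (Nat.le_succ i)))
    _ ≤ ENNReal.ofReal V := by
        refine ENNReal.ofReal_le_ofReal ?_
        rw [Finset.sum_range_sub (fun i => w (u i))]
        have := (hV (u n)).2
        have := (hV (u 0)).1
        linarith

lemma ultra_lim {g : ℕ → ℝ} {a b : ℝ} (h : ∀ n, g n ∈ Set.Icc a b) :
    ∃ c, Tendsto g (hyperfilter ℕ) (nhds c) := by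
  obtain ⟨c, -, hc⟩ := (isCompact_Icc (a := a) (b := b)).ultrafilter_le_nhds
    ((hyperfilter ℕ).map g) (by
      rw [Filter.le_principal_iff]
      exact Filter.mem_map.2 (Filter.univ_mem' h))
  exact ⟨c, hc⟩

/-- Step sizes. -/
noncomputable def hk (k : ℕ) : ℝ := 1 / ((k : ℝ) + 1)

lemma hk_pos (k : ℕ) : 0 < hk k := Nat.one_div_pos_of_nat
lemma hk_anti : Antitone hk := fun _ _ h => Nat.one_div_le_one_div h
lemma hk_tendsto : Tendsto hk atTop (nhds 0) := tendsto_one_div_add_atTop_nhds_zero_nat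

lemma core {R V A B : ℝ} (f W : ℕ → ℝ → ℝ) (F : ℝ → ℝ)
    (hAB : A ≤ B)
    (hD : ∀ n, Dom R V (f n) (W n))
    (hsupp : ∀ n y, (y < A ∨ B < y) → f n y = 0)
    (hF : ∀ y, Tendsto (fun n => ∫ z in A..y, f n z) atTop (nhds (F y))) :
    ∃ ρ : ℝ → ℝ,
      (∀ y, Tendsto (fun k => (hk k)⁻¹ * (F (y + hk k) - F y)) atTop (nhds (ρ y))) ∧
      (∀ y, ρ y ∈ Set.Icc 0 R) ∧
      (∀ y, (y < A ∨ B < y) → ρ y = 0) ∧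
      eVariationOn ρ Set.univ ≤ ENNReal.ofReal V ∧
      Tendsto (fun n => ∫ y, |f n y - ρ y|) atTop (nhds 0) := by
  set d : ℕ → ℝ → ℝ := fun k y => (hk k)⁻¹ * (F (y + hk k) - F y) with hd
  have hda : ∀ k y, Tendsto (fun n => avG (f n) (hk k) y) atTop (nhds (d k y)) := by
    intro k y
    have : (fun n => avG (f n) (hk k) y) = fun n =>
        (hk k)⁻¹ * ((∫ z in A..(y + hk k), f n z) - ∫ z in A..y, f n z) := funext fun n => 
        avG_eq (hD n).meas (hD n).fb (hk_pos k).ne' A y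
    rw [this]
    exact ((hF _).sub (hF _)).const_mul _
  have hdU : ∀ k y, Tendsto (fun n => avG (f n) (hk k) y) (hyperfilter ℕ) (nhds (d k y)) :=
    fun k y => (hda k y).mono_left Nat.hyperfilter_le_atTop
  have hW : ∀ n k y, avG (W n) (hk k) y ∈ Set.Icc 0 V := fun n k y => 
    avG_mem (hD n).Wmeas (hD n).Wb (hD n).Wmem _ _
  have hex : ∀ k y, ∃ c, Tendsto (fun n => avG (W n) (hk k) y) (hyperfilter ℕ) (nhds c) :=
    fun k y => ultra_lim fun n => hW n k y
  choose w hw using hex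
  have hwm : ∀ k y, w k y ∈ Set.Icc 0 V := fun k y => 
    isClosed_Icc.mem_of_tendsto (hw k y) (Eventually.of_forall fun n => hW n k y)
  have hdm : ∀ k y, d k y ∈ Set.Icc 0 R := fun k y => 
    isClosed_Icc.mem_of_tendsto (hda k y) (Eventually.of_forall fun n => 
      avG_mem (hD n).meas (hD n).fb (hD n).mem _ _)
  have hwanti : ∀ y, Antitone fun k => w k y := by
    intro y k l hkl
    refine le_of_tendsto_of_tendsto (hw l y) (hw k y) (Eventually.of_forall fun n => ?_)
    refine avG_mono (hD n).Wmeas (hD n).Wb (hD n).Wmeas (hD n).Wb fun s hs => (hD n).Wmono ?_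
    have := mul_le_mul_of_nonneg_right (hk_anti hkl) hs.1
    linarith
  have heanti : ∀ y, Antitone fun k => w k y - d k y := by
    intro y k l hkl
    refine le_of_tendsto_of_tendsto ((hw l y).sub (hdU l y)) ((hw k y).sub (hdU k y))
      (Eventually.of_forall fun n => ?_)
    have D := hD n
    simp only
    rw [avG_sub D.Wmeas D.Wb D.meas D.fb, avG_sub D.Wmeas D.Wb D.meas D.fb]
    refine intervalIntegral.integral_mono_on zero_le_one 
      ((ii_av D.Wmeas D.Wb _ _ _ _).sub (ii_av D.meas D.fb _ _ _ _))
      ((ii_av D.Wmeas D.Wb _ _ _ _).sub (ii_av D.meas D.fb _ _ _ _)) fun s hs => ?_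
    have := mul_le_mul_of_nonneg_right (hk_anti hkl) hs.1
    have h1 := D.dom (y + hk l * s) (y + hk k * s) (by linarith)
    have h2 := le_abs_self (f n (y + hk k * s) - f n (y + hk l * s))
    linarith
  have hwlim : ∀ y, ∃ c, Tendsto (fun k => w k y) atTop (nhds c) := fun y =>
    ⟨_, tendsto_atTop_ciInf (hwanti y) ⟨0, by rintro _ ⟨k, rfl⟩; exact (hwm k y).1⟩⟩
  have helim : ∀ y, ∃ c, Tendsto (fun k => w k y - d k y) atTop (nhds c) := fun y =>
    ⟨_, tendsto_atTop_ciInf (heanti y) ⟨-R, by 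
      rintro _ ⟨k, rfl⟩
      have h1 := (hwm k y).1
      have h2 := (hdm k y).2
      simp only; linarith⟩⟩
  choose w' hw' using hwlim
  choose e he using helim
  have hρ : ∀ y, Tendsto (fun k => d k y) atTop (nhds (w' y - e y)) := fun y => by
    simpa using (hw' y).sub (he y)
  set ρ : ℝ → ℝ := fun y => w' y - e y with hρdef
  have hdmeas : ∀ k, Measurable (d k) := fun k => by
    have hFm : Measurable F := by
      refine measurable_of_tendsto_metrizable (f := fun n y => ∫ z in A..y, f n z) (fun n => ?_)
        (tendsto_pi_nhds.2 hF)
      exact (intervalIntegral.continuous_primitive (μ := volume)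
        (ii_of_bdd (hD n).meas (hD n).fb) A).measurable
    simp only [hd]
    fun_prop
  have hρmeas : Measurable ρ := measurable_of_tendsto_metrizable hdmeas (tendsto_pi_nhds.2 hρ)
  have hρm : ∀ y, ρ y ∈ Set.Icc 0 R := fun y => 
    isClosed_Icc.mem_of_tendsto (hρ y) (Eventually.of_forall fun k => hdm k y)
  have hρs : ∀ y, (y < A ∨ B < y) → ρ y = 0 := by
    intro y hy
    refine tendsto_nhds_unique (hρ y) (tendsto_const_nhds.congr' ?_)
    have hev : ∀ᶠ k in atTop, ∀ s ∈ Set.Icc (0:ℝ) 1, y + hk k * s < A ∨ B < y + hk k * s := by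
      rcases hy with hy | hy
      · have : ∀ᶠ k in atTop, hk k < A - y := hk_tendsto.eventually_lt_const (by linarith)
        filter_upwards [this] with k h s hs
        left
        nlinarith [hk_pos k, hs.1, hs.2]
      · refine Eventually.of_forall fun k s hs => Or.inr ?_
        nlinarith [hk_pos k, hs.1, hs.2]
    filter_upwards [hev] with k h
    refine tendsto_nhds_unique (tendsto_const_nhds.congr' (Eventually.of_forall fun n => ?_))
      (hda k y)
    unfold avG
    rw [intervalIntegral.integral_congr (g := fun _ => 0)]
    · simp
    · intro s hs
      rw [Set.uIcc_of_le zero_le_one] at hs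
      exact hsupp n _ (h s hs)
  refine ⟨ρ, hρ, hρm, hρs, ?_, ?_⟩
  · refine eVar_le_of_dom (w := w') (fun z => isClosed_Icc.mem_of_tendsto (hw' z) 
      (Eventually.of_forall fun k => hwm k z)) fun a b hab => ?_
    refine le_of_tendsto_of_tendsto ((hρ b).sub (hρ a)).abs ((hw' b).sub (hw' a))
      (Eventually.of_forall fun k => ?_)
    refine le_of_tendsto_of_tendsto ((hdU k b).sub (hdU k a)).abs ((hw k b).sub (hw k a))
      (Eventually.of_forall fun n => ?_)
    exact (hD n).av_dom (hk k) hab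
  · have hab : A - 1 ≤ B + 1 := by linarith
    have hI : ∀ n, ∫ y, |f n y - ρ y| = ∫ y in (A-1)..(B+1), |f n y - ρ y| := by
      intro n
      refine (intervalIntegral.integral_eq_integral_of_support_subset ?_).symm
      intro y hy
      by_contra hcon
      apply hy
      have : y < A ∨ B < y := by
        by_contra hc
        push Not at hc
        exact hcon ⟨by linarith [hc.1], by linarith [hc.2]⟩
      simp [hsupp n y this, hρs y this]
    simp only [hI]
    have hb2 : ∀ a b : ℝ, a ∈ Set.Icc 0 R → b ∈ Set.Icc 0 R → |a - b| ≤ R := by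
      intro a b ha hb
      rw [abs_le]; constructor <;> linarith [ha.1, ha.2, hb.1, hb.2]
    have ham : ∀ n k y, avG (f n) (hk k) y ∈ Set.Icc 0 R := fun n k y => 
      avG_mem (hD n).meas (hD n).fb (hD n).mem _ _
    have hameas : ∀ n k, Measurable fun y => avG (f n) (hk k) y := by
      intro n k
      have : (fun y => avG (f n) (hk k) y) = fun y =>
        (hk k)⁻¹ * ((∫ z in A..(y + hk k), f n z) - ∫ z in A..y, f n z) := funext fun y => 
        avG_eq (hD n).meas (hD n).fb (hk_pos k).ne' A y
      rw [this]
      have hc := intervalIntegral.continuous_primitive (μ := volume)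
        (ii_of_bdd (hD n).meas (hD n).fb) A
      have hc2 : Continuous fun y => ∫ z in A..(y + hk k), f n z := hc.comp (by fun_prop)
      exact (continuous_const.mul (hc2.sub hc)).measurable
    have h3 : Tendsto (fun k => ∫ y in (A-1)..(B+1), |d k y - ρ y|) atTop (nhds 0) := by
      have := intervalIntegral.tendsto_integral_filter_of_dominated_convergence (μ := volume)
        (a := A - 1) (b := B + 1) (l := atTop) (F := fun k y => |d k y - ρ y|) (f := fun _ => 0)
        (fun _ => R) 
        (Eventually.of_forall fun k => ((hdmeas k).sub hρmeas).abs.aestronglyMeasurable)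
        (Eventually.of_forall fun k => Eventually.of_forall fun y _ => by
          simpa using hb2 _ _ (hdm k y) (hρm y)) (by simp)
        (Eventually.of_forall fun y _ => by
          simpa using ((show Tendsto (fun k => d k y) atTop (nhds (ρ y)) from hρ y).sub
            (tendsto_const_nhds (x := ρ y))).abs)
      simpa using this
    have h2 : ∀ k, Tendsto (fun n => ∫ y in (A-1)..(B+1), |avG (f n) (hk k) y - d k y|)
        atTop (nhds 0) := by
      intro k
      have := intervalIntegral.tendsto_integral_filter_of_dominated_convergence (μ := volume)
        (a := A - 1) (b := B + 1) (l := atTop) (F := fun n y => |avG (f n) (hk k) y - d k y|)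
        (f := fun _ => 0) (fun _ => R) 
        (Eventually.of_forall fun n => ((hameas n k).sub (hdmeas k)).abs.aestronglyMeasurable)
        (Eventually.of_forall fun n => Eventually.of_forall fun y _ => by
          simpa using hb2 _ _ (ham n k y) (hdm k y)) (by simp)
        (Eventually.of_forall fun y _ => by
          simpa using ((hda k y).sub (tendsto_const_nhds (x := d k y))).abs)
      simpa using this
    have h1 : Tendsto (fun k => hk k * V) atTop (nhds 0) := by
      simpa using hk_tendsto.mul_const V
    have key : ∀ n k, ∫ y in (A-1)..(B+1), |f n y - ρ y| ≤ hk k * V +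
        (∫ y in (A-1)..(B+1), |avG (f n) (hk k) y - d k y|) +
        ∫ y in (A-1)..(B+1), |d k y - ρ y| := by
      intro n k
      have i1 : IntervalIntegrable (fun y => |f n y - avG (f n) (hk k) y|) volume (A-1) (B+1) :=
        ii_of_bdd (K := R) (((hD n).meas.sub (hameas n k)).abs)
          (fun y => by simpa using hb2 _ _ ((hD n).mem y) (ham n k y)) _ _
      have i2 : IntervalIntegrable (fun y => |avG (f n) (hk k) y - d k y|) volume (A-1) (B+1) :=
        ii_of_bdd (K := R) (((hameas n k).sub (hdmeas k)).abs)
          (fun y => by simpa using hb2 _ _ (ham n k y) (hdm k y)) _ _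
      have i3 : IntervalIntegrable (fun y => |d k y - ρ y|) volume (A-1) (B+1) :=
        ii_of_bdd (K := R) (((hdmeas k).sub hρmeas).abs)
          (fun y => by simpa using hb2 _ _ (hdm k y) (hρm y)) _ _
      have i0 : IntervalIntegrable (fun y => |f n y - ρ y|) volume (A-1) (B+1) :=
        ii_of_bdd (K := R) (((hD n).meas.sub hρmeas).abs)
          (fun y => by simpa using hb2 _ _ ((hD n).mem y) (hρm y)) _ _
      have hn := (hD n).int_near (hk_pos k).le hab
      calc ∫ y in (A-1)..(B+1), |f n y - ρ y| ≤ ∫ y in (A-1)..(B+1), 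
            (|f n y - avG (f n) (hk k) y| + |avG (f n) (hk k) y - d k y| + |d k y - ρ y|) := by
            refine intervalIntegral.integral_mono_on hab i0 ((i1.add i2).add i3) fun y _ => ?_
            have e1 := abs_sub_le (f n y) (avG (f n) (hk k) y) (ρ y)
            have e2 := abs_sub_le (avG (f n) (hk k) y) (d k y) (ρ y)
            linarith
        _ = _ := by
            rw [intervalIntegral.integral_add (i1.add i2) i3, intervalIntegral.integral_add i1 i2]
        _ ≤ _ := by gcongr
    rw [Metric.tendsto_atTop]
    intro ε hε
    obtain ⟨k, hk1, hk3⟩ := ((h1.eventually_lt_const (show 0 < ε / 3 by positivity)).and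
      (h3.eventually_lt_const (show 0 < ε / 3 by positivity))).exists
    obtain ⟨n0, hn0⟩ := eventually_atTop.1
      ((h2 k).eventually_lt_const (show 0 < ε / 3 by positivity))
    refine ⟨n0, fun n hn => ?_⟩
    rw [Real.dist_eq, sub_zero, abs_of_nonneg]
    · have := key n k
      have := hn0 n hn
      linarith
    · exact intervalIntegral.integral_nonneg hab fun y _ => abs_nonneg _

lemma abstract_compact {R V A B T : ℝ} (hR : 0 < R) (hAB : A ≤ B)
    (D : ℕ → ℝ → ℝ → ℝ)
    (hmeas : ∀ n, Measurable (Function.uncurry (D n)))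
    (hDom : ∀ n t, ∃ W, Dom R V (fun y => D n y t) W)
    (hsupp : ∀ n t y, (y < A ∨ B < y) → D n y t = 0)
    (htime : ∀ t, ∀ ε > 0, ∃ r : ℚ, ∀ᶠ n in atTop, ∀ y,
      |(∫ z in A..y, D n z t) - ∫ z in A..y, D n z (T * r)| ≤ ε) :
    ∃ φ : ℕ → ℕ, StrictMono φ ∧
      ∃ ρ : ℝ → ℝ → ℝ,
        Measurable (Function.uncurry ρ) ∧
        (∀ t y : ℝ, (y < A ∨ B < y) → ρ y t = 0) ∧
        (∀ t y : ℝ, ρ y t ∈ Set.Icc 0 R) ∧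
        (∀ t, eVariationOn (fun y => ρ y t) Set.univ ≤ ENNReal.ofReal V) ∧
        Tendsto (fun k => ∫ t in (0 : ℝ)..T, ∫ y : ℝ, |D (φ k) y t - ρ y t|)
          atTop (nhds 0) := by
  choose W hW using hDom
  set F : ℕ → ℝ → ℝ → ℝ := fun n y t => ∫ z in A..y, D n z t with hF
  have hii : ∀ n t a b, IntervalIntegrable (fun y => D n y t) volume a b := fun n t => 
    ii_of_bdd (hW n t).meas (hW n t).fb
  have hLip : ∀ n t y y', |F n y t - F n y' t| ≤ R * |y - y'| := by
    intro n t y y'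
    simp only [hF]
    rw [intervalIntegral.integral_interval_sub_left (hii _ _ _ _) (hii _ _ _ _)]
    exact intervalIntegral.norm_integral_le_of_norm_le_const (f := fun z => D n z t)
      (fun z _ => (hW n t).fb z)
  have hFA : ∀ n t, F n A t = 0 := by intro n t; simp [hF]
  obtain ⟨a, -, φ, hφ, ha⟩ := (isCompact_univ_pi (ι := ℚ × ℚ) (X := fun _ => ℝ)
    (s := fun p => Set.Icc (-(R * |(p.1:ℝ) - A|)) (R * |(p.1:ℝ) - A|))
    (fun p => isCompact_Icc)).tendsto_subseq (x := fun n p => F n p.1 (T * p.2)) (by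
      intro n p _
      have := hLip n (T * p.2) p.1 A
      rw [hFA, sub_zero] at this
      exact abs_le.1 this)
  have ha' : ∀ q r : ℚ, Tendsto (fun k => F (φ k) q (T * r)) atTop (nhds (a (q, r))) := by
    intro q r
    exact (tendsto_pi_nhds.1 ha) (q, r)
  have hconv : ∀ y t, ∃ c, Tendsto (fun k => F (φ k) y t) atTop (nhds c) := by
    intro y t
    apply cauchySeq_tendsto_of_complete
    rw [Metric.cauchySeq_iff']
    intro ε hε
    obtain ⟨r, hr⟩ := htime t (ε / 8) (by positivity)
    obtain ⟨q, hq1, hq2⟩ := exists_rat_btwn (show y < y + ε / (8 * R) by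
      have : 0 < ε / (8 * R) := by positivity
      linarith)
    have hq : R * |y - q| ≤ ε / 8 := by
      rw [abs_of_neg (by linarith)]
      have : R * (-(y - q)) ≤ R * (ε / (8 * R)) := by gcongr; linarith
      calc _ ≤ _ := this
        _ = ε / 8 := by field_simp
    have hr' := hφ.tendsto_atTop.eventually hr
    have hcl : ∀ᶠ k in atTop, |F (φ k) q (T * r) - a (q, r)| < ε / 8 := by
      have := (Metric.tendsto_nhds.1 (ha' q r)) (ε / 8) (by positivity)
      simpa [Real.dist_eq] using this
    obtain ⟨k0, hk0⟩ := eventually_atTop.1 (hr'.and hcl)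
    have main : ∀ k ≥ k0, |F (φ k) y t - a (q, r)| ≤ 3 * ε / 8 := by
      intro k hk
      obtain ⟨h1, h2⟩ := hk0 k hk
      have h1 := h1 y
      have h3 := hLip (φ k) (T * r) y q
      have h1' : |F (φ k) y t - F (φ k) y (T * r)| ≤ ε / 8 := h1
      rw [abs_le] at *
      rw [abs_lt] at h2
      constructor <;> linarith [h1'.1, h1'.2, h2.1, h2.2, h3.1, h3.2]
    refine ⟨k0, fun k hk => ?_⟩
    rw [Real.dist_eq]
    have h1 := abs_le.1 (main k hk)
    have h2 := abs_le.1 (main k0 le_rfl)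
    rw [abs_lt]
    constructor <;> linarith [h1.1, h1.2, h2.1, h2.2]
  choose F' hF' using hconv
  have hFmeas : ∀ n, Measurable (Function.uncurry (F n)) := by
    intro n
    refine measurable_uncurry_of_continuous_of_measurable (fun t => ?_) (fun y => ?_)
    · exact intervalIntegral.continuous_primitive (μ := volume) (hii n t) A
    · simp only [hF, intervalIntegral]
      have h := ((hmeas n).comp measurable_swap).stronglyMeasurable
      exact ((StronglyMeasurable.integral_prod_right (ν := volume.restrict (Set.Ioc A y))
        (f := fun t z => D n z t) h).sub
        (StronglyMeasurable.integral_prod_right (ν := volume.restrict (Set.Ioc y A))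
        (f := fun t z => D n z t) h)).measurable
  have hF'meas : Measurable (Function.uncurry F') :=
    measurable_of_tendsto_metrizable (fun k => hFmeas (φ k))
      (tendsto_pi_nhds.2 fun p => hF' p.1 p.2)
  have hcore := fun t => core (f := fun k y => D (φ k) y t) (W := fun k => W (φ k) t)
    (fun y => F' y t) hAB (fun k => hW (φ k) t) (fun k y => hsupp (φ k) t y) (fun y => hF' y t)
  choose ρ h1 h2 h3 h4 h5 using hcore
  have hρmeas : Measurable (Function.uncurry fun y t => ρ t y) := by
    refine measurable_of_tendsto_metrizable 
      (f := fun k (p : ℝ × ℝ) => (hk k)⁻¹ * (F' (p.1 + hk k) p.2 - F' p.1 p.2)) (fun k => ?_)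
      (tendsto_pi_nhds.2 fun p => h1 p.2 p.1)
    have e1 : Measurable fun p : ℝ × ℝ => F' (p.1 + hk k) p.2 :=
      hF'meas.comp (by fun_prop : Measurable fun p : ℝ × ℝ => (p.1 + hk k, p.2))
    exact (e1.sub hF'meas).const_mul _
  refine ⟨φ, hφ, fun y t => ρ t y, hρmeas, h3, h2, h4, ?_⟩
  have := intervalIntegral.tendsto_integral_filter_of_dominated_convergence (μ := volume)
    (a := 0) (b := T) (l := atTop) (F := fun k t => ∫ y : ℝ, |D (φ k) y t - ρ t y|)
    (f := fun _ => 0) (fun _ => R * (B - A + 2)) 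
    (Eventually.of_forall fun k => by
      have hm : Measurable (Function.uncurry fun t y => |D (φ k) y t - ρ t y|) := 
        (((hmeas (φ k)).comp measurable_swap).sub (hρmeas.comp measurable_swap)).abs
      exact (hm.stronglyMeasurable.integral_prod_right).aestronglyMeasurable)
    (Eventually.of_forall fun k => Eventually.of_forall fun t _ => by
      have hI : ∫ y in (A-1)..(B+1), |D (φ k) y t - ρ t y| = ∫ y, |D (φ k) y t - ρ t y| := by
        refine (intervalIntegral.integral_eq_integral_of_support_subset ?_)
        intro y hy
        by_contra hcon
        apply hy
        have : y < A ∨ B < y := by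
          by_contra hc
          push Not at hc
          exact hcon ⟨by linarith [hc.1], by linarith [hc.2]⟩
        simp [hsupp (φ k) t y this, h3 t y this]
      rw [← hI]
      refine (intervalIntegral.norm_integral_le_of_norm_le_const (C := R) ?_).trans ?_
      · intro y _
        have e1 := (hW (φ k) t).mem y
        have e2 := h2 t y
        simp only [Real.norm_eq_abs, abs_abs]
        rw [abs_le]
        constructor <;> linarith [e1.1, e1.2, e2.1, e2.2]
      · rw [abs_of_nonneg (by linarith)]
        exact le_of_eq (by ring)) (by simp)
    (Eventually.of_forall fun t _ => h5 t)
  simpa using this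

/-! ### Step functions -/

/-- Heaviside function `1_{p ≤ y}`. -/
noncomputable def heav (p y : ℝ) : ℝ := if p ≤ y then 1 else 0

lemma heav_mono (p : ℝ) : Monotone (heav p) := by
  intro a b hab
  unfold heav
  split_ifs <;> first | linarith | norm_num

lemma heav_nonneg (p y : ℝ) : 0 ≤ heav p y := by unfold heav; split_ifs <;> norm_num
lemma heav_le_one (p y : ℝ) : heav p y ≤ 1 := by unfold heav; split_ifs <;> norm_num

lemma heav_anti {p q : ℝ} (h : p ≤ q) (y : ℝ) : heav q y ≤ heav p y := by
  unfold heav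
  split_ifs <;> first | linarith | norm_num

lemma ind_eq_heav {p q : ℝ} (h : p ≤ q) (y : ℝ) :
    Set.indicator (Set.Ico p q) (fun _ => (1 : ℝ)) y = heav p y - heav q y := by
  unfold heav
  by_cases h1 : p ≤ y <;> by_cases h2 : q ≤ y <;> simp [h1, h2, Set.indicator]
  all_goals linarith

lemma int_heav {A p : ℝ} (h : A ≤ p) (y : ℝ) : ∫ z in A..y, heav p z = max (y - p) 0 := by
  have hint : IntervalIntegrable (heav p) volume A y := (heav_mono p).intervalIntegrable
  have := intervalIntegral.integral_eq_sub_of_hasDeriv_right (f := fun z => max (z - p) 0)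
    (f' := heav p) (a := A) (b := y) (by fun_prop) (fun z _ => ?_) hint
  · rw [this]; simp [h]
  · unfold heav
    split_ifs with hz
    · have h1 : HasDerivWithinAt (fun z => z - p) 1 (Set.Ioi z) z :=
        ((hasDerivAt_id z).sub_const p).hasDerivWithinAt
      refine h1.congr (fun w hw => ?_) ?_
      · have : z < w := hw
        simp; linarith
      · simp; linarith
    · push Not at hz
      have h1 : HasDerivAt (fun z => max (z - p) 0) 0 z := by
        refine (hasDerivAt_const z (0:ℝ)).congr_of_eventuallyEq ?_
        filter_upwards [eventually_lt_nhds hz] with w hw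
        simp; linarith
      exact h1.hasDerivWithinAt

/-- Step function. -/
noncomputable def stp (N : ℕ) (r p : ℕ → ℝ) (y : ℝ) : ℝ :=
  ∑ i ∈ Finset.range N, r i * Set.indicator (Set.Ico (p i) (p (i + 1))) (fun _ => (1 : ℝ)) y

lemma stp_eq {N : ℕ} {r p : ℕ → ℝ} (hp : ∀ i < N, p i < p (i + 1)) (y : ℝ) :
    stp N r p y = ∑ i ∈ Finset.range N, r i * (heav (p i) y - heav (p (i + 1)) y) := by
  unfold stp
  refine Finset.sum_congr rfl fun i hi => ?_
  rw [ind_eq_heav (hp i (Finset.mem_range.1 hi)).le]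

lemma abel (K : ℕ) (r u : ℕ → ℝ) :
    ∑ i ∈ Finset.range (K + 1), r i * (u i - u (i + 1)) =
      r 0 * u 0 + ∑ i ∈ Finset.range K, (r (i + 1) - r i) * u (i + 1) - r K * u (K + 1) := by
  induction K with
  | zero => simp; ring
  | succ K ih => rw [Finset.sum_range_succ, ih, Finset.sum_range_succ]; ring

lemma stp_meas (N : ℕ) (r p : ℕ → ℝ) : Measurable (stp N r p) := by
  unfold stp
  refine Finset.measurable_sum _ fun i _ => ?_
  exact (measurable_const.indicator measurableSet_Ico).const_mul _

lemma stp_dom {N : ℕ} (hN : 0 < N) {r p : ℕ → ℝ} {R V : ℝ}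
    (hp : ∀ i < N, p i < p (i + 1)) (hr : ∀ i < N, 0 < r i ∧ r i ≤ R) 
    (hV : r 0 + (∑ i ∈ Finset.range (N - 1), |r (i + 1) - r i|) + r (N - 1) ≤ V) :
    ∃ W, Dom R V (stp N r p) W := by
  obtain ⟨K, rfl⟩ : ∃ K, N = K + 1 := ⟨N - 1, by omega⟩
  simp only [Nat.add_sub_cancel] at hV
  have h0 := (hr 0 hN).1.le
  have hK := (hr K (by omega)).1.le
  refine ⟨fun y => r 0 * heav (p 0) y + (∑ i ∈ Finset.range K, |r (i + 1) - r i| * heav (p (i + 1)) y)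
    + r K * heav (p (K + 1)) y, stp_meas _ _ _, fun y => ⟨?_, ?_⟩, ?_, fun y => ⟨?_, ?_⟩, ?_⟩
  · rw [stp_eq hp]
    refine Finset.sum_nonneg fun i hi => ?_
    have hi := Finset.mem_range.1 hi
    exact mul_nonneg (hr i hi).1.le (sub_nonneg.2 (heav_anti (hp i hi).le y))
  · rw [stp_eq hp]
    calc _ ≤ ∑ i ∈ Finset.range (K + 1), R * (heav (p i) y - heav (p (i + 1)) y) := by
          refine Finset.sum_le_sum fun i hi => ?_
          have hi := Finset.mem_range.1 hi
          exact mul_le_mul_of_nonneg_right (hr i hi).2 (sub_nonneg.2 (heav_anti (hp i hi).le y))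
      _ = R * (heav (p 0) y - heav (p (K + 1)) y) := by
          rw [← Finset.mul_sum, Finset.sum_range_sub' (fun i => heav (p i) y)]
      _ ≤ R := by
          have := heav_le_one (p 0) y
          have := heav_nonneg (p (K + 1)) y
          have : 0 ≤ R := h0.trans (hr 0 hN).2
          nlinarith
  · intro a b hab
    simp only
    gcongr
    · exact heav_mono _ hab
    · exact heav_mono _ hab
    · exact heav_mono _ hab
  · refine add_nonneg (add_nonneg (mul_nonneg h0 (heav_nonneg _ _)) 
      (Finset.sum_nonneg fun i _ => mul_nonneg (abs_nonneg _) (heav_nonneg _ _))) 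
      (mul_nonneg hK (heav_nonneg _ _))
  · refine le_trans ?_ hV
    gcongr
    · exact mul_le_of_le_one_right h0 (heav_le_one _ _)
    · exact mul_le_of_le_one_right (abs_nonneg _) (heav_le_one _ _)
    · exact mul_le_of_le_one_right hK (heav_le_one _ _)
  · intro a b hab
    rw [stp_eq hp, stp_eq hp, abel, abel]
    have e : ∀ q, 0 ≤ heav q b - heav q a := fun q => sub_nonneg.2 (heav_mono q hab)
    have e1 : |∑ i ∈ Finset.range K, (r (i + 1) - r i) * (heav (p (i + 1)) b - heav (p (i + 1)) a)| ≤
        ∑ i ∈ Finset.range K, |r (i + 1) - r i| * (heav (p (i + 1)) b - heav (p (i + 1)) a) := by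
      refine (Finset.abs_sum_le_sum_abs _ _).trans (le_of_eq (Finset.sum_congr rfl fun i _ => ?_))
      rw [abs_mul, abs_of_nonneg (e _)]
    simp only [mul_sub, Finset.sum_sub_distrib] at e1
    have e2 := mul_nonneg h0 (e (p 0))
    have e3 := mul_nonneg hK (e (p (K + 1)))
    rw [abs_le] at *
    constructor <;> nlinarith [e1.1, e1.2]

lemma mono_of_step {N : ℕ} {p : ℕ → ℝ} (hp : ∀ i < N, p i < p (i + 1)) {i j : ℕ} (hij : i ≤ j)
    (hj : j ≤ N) : p i ≤ p j := by
  induction j, hij using Nat.le_induction with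
  | base => exact le_rfl
  | succ j hij ih => exact (ih (by omega)).trans (hp j (by omega)).le

lemma stp_supp {N : ℕ} {r p : ℕ → ℝ} (hp : ∀ i < N, p i < p (i + 1)) {A B : ℝ}
    (hA : A ≤ p 0) (hB : p N ≤ B) {y : ℝ} (hy : y < A ∨ B < y) : stp N r p y = 0 := by
  unfold stp
  refine Finset.sum_eq_zero fun i hi => ?_
  have hi := Finset.mem_range.1 hi
  have h1 := mono_of_step hp (Nat.zero_le i) hi.le
  have h2 := mono_of_step hp (show i + 1 ≤ N by omega) le_rfl
  rw [Set.indicator_of_notMem, mul_zero]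
  rintro ⟨h3, h4⟩
  rcases hy with hy | hy <;> linarith

lemma int_stp {N : ℕ} {r p : ℕ → ℝ} (hp : ∀ i < N, p i < p (i + 1)) {A : ℝ}
    (hA : A ≤ p 0) (y : ℝ) :
    ∫ z in A..y, stp N r p z = 
      ∑ i ∈ Finset.range N, r i * (max (y - p i) 0 - max (y - p (i + 1)) 0) := by
  have hint : ∀ p, IntervalIntegrable (heav p) volume A y := fun p => (heav_mono p).intervalIntegrable
  simp only [stp_eq hp]
  rw [intervalIntegral.integral_finsetSum]
  · refine Finset.sum_congr rfl fun i hi => ?_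
    have hi := Finset.mem_range.1 hi
    have h1 := mono_of_step hp (Nat.zero_le i) hi.le
    have h2 := hp i hi
    rw [intervalIntegral.integral_const_mul, intervalIntegral.integral_sub (hint _) (hint _),
      int_heav (by linarith), int_heav (by linarith)]
  · intro i _
    exact ((hint _).sub (hint _)).const_mul _

lemma term_cmp {l a b a' b' δ y : ℝ} (hl : 0 ≤ l) (hab : a < b) (hab' : a' < b')
    (ha : a' ≤ a + δ) (hb : b' ≤ b + δ) :
    l / (b - a) * (max (y - a) 0 - max (y - b) 0) ≤
      l / (b' - a') * (max (y + δ - a') 0 - max (y + δ - b') 0) := by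
  have d : 0 < b - a := by linarith
  have d' : 0 < b' - a' := by linarith
  have hR0 : 0 ≤ l / (b' - a') * (max (y + δ - a') 0 - max (y + δ - b') 0) := by
    refine mul_nonneg (div_nonneg hl d'.le) (sub_nonneg.2 ?_)
    exact max_le_max (by linarith) le_rfl
  have hLl : l / (b - a) * (max (y - a) 0 - max (y - b) 0) ≤ l := by
    rw [div_mul_eq_mul_div, div_le_iff₀ d]
    refine mul_le_mul_of_nonneg_left ?_ hl
    rcases le_total (y - a) 0 with h | h <;> rcases le_total (y - b) 0 with h' | h' <;>
      simp only [max_eq_left, max_eq_right, h, h'] <;> linarith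
  rcases le_or_gt y a with h1 | h1
  · rw [max_eq_right (by linarith), max_eq_right (by linarith)]
    simpa using hR0
  · rcases le_or_gt b' (y + δ) with h2 | h2
    · rw [max_eq_left (show 0 ≤ y + δ - a' by linarith), 
        max_eq_left (show 0 ≤ y + δ - b' by linarith)]
      have : l / (b' - a') * (y + δ - a' - (y + δ - b')) = l := by
        field_simp; ring
      rw [this]; exact hLl
    · have h3 : y < b := by linarith
      rw [max_eq_left (show 0 ≤ y - a by linarith), max_eq_right (show y - b ≤ 0 by linarith),
        max_eq_left (show 0 ≤ y + δ - a' by linarith), 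
        max_eq_right (show y + δ - b' ≤ 0 by linarith), sub_zero, sub_zero,
        div_mul_eq_mul_div, div_mul_eq_mul_div, mul_div_assoc, mul_div_assoc]
      refine mul_le_mul_of_nonneg_left ?_ hl
      rw [div_le_div_iff₀ d d']
      nlinarith [mul_nonneg (show 0 ≤ a + δ - a' by linarith) (show 0 ≤ b - y by linarith),
        mul_nonneg (show 0 ≤ y - a by linarith) (show 0 ≤ b + δ - b' by linarith)]

lemma cum_cmp1 {N : ℕ} (hN : 0 < N) {r p r' p' : ℕ → ℝ} {l A δ R : ℝ} (hl : 0 ≤ l) (hδ : 0 ≤ δ)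
    (hp : ∀ i < N, p i < p (i + 1)) (hp' : ∀ i < N, p' i < p' (i + 1))
    (hr : ∀ i < N, r i = l / (p (i + 1) - p i)) (hr' : ∀ i < N, r' i = l / (p' (i + 1) - p' i))
    (hA : A ≤ p 0) (hA' : A ≤ p' 0) (hd : ∀ i ≤ N, p' i ≤ p i + δ)
    (hb' : ∀ i < N, 0 < r' i ∧ r' i ≤ R) (y : ℝ) :
    ∫ z in A..y, stp N r p z ≤ (∫ z in A..y, stp N r' p' z) + R * δ := by
  obtain ⟨W, D⟩ := stp_dom hN hp' hb' le_rfl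
  have hii := ii_of_bdd D.meas D.fb
  have h1 : ∫ z in A..y, stp N r p z ≤ ∫ z in A..(y + δ), stp N r' p' z := by
    rw [int_stp hp hA, int_stp hp' hA']
    refine Finset.sum_le_sum fun i hi => ?_
    have hi := Finset.mem_range.1 hi
    rw [hr i hi, hr' i hi]
    exact term_cmp hl (hp i hi) (hp' i hi) (hd i hi.le) (hd (i + 1) hi)
  have h2 := intervalIntegral.integral_interval_sub_left (hii A (y + δ)) (hii A y)
  have h3 := intervalIntegral.norm_integral_le_of_norm_le_const (f := stp N r' p') 
    (a := y) (b := y + δ) (fun z _ => D.fb z)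
  rw [← h2, Real.norm_eq_abs] at h3
  have h4 := le_abs_self ((∫ z in A..(y + δ), stp N r' p' z) - ∫ z in A..y, stp N r' p' z)
  rw [show y + δ - y = δ by ring, abs_of_nonneg hδ] at h3
  linarith

/-! ### The scheme -/

lemma v_bound {R Lv : ℝ} {v : ℝ → ℝ} (hR : 0 < R)
    (hLv : ∀ a ∈ Set.Icc (0 : ℝ) R, ∀ b ∈ Set.Icc (0 : ℝ) R, |v a - v b| ≤ Lv * |a - b|) :
    ∃ C, 0 ≤ C ∧ ∀ a ∈ Set.Icc (0 : ℝ) R, |v a| ≤ C := by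
  have h0 : (0:ℝ) ∈ Set.Icc 0 R := ⟨le_rfl, hR.le⟩
  have hL : 0 ≤ Lv := by
    have := (abs_nonneg _).trans (hLv R ⟨hR.le, le_rfl⟩ 0 h0)
    rw [sub_zero, abs_of_pos hR] at this
    exact nonneg_of_mul_nonneg_left this hR
  refine ⟨|v 0| + Lv * R, by positivity, fun a ha => ?_⟩
  have h1 := hLv a ha 0 h0
  rw [sub_zero, abs_of_nonneg ha.1] at h1
  have h2 := abs_sub_abs_le_abs_sub (v a) (v 0)
  have h3 := mul_le_mul_of_nonneg_left ha.2 hL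
  linarith

lemma scheme_step {N M : ℕ} {l τ θ R C : ℝ} {v : ℝ → ℝ} {x : ℕ → ℕ → ℝ} (hτ : 0 ≤ τ)
    (hR : 0 < R) (hθ : θ ∈ Set.Icc (0 : ℝ) 1)
    (hC : ∀ a ∈ Set.Icc (0 : ℝ) R, |v a| ≤ C)
    (hs : IsScheme N M l τ θ v x)
    (hb : ∀ m ≤ M, ∀ i < N, 0 < Rd N l x i m ∧ Rd N l x i m ≤ R) :
    ∀ m < M, ∀ i ≤ N, |x i (m + 1) - x i m| ≤ C * τ := by
  intro m hm i hi
  rcases hi.eq_or_lt with rfl | hi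
  · rw [hs.2.1 m hm, add_sub_cancel_left, abs_mul, abs_of_nonneg hτ, mul_comm]
    exact mul_le_mul_of_nonneg_right (hC 0 ⟨le_rfl, hR.le⟩) hτ
  · have h1 := hb m hm.le i hi
    have h2 := hb (m + 1) hm i hi
    have e1 := abs_le.1 (hC _ ⟨h1.1.le, h1.2⟩)
    have e2 := abs_le.1 (hC _ ⟨h2.1.le, h2.2⟩)
    rw [hs.2.2 m hm i hi, add_sub_cancel_left, abs_mul, abs_of_nonneg hτ, mul_comm]
    refine mul_le_mul_of_nonneg_right ?_ hτ
    have t0 := hθ.1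
    have t1 : 0 ≤ 1 - θ := by linarith [hθ.2]
    rw [abs_le]
    constructor
    · nlinarith [mul_le_mul_of_nonneg_left e1.1 t0, mul_le_mul_of_nonneg_left e2.1 t1]
    · nlinarith [mul_le_mul_of_nonneg_left e1.2 t0, mul_le_mul_of_nonneg_left e2.2 t1]

lemma scheme_move {N M : ℕ} {K : ℝ} {x : ℕ → ℕ → ℝ}
    (h : ∀ m < M, ∀ i ≤ N, |x i (m + 1) - x i m| ≤ K) {i : ℕ} (hi : i ≤ N) {m m' : ℕ}
    (hmm : m ≤ m') (hm' : m' ≤ M) : |x i m' - x i m| ≤ K * ((m' : ℝ) - m) := by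
  induction m', hmm using Nat.le_induction with
  | base => simp
  | succ m' hmm ih =>
    have h1 := ih (by omega)
    have h2 := h m' (by omega) i hi
    have h3 := abs_sub_le (x i (m' + 1)) (x i m') (x i m)
    push_cast
    linarith

lemma init_bound {N : ℕ} {l B0 : ℝ} {ρb : ℝ → ℝ} {p : ℕ → ℝ} (hint : Integrable ρb)
    (h0 : p 0 ≤ B0) (hz : ∀ z, B0 < z → ρb z = 0)
    (hinit : ∀ i < N, IsLeast {z : ℝ | p i ≤ z ∧ l ≤ ∫ s in (p i)..z, ρb s} (p (i + 1))) :
    ∀ i ≤ N, p i ≤ B0 := by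
  intro i
  induction i with
  | zero => intro _; exact h0
  | succ i ih =>
    intro hi
    have h1 := ih (by omega)
    have h2 := hinit i (by omega)
    by_contra hc
    push Not at hc
    have h3 : ∫ s in (p i)..(p (i + 1)), ρb s = ∫ s in (p i)..B0, ρb s := by
      rw [← intervalIntegral.integral_add_adjacent_intervals (b := B0)
        hint.intervalIntegrable hint.intervalIntegrable]
      have : ∫ s in B0..(p (i + 1)), ρb s = 0 := by
        rw [intervalIntegral.integral_of_le hc.le, 
          setIntegral_congr_fun (g := fun _ => 0) measurableSet_Ioc (fun z hz' => hz z hz'.1)]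
        simp
      rw [this, add_zero]
    have h4 := h2.2 ⟨h1, h3 ▸ h2.1.2⟩
    linarith

lemma discDens_eq_sum (N M : ℕ) (l τ : ℝ) (x : ℕ → ℕ → ℝ) (y t : ℝ) :
    discDens N M l τ x y t = ∑ m ∈ Finset.range M,
      stp N (fun i => Rd N l x i m) (fun i => x i m) y *
      Set.indicator (Set.Ico ((m : ℝ) * τ) (((m : ℝ) + 1) * τ)) (fun _ => (1 : ℝ)) t := by
  unfold discDens stp
  refine Finset.sum_congr rfl fun m _ => ?_
  rw [Finset.sum_mul]

lemma discDens_meas (N M : ℕ) (l τ : ℝ) (x : ℕ → ℕ → ℝ) :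
    Measurable (Function.uncurry (discDens N M l τ x)) := by
  have : Function.uncurry (discDens N M l τ x) = fun p : ℝ × ℝ => ∑ m ∈ Finset.range M,
      stp N (fun i => Rd N l x i m) (fun i => x i m) p.1 *
      Set.indicator (Set.Ico ((m : ℝ) * τ) (((m : ℝ) + 1) * τ)) (fun _ => (1 : ℝ)) p.2 := by
    funext p
    exact discDens_eq_sum N M l τ x p.1 p.2
  rw [this]
  refine Finset.measurable_sum _ fun m _ => ?_
  exact ((stp_meas _ _ _).comp measurable_fst).mul
    ((measurable_const.indicator measurableSet_Ico).comp measurable_snd)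

lemma discDens_eq {N M : ℕ} {l τ : ℝ} (hτ : 0 < τ) {x : ℕ → ℕ → ℝ} {m : ℕ} (hm : m < M)
    {t : ℝ} (ht : t ∈ Set.Ico ((m : ℝ) * τ) (((m : ℝ) + 1) * τ)) :
    (fun y => discDens N M l τ x y t) = stp N (fun i => Rd N l x i m) (fun i => x i m) := by
  funext y
  rw [discDens_eq_sum, Finset.sum_eq_single m]
  · simp [Set.indicator_of_mem ht]
  · intro k _ hkm
    rw [Set.indicator_of_notMem, mul_zero]
    rintro ⟨h1, h2⟩
    have h3 : (k:ℝ) < m + 1 := lt_of_mul_lt_mul_right (h1.trans_lt ht.2) hτ.le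
    have h4 : (m:ℝ) < k + 1 := lt_of_mul_lt_mul_right (ht.1.trans_lt h2) hτ.le
    have h3 : k < m + 1 := by exact_mod_cast h3
    have h4 : m < k + 1 := by exact_mod_cast h4
    omega
  · intro h; exact absurd (Finset.mem_range.2 hm) h

lemma discDens_zero {N M : ℕ} {l τ : ℝ} (hτ : 0 < τ) {x : ℕ → ℕ → ℝ} 
    {t : ℝ} (ht : t < 0 ∨ M * τ ≤ t) :
    (fun y => discDens N M l τ x y t) = fun _ => 0 := by
  funext y
  rw [discDens_eq_sum]
  refine Finset.sum_eq_zero fun m hm => ?_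
  have hm : m + 1 ≤ M := Finset.mem_range.1 hm
  have hm : (m:ℝ) + 1 ≤ M := by exact_mod_cast hm
  rw [Set.indicator_of_notMem, mul_zero]
  rintro ⟨h1, h2⟩
  have := mul_le_mul_of_nonneg_right hm hτ.le
  have := mul_nonneg (Nat.cast_nonneg (α := ℝ) m) hτ.le
  rcases ht with ht | ht <;> linarith

lemma exists_slot {M : ℕ} {τ t : ℝ} (hτ : 0 < τ) (h0 : 0 ≤ t) (h1 : t < M * τ) :
    ∃ m < M, t ∈ Set.Ico ((m : ℝ) * τ) (((m : ℝ) + 1) * τ) := by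
  have e1 : (⌊t / τ⌋₊ : ℝ) * τ ≤ t := by
    rw [← le_div_iff₀ hτ]; exact Nat.floor_le (by positivity)
  refine ⟨⌊t / τ⌋₊, ?_, e1, ?_⟩
  · have : (⌊t / τ⌋₊ : ℝ) < M := lt_of_mul_lt_mul_right (e1.trans_lt h1) hτ.le
    exact_mod_cast this
  · rw [← div_lt_iff₀ hτ]; exact Nat.lt_floor_add_one _

lemma dom_zero {R V : ℝ} (hR : 0 ≤ R) (hV : 0 ≤ V) : Dom R V (fun _ => 0) (fun _ => 0) :=
  ⟨measurable_const, fun _ => ⟨le_rfl, hR⟩, monotone_const, fun _ => ⟨le_rfl, hV⟩, by simp⟩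
theorem discrete_densities_compactness
    (R T L θ Lv : ℝ) (v : ℝ → ℝ) (ρb : ℝ → ℝ)
    (Nn Mn : ℕ → ℕ) (x : ℕ → ℕ → ℕ → ℝ)
    (hR : 0 < R) (hT : 0 < T) (hLpos : 0 < L)
    (hθ : θ ∈ Set.Icc (0 : ℝ) 1)
    (hv : ContDiffOn ℝ 1 v (Set.Icc 0 R))
    (hv' : ∀ ρ ∈ Set.Icc (0 : ℝ) R, derivWithin v (Set.Icc 0 R) ρ < 0)
    (hvleft : ∀ ρ < (0 : ℝ), v ρ = v 0)
    (hvright : ∀ ρ, R < ρ → v ρ = v R)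
    (hLv : ∀ a ∈ Set.Icc (0 : ℝ) R, ∀ b ∈ Set.Icc (0 : ℝ) R, |v a - v b| ≤ Lv * |a - b|)
    (hBV : BoundedVariationOn ρb Set.univ)
    (hsupp : HasCompactSupport ρb)
    (hbound : ∀ᵐ z ∂(volume : Measure ℝ), ρb z ∈ Set.Icc 0 R)
    (hLdef : (∫ z, ρb z) = L)
    (hNpos : ∀ n, 0 < Nn n) (hMpos : ∀ n, 0 < Mn n)
    (hNmono : Monotone Nn) (hMmono : Monotone Mn)
    (hNtop : Tendsto Nn atTop atTop)
    (hCFL : ∀ n, θ * (Nn n) * T * Lv * R ^ 2 < L * (Mn n))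
    (hscheme : ∀ n, IsScheme (Nn n) (Mn n) (L / Nn n) (T / Mn n) θ v (x n))
    (hinit0 : ∀ n, x n 0 0 = sInf (tsupport ρb))
    (hinit : ∀ n, ∀ i < Nn n,
      IsLeast {z : ℝ | x n i 0 ≤ z ∧ L / Nn n ≤ ∫ s in (x n i 0)..z, ρb s} (x n (i + 1) 0))
    (hbnd : ∀ n, ∀ m ≤ Mn n, ∀ i < Nn n,
      0 < Rd (Nn n) (L / Nn n) (x n) i m ∧ Rd (Nn n) (L / Nn n) (x n) i m ≤ R)
    (hTVd : ∀ n, ∀ m ≤ Mn n,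
      TVd (Nn n) (L / Nn n) (x n) m ≤ (eVariationOn ρb Set.univ).toReal) :
    ∃ φ : ℕ → ℕ, StrictMono φ ∧
      ∃ ρ : ℝ → ℝ → ℝ,
        Measurable (Function.uncurry ρ) ∧
        (∃ A B : ℝ, ∀ t ∈ Set.Icc (0 : ℝ) T, ∀ y : ℝ, (y < A ∨ B < y) → ρ y t = 0) ∧
        (∀ t ∈ Set.Icc (0 : ℝ) T, ∀ y : ℝ, ρ y t ∈ Set.Icc 0 R) ∧
        (∀ t ∈ Set.Icc (0 : ℝ) T,
          eVariationOn (fun y => ρ y t) Set.univ ≤ eVariationOn ρb Set.univ) ∧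
        Tendsto
          (fun k => ∫ t in (0 : ℝ)..T, ∫ y : ℝ,
            |discDens (Nn (φ k)) (Mn (φ k)) (L / Nn (φ k)) (T / Mn (φ k)) (x (φ k)) y t -
              ρ y t|)
          atTop (nhds 0) := by
  obtain ⟨C, hC0, hC⟩ := v_bound hR hLv
  have hNr : ∀ n, (0:ℝ) < Nn n := fun n => by exact_mod_cast hNpos n
  have hMr : ∀ n, (0:ℝ) < Mn n := fun n => by exact_mod_cast hMpos n
  have hτ : ∀ n, 0 < T / Mn n := fun n => div_pos hT (hMr n)
  have hMτ : ∀ n, (Mn n : ℝ) * (T / Mn n) = T := fun n => by have := (hMr n).ne'; field_simp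
  have hl : ∀ n, 0 < L / Nn n := fun n => div_pos hLpos (hNr n)
  have hint : Integrable ρb := by
    by_contra h
    rw [integral_undef h] at hLdef
    exact hLpos.ne hLdef
  have hfin : eVariationOn ρb Set.univ ≠ ⊤ := hBV
  set V : ℝ := (eVariationOn ρb Set.univ).toReal with hVdef
  have hV0 : 0 ≤ V := ENNReal.toReal_nonneg
  obtain ⟨b0, hb0⟩ := hsupp.isCompact.bddAbove
  set A0 := sInf (tsupport ρb) with hA0
  set B0 := max b0 A0 with hB0
  have hz : ∀ z, B0 < z → ρb z = 0 := by
    intro z hz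
    by_contra hne
    have h1 : z ≤ b0 := hb0 (subset_tsupport _ hne)
    have h2 : b0 ≤ B0 := le_max_left _ _
    linarith
  have hinc : ∀ n, ∀ m ≤ Mn n, ∀ i < Nn n, x n i m < x n (i + 1) m := fun n => (hscheme n).1
  have hstep := fun n => scheme_step (hτ n).le hR hθ hC (hscheme n) (hbnd n)
  have hmove := fun n {i} (hi : i ≤ Nn n) {m m'} (h1 : m ≤ m') (h2 : m' ≤ Mn n) => 
    scheme_move (hstep n) hi h1 h2
  have hfromzero : ∀ n, ∀ m ≤ Mn n, ∀ i ≤ Nn n, |x n i m - x n i 0| ≤ C * T := by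
    intro n m hm i hi
    refine (hmove n hi (Nat.zero_le m) hm).trans ?_
    have : (m:ℝ) ≤ Mn n := by exact_mod_cast hm
    calc C * (T / Mn n) * ((m:ℝ) - (0:ℕ)) ≤ C * (T / Mn n) * Mn n := by
          refine mul_le_mul_of_nonneg_left ?_ (mul_nonneg hC0 (hτ n).le)
          simpa using this
      _ = C * T := by rw [mul_assoc, mul_comm (T / _), hMτ]
  set A := A0 - C * T with hA
  set B := B0 + C * T with hB
  have hCT : 0 ≤ C * T := by positivity
  have hAB : A ≤ B := by
    have : A0 ≤ B0 := le_max_right _ _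
    linarith
  have hleft : ∀ n, ∀ m ≤ Mn n, A ≤ x n 0 m := by
    intro n m hm
    have := (abs_le.1 (hfromzero n m hm 0 (Nat.zero_le _))).1
    rw [hinit0 n] at this
    linarith
  have hright : ∀ n, ∀ m ≤ Mn n, x n (Nn n) m ≤ B := by
    intro n m hm
    have h1 := (abs_le.1 (hfromzero n m hm (Nn n) le_rfl)).2
    have h2 := init_bound (p := fun i => x n i 0) hint
      (by simp only [hinit0 n]; exact le_max_right _ _) hz (hinit n) (Nn n) le_rfl
    linarith
  have hRd : ∀ n m i, i < Nn n → Rd (Nn n) (L / Nn n) (x n) i m =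
      L / Nn n / (x n (i + 1) m - x n i m) := fun n m i hi => by simp [Rd, hi]
  set D : ℕ → ℝ → ℝ → ℝ := fun n => discDens (Nn n) (Mn n) (L / Nn n) (T / Mn n) (x n) with hD
  have hslot : ∀ n t, 0 ≤ t → t < T → ∃ m < Mn n,
      t ∈ Set.Ico ((m : ℝ) * (T / Mn n)) (((m : ℝ) + 1) * (T / Mn n)) := fun n t h0 h1 => 
    exists_slot (hτ n) h0 (by rw [hMτ]; exact h1)
  have hzero : ∀ n t, (t < 0 ∨ T ≤ t) → (fun y => D n y t) = fun _ => 0 := fun n t ht => 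
    discDens_zero (hτ n) (by rw [hMτ]; exact ht)
  have hst : ∀ n m, m < Mn n → ∀ t, 
      t ∈ Set.Ico ((m : ℝ) * (T / Mn n)) (((m : ℝ) + 1) * (T / Mn n)) →
      (fun y => D n y t) =
      stp (Nn n) (fun i => Rd (Nn n) (L / Nn n) (x n) i m) (fun i => x n i m) := 
    fun n m hm t ht => discDens_eq (hτ n) hm ht
  -- comparison in time
  have hcmp : ∀ n m m', m < Mn n → m' < Mn n → ∀ y,
      ∫ z in A..y, stp (Nn n) (fun i => Rd (Nn n) (L / Nn n) (x n) i m) (fun i => x n i m) z ≤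
      (∫ z in A..y, stp (Nn n) (fun i => Rd (Nn n) (L / Nn n) (x n) i m') (fun i => x n i m') z)
        + R * (C * (T / Mn n) * |(m':ℝ) - m|) := by
    intro n m m' hm hm' y
    refine cum_cmp1 (hNpos n) (hl n).le ?_ (hinc n m hm.le) (hinc n m' hm'.le)
      (fun i hi => hRd n m i hi) (fun i hi => hRd n m' i hi) (hleft n m hm.le) (hleft n m' hm'.le)
      ?_ (hbnd n m' hm'.le) y
    · exact mul_nonneg (mul_nonneg hC0 (hτ n).le) (abs_nonneg _)
    · intro i hi
      rcases le_total m m' with h | h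
      · have h1 := (abs_le.1 (hmove n hi h hm'.le)).2
        have h2 : (m:ℝ) ≤ m' := by exact_mod_cast h
        rw [abs_of_nonneg (by linarith)]
        linarith
      · have h1 := (abs_le.1 (hmove n hi h hm.le)).1
        have h2 : (m':ℝ) ≤ m := by exact_mod_cast h
        rw [abs_of_nonpos (by linarith), neg_sub]
        linarith
  have htc : ∀ n t s, 0 ≤ t → t < T → 0 ≤ s → s < T → ∀ y,
      |(∫ z in A..y, D n z t) - ∫ z in A..y, D n z s| ≤ R * C * (|t - s| + T / Mn n) := by
    intro n t s ht0 ht1 hs0 hs1 y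
    obtain ⟨m, hm, htm⟩ := hslot n t ht0 ht1
    obtain ⟨m', hm', hsm⟩ := hslot n s hs0 hs1
    have e1 := hcmp n m m' hm hm' y
    have e2 := hcmp n m' m hm' hm y
    rw [abs_sub_comm] at e2
    have hτn := hτ n
    have e3 : (T / Mn n) * |(m':ℝ) - m| ≤ |t - s| + T / Mn n := by
      rw [← abs_of_pos hτn, ← abs_mul, abs_of_pos hτn]
      have := abs_le.1 (le_refl |t - s|)
      have q1 := htm.1
      have q2 := htm.2
      have q3 := hsm.1
      have q4 := hsm.2
      rw [abs_le]
      constructor <;> nlinarith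
    have e4 := mul_le_mul_of_nonneg_left e3 (mul_nonneg hR.le hC0)
    rw [hst n m hm t htm, hst n m' hm' s hsm, abs_le]
    constructor <;> nlinarith
  have hcst : ∀ n t s m, m < Mn n → 
      t ∈ Set.Ico ((m : ℝ) * (T / Mn n)) (((m : ℝ) + 1) * (T / Mn n)) →
      s ∈ Set.Ico ((m : ℝ) * (T / Mn n)) (((m : ℝ) + 1) * (T / Mn n)) → 
      (fun y => D n y t) = fun y => D n y s := by
    intro n t s m hm h1 h2
    rw [hst n m hm t h1, hst n m hm s h2]
  obtain ⟨φ, hφ, ρ, h1, h2, h3, h4, h5⟩ := abstract_compact (R := R) (V := V) (A := A) (B := B)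
    (T := T) hR hAB D (fun n => discDens_meas _ _ _ _ _) 
    (by
      intro n t
      by_cases ht : t < 0 ∨ T ≤ t
      · exact ⟨_, (hzero n t ht) ▸ dom_zero hR.le hV0⟩
      · push Not at ht
        obtain ⟨m, hm, htm⟩ := hslot n t ht.1 ht.2
        rw [hst n m hm t htm]
        exact stp_dom (hNpos n) (hinc n m hm.le) (hbnd n m hm.le) (hTVd n m hm.le))
    (by
      intro n t y hy
      by_cases ht : t < 0 ∨ T ≤ t
      · exact congrFun (hzero n t ht) y
      · push Not at ht
        obtain ⟨m, hm, htm⟩ := hslot n t ht.1 ht.2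
        refine (congrFun (hst n m hm t htm) y).trans ?_
        exact stp_supp (hinc n m hm.le) (hleft n m hm.le) (hright n m hm.le) hy)
    (by
      intro t ε hε
      by_cases ht : t < 0 ∨ T ≤ t
      · refine ⟨2, Eventually.of_forall fun n y => ?_⟩
        rw [hzero n t ht, hzero n (T * (2:ℚ)) (Or.inr (by push_cast; linarith))]
        simpa using hε.le
      push Not at ht
      by_cases hMt : Tendsto Mn atTop atTop
      · have hRC : 0 ≤ R * C := mul_nonneg hR.le hC0
        set δ := ε / (2 * (R * C + 1)) with hδ
        have hδ0 : 0 < δ := by positivity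
        have hτ0 : Tendsto (fun n => T / (Mn n : ℝ)) atTop (nhds 0) :=
          (tendsto_natCast_atTop_atTop.comp hMt).const_div_atTop T
        obtain ⟨r, hr1, hr2⟩ := exists_rat_btwn (show t / T < min 1 ((t + δ) / T) by
          refine lt_min ((div_lt_one hT).2 ht.2) ?_
          gcongr; linarith)
        have a1 : t < T * r := by rw [div_lt_iff₀ hT] at hr1; linarith
        have a2 : T * r < T := by nlinarith [hr2.trans_le (min_le_left _ _)]
        have a3 : T * r < t + δ := by
          have := hr2.trans_le (min_le_right _ _)
          rw [lt_div_iff₀ hT] at this; linarith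
        refine ⟨r, ?_⟩
        filter_upwards [hτ0.eventually_lt_const hδ0] with n hn y
        refine (htc n t (T * r) ht.1 ht.2 (by linarith [ht.1]) a2 y).trans ?_
        rw [abs_of_neg (by linarith)]
        calc R * C * (-(t - T * r) + T / Mn n) ≤ (R * C + 1) * (δ + δ) := by
              gcongr
              · have := hτ n; linarith
              · linarith
              · linarith
          _ = ε := by rw [hδ]; field_simp; ring
      · -- `Mn` is eventually constant
        obtain ⟨n0, hn0⟩ : ∃ n0, ∀ n ≥ n0, Mn n = Mn n0 := by
          have hbd : ∃ b, ∀ n, Mn n < b := by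
            by_contra hc
            push Not at hc
            exact hMt (tendsto_atTop_atTop_of_monotone hMmono hc)
          obtain ⟨b, hb⟩ := hbd
          have hfinr : (Set.range Mn).Finite :=
            (Set.finite_Iio b).subset (by rintro _ ⟨n, rfl⟩; exact hb n)
          obtain ⟨_, ⟨n0, rfl⟩, hmax⟩ := hfinr.exists_maximal (Set.range_nonempty Mn)
          exact ⟨n0, fun n hn => le_antisymm (hmax ⟨n, rfl⟩ (hMmono hn)) (hMmono hn)⟩
        obtain ⟨m, hm, htm⟩ := hslot n0 t ht.1 ht.2
        refine ⟨(m : ℚ) / (Mn n0 : ℚ), eventually_atTop.2 ⟨n0, fun n hn y => ?_⟩⟩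
        have e := hn0 n hn
        rw [← e] at hm htm ⊢
        have es : T * (((m : ℚ) / (Mn n : ℚ) : ℚ) : ℝ) = m * (T / Mn n) := by
          push_cast; ring
        rw [es, hcst n t (m * (T / Mn n)) m hm htm ⟨le_rfl, by have := hτ n; nlinarith⟩]
        simpa using hε.le)
  refine ⟨φ, hφ, ρ, h1, ⟨A, B, fun t _ y hy => h2 t y hy⟩, fun t _ y => h3 t y, fun t _ => ?_, h5⟩
  refine (h4 t).trans ?_
  rw [hVdef, ENNReal.ofReal_toReal hfin]
end
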